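/- Let S ⊂ ℝⁿ (n ≥ 2) be a centrally symmetric convex body with C² boundary whose Gauss curvature is strictly positive at every boundary point (class C²₊). Then the limit lim_{δ→0} (d_S(δ) − 1)/δ^{2/(n+1)} exists and equals G_max − G_min. -/

import Mathlib

open MeasureTheory Metric Set Filter
open scoped RealInnerProductSpace Pointwise Topology

noncomputable section

abbrev Euc (n : ℕ) : Type := EuclideanSpace ℝ (Fin n)

/-- A centrally symmetric convex body in `ℝⁿ`. -/
def IsSymConvexBody {n : ℕ} (S : Set (Euc n)) : Prop :=
  IsCompact S ∧ Convex ℝ S ∧ (interior S).Nonempty ∧ S = -S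

/-- The convex floating body `K_δ`: the intersection of all closed halfspaces whose bounding
hyperplane cuts off a set of volume at most `δ·|K|ₙ` from `K`. -/
def floatingBody {n : ℕ} (K : Set (Euc n)) (δ : ℝ) : Set (Euc n) :=
  ⋂ (v : Euc n) (_ : v ≠ 0) (c : ℝ)
    (_ : volume (K ∩ {y | c ≤ ⟪v, y⟫}) ≤ ENNReal.ofReal δ * volume K),
    {y | ⟪v, y⟫ ≤ c}

/-- The illumination body `K^δ`. -/
def illuminationBody {n : ℕ} (K : Set (Euc n)) (δ : ℝ) : Set (Euc n) :=
  {x | volume (convexHull ℝ (K ∪ {x})) ≤ ENNReal.ofReal (1 + δ) * volume K}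

/-- The polar body `K°`. -/
def polarBody {n : ℕ} (K : Set (Euc n)) : Set (Euc n) :=
  {y | ∀ x ∈ K, ⟪x, y⟫ ≤ 1}

/-- The distance `d(C₁, C₂) = inf {a ≥ 1 : a⁻¹ C₁ ⊆ C₂ ⊆ a C₁}`. -/
def bodyDist {n : ℕ} (C₁ C₂ : Set (Euc n)) : ℝ :=
  sInf {a : ℝ | 1 ≤ a ∧ a⁻¹ • C₁ ⊆ C₂ ∧ C₂ ⊆ a • C₁}

/-- `d_C(δ) = inf_{δ' > 0} d(C_δ, ((C°)^{δ'})°)`. -/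
def dualDist {n : ℕ} (C : Set (Euc n)) (δ : ℝ) : ℝ :=
  sInf {r : ℝ | ∃ δ' > (0:ℝ), r = bodyDist (floatingBody C δ)
      (polarBody (illuminationBody (polarBody C) δ'))}

/-- `ν` is an outer unit normal of `S` at `x`. -/
def IsOuterNormalAt {n : ℕ} (S : Set (Euc n)) (x ν : Euc n) : Prop :=
  ‖ν‖ = 1 ∧ ∀ y ∈ S, ⟪y, ν⟫ ≤ ⟪x, ν⟫

/-- Near `x ∈ ∂S`, the boundary of `S` is the graph of a `C²` function `f` over the tangent
hyperplane at `x` (embedded via a linear isometry `L` orthogonal to the normal `ν`), with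
`f 0 = 0` and vanishing derivative at `0`, and `k` is the determinant of the Hessian of `f`
at `0`, i.e. the Gauss curvature of `∂S` at `x`. -/
def IsGaussCurvatureAt {n : ℕ} (S : Set (Euc n)) (x ν : Euc n) (k : ℝ) : Prop :=
  ∃ (L : Euc (n-1) →ₗᵢ[ℝ] Euc n) (f : Euc (n-1) → ℝ) (τ ε : ℝ),
    0 < τ ∧ 0 < ε ∧
    (∀ v, ⟪L v, ν⟫ = 0) ∧
    ContDiffOn ℝ 2 f (ball 0 τ) ∧
    f 0 = 0 ∧ fderiv ℝ f 0 = 0 ∧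
    frontier S ∩ ball x ε
      = {y | ∃ v ∈ ball (0 : Euc (n-1)) τ, y = x + L v - f v • ν} ∩ ball x ε ∧
    k = (Matrix.of fun i j : Fin (n-1) =>
      iteratedFDeriv ℝ 2 f 0 ![EuclideanSpace.single i 1, EuclideanSpace.single j 1]).det

/-- `S` has `C²` boundary, with outer unit normal map `u` and Gauss curvature function `κ`. -/
def IsC2Body {n : ℕ} (S : Set (Euc n)) (u : Euc n → Euc n) (κ : Euc n → ℝ) : Prop :=
  ∀ x ∈ frontier S, IsOuterNormalAt S x (u x) ∧ IsGaussCurvatureAt S x (u x) (κ x)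

/-- The constant `c(K, n) = ((n+1)^{2/(n+1)}/2)·(|K|ₙ/|B₂^{n−1}|_{n−1})^{2/(n+1)}`. -/
def cConst (n : ℕ) (K : Set (Euc n)) : ℝ :=
  ((n + 1 : ℝ) ^ ((2:ℝ)/(n+1)) / 2) *
    ((volume K).toReal / (volume (ball (0 : Euc (n-1)) 1)).toReal) ^ ((2:ℝ)/(n+1))

/-- The function `G_S(x) = c(S,n)·κ(x)^{1/(n+1)} / ⟨x, u(x)⟩`. -/
def Gfun {n : ℕ} (S : Set (Euc n)) (u : Euc n → Euc n) (κ : Euc n → ℝ) (x : Euc n) : ℝ :=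
  cConst n S * (κ x) ^ ((1:ℝ)/(n+1)) / ⟪x, u x⟫

/-- The orthogonal projection onto the hyperplane orthogonal to the unit vector `e`. -/
def perp {n : ℕ} (e : Euc n) : Euc n →L[ℝ] Euc n :=
  ContinuousLinearMap.id ℝ (Euc n) - (innerSL ℝ e).smulRight e

lemma perp_apply {n : ℕ} (e w : Euc n) : perp e w = w - ⟪e, w⟫ • e := by
  simp [perp]

lemma inner_perp {n : ℕ} {e : Euc n} (he : ‖e‖ = 1) (w : Euc n) : ⟪e, perp e w⟫ = 0 := by
  rw [perp_apply, inner_sub_right, inner_smul_right, real_inner_self_eq_norm_sq, he]; ring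

lemma perp_self {n : ℕ} {e : Euc n} (he : ‖e‖ = 1) : perp e e = 0 := by
  rw [perp_apply, real_inner_self_eq_norm_sq, he]; simp

lemma perp_perp {n : ℕ} {e : Euc n} (he : ‖e‖ = 1) (w : Euc n) :
    perp e (perp e w) = perp e w := by
  rw [perp_apply e (perp e w), inner_perp he]; simp

lemma norm_sq_eq_perp {n : ℕ} {e : Euc n} (he : ‖e‖ = 1) (w : Euc n) :
    ‖w‖ ^ 2 = ‖perp e w‖ ^ 2 + ⟪e, w⟫ ^ 2 := by
  have h : w = perp e w + ⟪e, w⟫ • e := by rw [perp_apply]; abel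
  have h2 : ‖perp e w + ⟪e, w⟫ • e‖ ^ 2 = ‖perp e w‖ ^ 2 + ⟪e, w⟫ ^ 2 := by
    rw [norm_add_sq_real, inner_smul_right, real_inner_comm e, inner_perp he, norm_smul, he]
    simp
  rw [← h2, ← h]

lemma norm_perp_le {n : ℕ} {e : Euc n} (he : ‖e‖ = 1) (w : Euc n) : ‖perp e w‖ ≤ ‖w‖ := by
  have := norm_sq_eq_perp he w
  exact abs_le_of_sq_le_sq' (by nlinarith [sq_nonneg ⟪e, w⟫]) (norm_nonneg _) |>.2

/-- The map scaling the hyperplane orthogonal to `e` by `a` and the direction `e` by `b`. -/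
def aniso {n : ℕ} (e : Euc n) (a b : ℝ) : Euc n →L[ℝ] Euc n :=
  a • perp e + b • (innerSL ℝ e).smulRight e

lemma aniso_apply {n : ℕ} (e : Euc n) (a b : ℝ) (w : Euc n) :
    aniso e a b w = a • perp e w + (b * ⟪e, w⟫) • e := by
  simp [aniso, mul_smul]

lemma perp_aniso {n : ℕ} {e : Euc n} (he : ‖e‖ = 1) (a b : ℝ) (w : Euc n) :
    perp e (aniso e a b w) = a • perp e w := by
  rw [aniso_apply, map_add, map_smul, map_smul, perp_perp he, perp_self he]; simp

lemma inner_aniso {n : ℕ} {e : Euc n} (he : ‖e‖ = 1) (a b : ℝ) (w : Euc n) :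
    ⟪e, aniso e a b w⟫ = b * ⟪e, w⟫ := by
  rw [aniso_apply, inner_add_right, inner_smul_right, inner_smul_right, inner_perp he,
    real_inner_self_eq_norm_sq, he]; ring

lemma aniso_comp {n : ℕ} {e : Euc n} (he : ‖e‖ = 1) (a b a' b' : ℝ) (w : Euc n) :
    aniso e a b (aniso e a' b' w) = aniso e (a * a') (b * b') w := by
  rw [aniso_apply, perp_aniso he, inner_aniso he, aniso_apply, smul_smul, mul_assoc]

lemma aniso_one {n : ℕ} (e w : Euc n) : aniso e 1 1 w = w := by
  rw [aniso_apply, perp_apply]; simp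

lemma det_aniso {n : ℕ} (hn : 1 ≤ n) {e : Euc n} (he : ‖e‖ = 1) {a : ℝ} (ha : a ≠ 0) (b : ℝ) :
    LinearMap.det (aniso e a b : Euc n →ₗ[ℝ] Euc n) = a ^ (n - 1) * b := by
  have h : (aniso e a b : Euc n →ₗ[ℝ] Euc n)
      = a • LinearMap.transvection (innerSL ℝ e : Euc n →ₗ[ℝ] ℝ) (((b - a) / a) • e) := by
    ext w : 1
    simp only [ContinuousLinearMap.coe_coe, aniso_apply, perp_apply, LinearMap.smul_apply,
      LinearMap.transvection.apply, innerSL_apply_apply, smul_add, smul_smul, smul_sub]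
    have : a * (⟪e, w⟫ * ((b - a) / a)) = b * ⟪e, w⟫ - a * ⟪e, w⟫ := by field_simp
    rw [this, sub_smul]; abel
  rw [h, LinearMap.det_smul, LinearMap.transvection.det]
  simp only [finrank_euclideanSpace_fin, ContinuousLinearMap.coe_coe, innerSL_apply_apply,
    inner_smul_right, real_inner_self_eq_norm_sq, he]
  obtain ⟨k, rfl⟩ : ∃ k, n = k + 1 := ⟨n - 1, by omega⟩
  simp only [Nat.add_sub_cancel, pow_succ]
  field_simp
  ring

/-- The solid paraboloid with vertex `0` and inner normal `-e`. -/
def para {n : ℕ} (e : Euc n) (c : ℝ) : Set (Euc n) :=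
  {w | c / 2 * ‖perp e w‖ ^ 2 ≤ -⟪e, w⟫}

/-- The cap of height `h` of the paraboloid. -/
def paraCap {n : ℕ} (e : Euc n) (c h : ℝ) : Set (Euc n) :=
  para e c ∩ {w | -⟪e, w⟫ ≤ h}

/-- The region between the paraboloid and its hull with an exterior point at height `h`. -/
def paraHat {n : ℕ} (e : Euc n) (c h : ℝ) : Set (Euc n) :=
  convexHull ℝ (para e c ∪ {h • e}) \ para e c

lemma volume_image_real {n : ℕ} (f : Euc n →L[ℝ] Euc n) (s : Set (Euc n)) :
    volume.real (f '' s) = |LinearMap.det (f : Euc n →ₗ[ℝ] Euc n)| * volume.real s := by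
  have := Measure.addHaar_image_linearMap (volume : Measure (Euc n)) (f : Euc n →ₗ[ℝ] Euc n) s
  simp only [ContinuousLinearMap.coe_coe] at this
  rw [Measure.real, this, ENNReal.toReal_mul, ENNReal.toReal_ofReal (abs_nonneg _), Measure.real]

lemma mem_image_aniso {n : ℕ} {e : Euc n} (he : ‖e‖ = 1) {a b : ℝ} (ha : a ≠ 0) (hb : b ≠ 0)
    (s : Set (Euc n)) (w : Euc n) : w ∈ aniso e a b '' s ↔ aniso e a⁻¹ b⁻¹ w ∈ s := by
  constructor
  · rintro ⟨v, hv, rfl⟩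
    rw [aniso_comp he, inv_mul_cancel₀ ha, inv_mul_cancel₀ hb, aniso_one]; exact hv
  · intro h
    exact ⟨_, h, by rw [aniso_comp he, mul_inv_cancel₀ ha, mul_inv_cancel₀ hb, aniso_one]⟩

lemma para_image {n : ℕ} {e : Euc n} (he : ‖e‖ = 1) {c h : ℝ} (hc : 0 < c) (hh : 0 < h) :
    aniso e (√(h / c)) h '' para e 1 = para e c := by
  have h1 : 0 < √(h / c) := Real.sqrt_pos.2 (by positivity)
  ext w
  rw [mem_image_aniso he h1.ne' hh.ne']
  simp only [para, mem_ofPred_eq, perp_aniso he, inner_aniso he, norm_smul, mul_pow]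
  rw [Real.norm_eq_abs, sq_abs, inv_pow, Real.sq_sqrt (by positivity)]
  rw [← mul_neg, inv_mul_eq_div h, le_div_iff₀ hh]
  have : 1 / 2 * ((h / c)⁻¹ * ‖perp e w‖ ^ 2) * h = c / 2 * ‖perp e w‖ ^ 2 := by field_simp
  rw [this]

lemma paraCap_image {n : ℕ} {e : Euc n} (he : ‖e‖ = 1) {c h : ℝ} (hc : 0 < c) (hh : 0 < h) :
    aniso e (√(h / c)) h '' paraCap e 1 1 = paraCap e c h := by
  have h1 : 0 < √(h / c) := Real.sqrt_pos.2 (by positivity)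
  have hp := para_image he hc hh
  ext w
  rw [mem_image_aniso he h1.ne' hh.ne', paraCap, paraCap, mem_inter_iff, mem_inter_iff, ← hp,
    mem_image_aniso he h1.ne' hh.ne']
  simp only [mem_ofPred_eq, inner_aniso he]
  rw [← mul_neg, inv_mul_eq_div h, div_le_one hh]

lemma paraHat_image {n : ℕ} {e : Euc n} (he : ‖e‖ = 1) {c h : ℝ} (hc : 0 < c) (hh : 0 < h) :
    aniso e (√(h / c)) h '' paraHat e 1 1 = paraHat e c h := by
  have h1 : 0 < √(h / c) := Real.sqrt_pos.2 (by positivity)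
  have inj : Function.Injective (aniso e (√(h / c)) h) := by
    intro x y hxy
    have := congrArg (aniso e (√(h / c))⁻¹ h⁻¹) hxy
    rwa [aniso_comp he, aniso_comp he, inv_mul_cancel₀ h1.ne', inv_mul_cancel₀ hh.ne', aniso_one,
      aniso_one] at this
  rw [paraHat, paraHat, image_sdiff inj, para_image he hc hh]
  congr 1
  have := (aniso e (√(h / c)) h : Euc n →ₗ[ℝ] Euc n).image_convexHull (para e 1 ∪ {(1:ℝ) • e})
  simp only [ContinuousLinearMap.coe_coe] at this
  rw [this, image_union, para_image he hc hh, image_singleton]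
  congr
  rw [one_smul, aniso_apply, perp_self he, real_inner_self_eq_norm_sq, he]; simp

lemma sqrt_pow_mul {n : ℕ} (hn : 1 ≤ n) {c h : ℝ} (hc : 0 < c) (hh : 0 < h) :
    √(h / c) ^ (n - 1) * h = c ^ (-((n:ℝ) - 1) / 2) * h ^ (((n:ℝ) + 1) / 2) := by
  rw [Real.sqrt_eq_rpow, ← Real.rpow_natCast, ← Real.rpow_mul (by positivity),
    Real.div_rpow hh.le hc.le]
  push_cast [Nat.cast_sub hn]
  have h2 : h ^ (((n:ℝ) + 1) / 2) = h ^ (1 / 2 * ((n:ℝ) - 1)) * h := by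
    nth_rw 3 [← Real.rpow_one h]
    rw [← Real.rpow_add hh]; congr 1; ring
  rw [h2, show -((n:ℝ) - 1) / 2 = -(1 / 2 * ((n:ℝ) - 1)) by ring, Real.rpow_neg hc.le]
  field_simp

lemma volume_paraCap {n : ℕ} (hn : 1 ≤ n) {e : Euc n} (he : ‖e‖ = 1) {c h : ℝ} (hc : 0 < c)
    (hh : 0 < h) : volume.real (paraCap e c h)
      = c ^ (-((n:ℝ) - 1) / 2) * h ^ (((n:ℝ) + 1) / 2) * volume.real (paraCap e 1 1) := by
  rw [← paraCap_image he hc hh, volume_image_real, det_aniso hn he, sqrt_pow_mul hn hc hh,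
    abs_of_pos (by positivity)]
  exact (Real.sqrt_pos.2 (by positivity)).ne'

lemma volume_paraHat {n : ℕ} (hn : 1 ≤ n) {e : Euc n} (he : ‖e‖ = 1) {c h : ℝ} (hc : 0 < c)
    (hh : 0 < h) : volume.real (paraHat e c h)
      = c ^ (-((n:ℝ) - 1) / 2) * h ^ (((n:ℝ) + 1) / 2) * volume.real (paraHat e 1 1) := by
  rw [← paraHat_image he hc hh, volume_image_real, det_aniso hn he, sqrt_pow_mul hn hc hh,
    abs_of_pos (by positivity)]
  exact (Real.sqrt_pos.2 (by positivity)).ne'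

lemma para_anti {n : ℕ} (e : Euc n) {c c' : ℝ} (h : c ≤ c') : para e c' ⊆ para e c := by
  intro w hw
  have : 0 ≤ ‖perp e w‖ ^ 2 := by positivity
  simp only [para, mem_ofPred_eq] at *
  nlinarith

lemma isClosed_para {n : ℕ} (e : Euc n) (c : ℝ) : IsClosed (para e c) :=
  isClosed_le (by fun_prop) (by fun_prop)

lemma isClosed_paraCap {n : ℕ} (e : Euc n) (c h : ℝ) : IsClosed (paraCap e c h) :=
  (isClosed_para e c).inter (isClosed_le (by fun_prop) (by fun_prop))

lemma convex_para {n : ℕ} (e : Euc n) {c : ℝ} (hc : 0 ≤ c) : Convex ℝ (para e c) := by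
  have h1 : ConvexOn ℝ univ (fun w : Euc n => ‖perp e w‖ ^ 2) := by
    have := (convexOn_norm (E := Euc n) convex_univ).comp_linearMap
      (perp e : Euc n →ₗ[ℝ] Euc n)
    exact this.pow (fun _ _ => norm_nonneg _) 2
  have h2 : ConvexOn ℝ univ (fun w : Euc n => c / 2 * ‖perp e w‖ ^ 2 + ⟪e, w⟫) := by
    refine (h1.smul (by positivity : 0 ≤ c / 2)).add ?_
    exact (innerSL ℝ e : Euc n →ₗ[ℝ] ℝ).convexOn convex_univ
  have := h2.convex_le 0
  convert this using 1
  ext w; simp only [para, mem_ofPred_eq, mem_univ, true_and]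
  constructor <;> intro h <;> linarith

lemma norm_sq_le_of_mem_paraCap {n : ℕ} {e : Euc n} (he : ‖e‖ = 1) {c h : ℝ} (hc : 0 < c)
    {w : Euc n} (hw : w ∈ paraCap e c h) : ‖w‖ ^ 2 ≤ 2 / c * h + h ^ 2 := by
  obtain ⟨h1, h2⟩ := hw
  simp only [para, mem_ofPred_eq] at h1 h2
  rw [norm_sq_eq_perp he]
  have h0 : 0 ≤ c / 2 * ‖perp e w‖ ^ 2 := by positivity
  have h3 : ‖perp e w‖ ^ 2 ≤ 2 / c * h := by
    rw [div_mul_eq_mul_div, le_div_iff₀ hc]; linarith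
  nlinarith

lemma isBounded_paraCap {n : ℕ} {e : Euc n} (he : ‖e‖ = 1) {c h : ℝ} (hc : 0 < c) :
    Bornology.IsBounded (paraCap e c h) := by
  refine (isBounded_iff_forall_norm_le).2 ⟨√(2 / c * h + h ^ 2), fun w hw => ?_⟩
  exact Real.le_sqrt_of_sq_le (norm_sq_le_of_mem_paraCap he hc hw)

lemma volume_paraCap_ne_top {n : ℕ} {e : Euc n} (he : ‖e‖ = 1) {c h : ℝ} (hc : 0 < c) :
    volume (paraCap e c h) ≠ ⊤ := (isBounded_paraCap he hc).measure_lt_top.ne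

lemma volume_paraCap_pos {n : ℕ} {e : Euc n} (he : ‖e‖ = 1) :
    0 < volume.real (paraCap e 1 1) := by
  have hopen : IsOpen {w : Euc n | 1 / 2 * ‖perp e w‖ ^ 2 < -⟪e, w⟫ ∧ -⟪e, w⟫ < 1} :=
    IsOpen.and (isOpen_lt (by fun_prop) (by fun_prop)) (isOpen_lt (by fun_prop) (by fun_prop))
  have hne : {w : Euc n | 1 / 2 * ‖perp e w‖ ^ 2 < -⟪e, w⟫ ∧ -⟪e, w⟫ < 1}.Nonempty := by
    refine ⟨(-(1/2) : ℝ) • e, ?_⟩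
    simp only [mem_ofPred_eq, map_smul, perp_self he, inner_smul_right,
      real_inner_self_eq_norm_sq, he]
    norm_num
  have := hopen.measure_pos volume hne
  refine ENNReal.toReal_pos (this.trans_le (measure_mono ?_)).ne'
    (volume_paraCap_ne_top he one_pos)
  exact fun w hw => ⟨hw.1.le, hw.2.le⟩

lemma volume_paraCap_one_one {k n : ℕ} (I : WithLp 2 (Euc k × ℝ) ≃ₗᵢ[ℝ] Euc n) :
    volume.real (paraCap (I (WithLp.toLp 2 (0, 1))) 1 1)
      = volume.real (ball (0 : Euc k) 1) * 2 ^ (((k:ℝ) + 2) / 2) / (k + 2) := by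
  set e := I (WithLp.toLp 2 (0, 1)) with he_def
  have he : ‖e‖ = 1 := by
    rw [he_def, I.norm_map, WithLp.prod_norm_eq_of_L2]; simp
  have hinner : ∀ p : Euc k × ℝ, ⟪e, I (WithLp.toLp 2 p)⟫ = p.2 := by
    intro p
    rw [he_def, I.inner_map_map, WithLp.prod_inner_apply]; simp
  have hperp : ∀ p : Euc k × ℝ, ‖perp e (I (WithLp.toLp 2 p))‖ ^ 2 = ‖p.1‖ ^ 2 := by
    intro p
    have h1 := norm_sq_eq_perp he (I (WithLp.toLp 2 p))
    rw [hinner, I.norm_map, WithLp.prod_norm_sq_eq_of_L2] at h1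
    simp at h1
    rw [h1]
  have hmp : MeasurePreserving (fun p : Euc k × ℝ => I (WithLp.toLp 2 p)) :=
    I.measurePreserving.comp (WithLp.volume_preserving_toLp (Euc k) ℝ)
  have hmeas : MeasurableSet (paraCap e 1 1) := (isClosed_paraCap e 1 1).measurableSet
  have hpre : (fun p : Euc k × ℝ => I (WithLp.toLp 2 p)) ⁻¹' (paraCap e 1 1)
      = {p : Euc k × ℝ | 1 / 2 * ‖p.1‖ ^ 2 ≤ -p.2 ∧ -p.2 ≤ 1} := by
    ext p
    simp only [paraCap, para, mem_preimage, mem_inter_iff, mem_ofPred_eq, hinner, hperp]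
  have hvol : volume (paraCap e 1 1)
      = ∫⁻ t in Icc (-1:ℝ) 0, ENNReal.ofReal (√(2 * -t) ^ k) * volume (ball (0 : Euc k) 1) := by
    rw [← hmp.measure_preimage hmeas.nullMeasurableSet, Measure.volume_eq_prod,
      Measure.prod_apply_symm (hmp.measurable hmeas), hpre, ← lintegral_indicator measurableSet_Icc]
    refine lintegral_congr fun t => ?_
    by_cases ht : t ∈ Icc (-1:ℝ) 0
    · rw [indicator_of_mem ht]
      have : (fun x : Euc k => (x, t)) ⁻¹' {p : Euc k × ℝ | 1 / 2 * ‖p.1‖ ^ 2 ≤ -p.2 ∧ -p.2 ≤ 1}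
          = closedBall 0 (√(2 * -t)) := by
        ext x
        simp only [mem_preimage, mem_ofPred_eq, mem_closedBall, dist_zero_right]
        rw [Real.le_sqrt (norm_nonneg _) (by linarith [ht.2])]
        constructor
        · intro h; linarith [h.1]
        · intro h; exact ⟨by linarith, by linarith [ht.1]⟩
      rw [this, Measure.addHaar_closedBall _ _ (Real.sqrt_nonneg _)]
      simp
    · rw [indicator_of_notMem ht]
      convert measure_empty (μ := (volume : Measure (Euc k)))
      ext x
      simp only [mem_preimage, mem_ofPred_eq, mem_empty_iff_false, iff_false]
      rintro ⟨h1, h2⟩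
      exact ht ⟨by linarith, by nlinarith [sq_nonneg ‖x‖]⟩
  have hint : ∫ t in Icc (-1:ℝ) 0, √(2 * -t) ^ k = 2 ^ (((k:ℝ) + 2) / 2) / (k + 2) := by
    rw [integral_Icc_eq_integral_Ioc, ← intervalIntegral.integral_of_le (by norm_num)]
    rw [intervalIntegral.integral_comp_neg (fun t => √(2 * t) ^ k)]
    have : ∀ t : ℝ, √(2 * t) ^ k = if 0 ≤ t then (2:ℝ) ^ ((k:ℝ)/2) * t ^ ((k:ℝ) / 2)
        else √(2 * t) ^ k := by
      intro t
      split_ifs with h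
      · rw [Real.sqrt_eq_rpow, ← Real.rpow_natCast, ← Real.rpow_mul (by positivity),
          Real.mul_rpow (by norm_num) h]
        congr 2 <;> ring
      · rfl
    have h2 : ∫ t in (-0:ℝ)..(-(-1)), √(2 * t) ^ k
        = ∫ t in (0:ℝ)..1, (2:ℝ) ^ ((k:ℝ)/2) * t ^ ((k:ℝ) / 2) := by
      norm_num only [neg_zero, neg_neg]
      refine intervalIntegral.integral_congr fun t ht => ?_
      rw [uIcc_of_le zero_le_one] at ht
      exact (this t).trans (if_pos ht.1)
    have hk : (0:ℝ) ≤ k := Nat.cast_nonneg k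
    rw [h2, intervalIntegral.integral_const_mul, integral_rpow (Or.inl (by linarith))]
    rw [Real.one_rpow, Real.zero_rpow (by positivity),
      show ((k:ℝ) + 2) / 2 = k / 2 + 1 by ring, Real.rpow_add (by norm_num), Real.rpow_one]
    field_simp
    ring
  rw [lintegral_mul_const _ (by fun_prop), ← ofReal_integral_eq_lintegral_ofReal] at hvol
  · rw [Measure.real, hvol, hint, ENNReal.toReal_mul, ENNReal.toReal_ofReal (by positivity),
      Measure.real]
    ring
  · exact (by fun_prop : Continuous fun t : ℝ => √(2 * -t) ^ k).continuousOn.integrableOn_Icc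
  · exact Eventually.of_forall fun t => by positivity

/-- Points of a cap-shaped neighbourhood see all of the hull outside of a closed convex set. -/
lemma exists_mem_window {n : ℕ} {K Win : Set (Euc n)} {m : Euc n} (hc : IsClosed K)
    (hconv : Convex ℝ K)
    (hW : ∀ k ∈ K, k ∉ Win → ∃ θ : ℝ, 0 ≤ θ ∧ θ < 1 ∧ θ • k + (1 - θ) • m ∈ K) {w : Euc n}
    (hw : w ∈ convexHull ℝ (K ∪ {m}) \ K) : w = m ∨ ∃ k ∈ K, k ∈ Win ∧ w ∈ segment ℝ k m := by
  obtain ⟨hw1, hw2⟩ := hw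
  rcases K.eq_empty_or_nonempty with rfl | hne
  · left; simpa using hw1
  rw [union_singleton, convexHull_insert hne, hconv.convexHull_eq, mem_convexJoin] at hw1
  obtain ⟨m', hm', k, hk, hseg⟩ := hw1
  rw [mem_singleton_iff] at hm'
  subst hm'
  rw [segment_symm, segment_eq_image] at hseg
  obtain ⟨t, ht, rfl⟩ := hseg
  set T : Set ℝ := Icc 0 1 ∩ (fun t : ℝ => (1 - t) • k + t • m') ⁻¹' K with hT
  have hTc : IsCompact T := isCompact_Icc.inter_right (hc.preimage (by fun_prop))
  have hTne : T.Nonempty := ⟨0, by simp, by simpa using hk⟩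
  obtain ⟨t₀, ht₀, hmax⟩ := hTc.exists_isGreatest hTne
  have hlt : t₀ < t := by
    by_contra hle
    push Not at hle
    apply hw2
    rcases eq_or_lt_of_le ht.1 with h0 | h0
    · simp only [← h0]; simpa using hk
    have h0' : 0 < t₀ := h0.trans_le hle
    have := hconv hk ht₀.2 (sub_nonneg.2 ((div_le_one h0').2 hle))
      (div_nonneg ht.1 h0'.le) (by ring)
    convert this using 1
    simp only [smul_add, smul_smul]
    rw [← add_assoc, ← add_smul]
    congr 2 <;> field_simp
    ring
  right
  refine ⟨_, ht₀.2, ?_, ?_⟩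
  · by_contra hnw
    obtain ⟨θ, hθ0, hθ1, hmem⟩ := hW _ ht₀.2 hnw
    have h1 : t₀ < 1 := hlt.trans_le ht.2
    have : t₀ + (1 - θ) * (1 - t₀) ∈ T := by
      refine ⟨⟨by nlinarith [ht₀.1.1], by nlinarith⟩, ?_⟩
      simp only [mem_preimage]
      convert hmem using 1
      simp only [smul_add, smul_smul]
      rw [add_assoc, ← add_smul]
      congr 2 <;> ring
    have := hmax this
    nlinarith
  · have h1 : t₀ < 1 := hlt.trans_le ht.2
    rw [segment_eq_image]
    refine ⟨(t - t₀) / (1 - t₀), ⟨div_nonneg (by linarith) (by linarith),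
      (div_le_one (by linarith)).2 (by linarith [ht.2])⟩, ?_⟩
    have h1' : 1 - t₀ ≠ 0 := by linarith
    simp only [smul_add, smul_smul]
    rw [add_assoc, ← add_smul]
    congr 2
    · field_simp; ring
    · field_simp; ring

/-- A closed convex set which near its boundary point `0` is squeezed between two paraboloids. -/
structure NormalForm {n : ℕ} (e : Euc n) (K : Set (Euc n)) (ε r c R : ℝ) : Prop where
  isClosed : IsClosed K
  convex : Convex ℝ K
  bound : ∀ w ∈ K, ‖w‖ ≤ R
  mem_para : ∀ w, ‖w‖ < r → w ∈ K → w ∈ para e (1 - ε)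
  of_mem_para : ∀ w, ‖w‖ < r → w ∈ para e (1 + ε) → w ∈ K
  far : ∀ w ∈ K, r ≤ ‖w‖ → c ≤ -⟪e, w⟫

lemma exists_rpow_close (p : ℝ) {η : ℝ} (hη : 0 < η) :
    ∃ ε : ℝ, 0 < ε ∧ ε ≤ 1 / 4 ∧ |(1 - ε) ^ p - 1| ≤ η ∧ |(1 + ε) ^ p - 1| ≤ η := by
  have hcont : ContinuousAt (fun x : ℝ => x ^ p) 1 :=
    Real.continuousAt_rpow_const 1 p (Or.inl one_ne_zero)
  obtain ⟨δ, hδ, h⟩ := Metric.continuousAt_iff.1 hcont η hη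
  simp only [Real.one_rpow, Real.dist_eq] at h
  refine ⟨min (δ / 2) (1 / 4), by positivity, min_le_right _ _, (h ?_).le, (h ?_).le⟩
  · rw [show 1 - min (δ / 2) (1 / 4) - 1 = -min (δ / 2) (1 / 4) by ring, abs_neg,
      abs_of_pos (by positivity)]
    linarith [min_le_left (δ / 2) (1 / 4)]
  · rw [show 1 + min (δ / 2) (1 / 4) - 1 = min (δ / 2) (1 / 4) by ring,
      abs_of_pos (by positivity)]
    linarith [min_le_left (δ / 2) (1 / 4)]

lemma exists_small_paraCap {n : ℕ} {e : Euc n} (he : ‖e‖ = 1) {r : ℝ} (hr : 0 < r) :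
    ∃ h₀ > 0, ∀ h ≤ h₀, ∀ c, 1 / 2 ≤ c → ∀ w ∈ paraCap e c h, ‖w‖ < r := by
  refine ⟨min 1 (r ^ 2 / 6), by positivity, fun h hh c hc w hw => ?_⟩
  have h1 := norm_sq_le_of_mem_paraCap he (by linarith) hw
  have h1' : h ≤ 1 := hh.trans (min_le_left _ _)
  have h2' : h ≤ r ^ 2 / 6 := hh.trans (min_le_right _ _)
  have h0 : 0 ≤ h := by
    have := hw.1; have h3 := hw.2
    simp only [para, mem_ofPred_eq] at this h3
    have : 0 ≤ c / 2 * ‖perp e w‖ ^ 2 := by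
      have : 0 ≤ c := by linarith
      positivity
    linarith
  have h2 : 2 / c ≤ 4 := by
    rw [div_le_iff₀ (by linarith)]; linarith
  have : ‖w‖ ^ 2 < r ^ 2 := by nlinarith
  exact lt_of_pow_lt_pow_left₀ 2 hr.le this

lemma cap_asymptotics {n : ℕ} (hn : 1 ≤ n) {e : Euc n} (he : ‖e‖ = 1) {η : ℝ} (hη : 0 < η) :
    ∃ ε : ℝ, 0 < ε ∧ ε ≤ 1 / 4 ∧ ∀ r c R : ℝ, 0 < r → 0 < c → 0 < R → ∃ h₀ > 0,
      ∀ K, NormalForm e K ε r c R → ∀ h, 0 < h → h < h₀ →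
        |volume.real (K ∩ {w | -⟪e, w⟫ ≤ h})
          - volume.real (paraCap e 1 1) * h ^ (((n:ℝ) + 1) / 2)| ≤ η * h ^ (((n:ℝ) + 1) / 2) := by
  have hc1 := volume_paraCap_pos he
  set c1 := volume.real (paraCap e 1 1) with hc1_def
  obtain ⟨ε, hε0, hε4, hm, hp⟩ := exists_rpow_close (-((n:ℝ) - 1) / 2) (div_pos hη hc1)
  refine ⟨ε, hε0, hε4, fun r c R hr hc hR => ?_⟩
  obtain ⟨h₁, hh₁, hsmall⟩ := exists_small_paraCap he hr
  refine ⟨min h₁ c, by positivity, fun K hK h hh0 hh => ?_⟩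
  have hhc : h < c := hh.trans_le (min_le_right _ _)
  have hhh : h ≤ h₁ := hh.le.trans (min_le_left _ _)
  have hup : K ∩ {w | -⟪e, w⟫ ≤ h} ⊆ paraCap e (1 - ε) h := by
    rintro w ⟨hwK, hwh⟩
    refine ⟨hK.mem_para w ?_ hwK, hwh⟩
    by_contra hcon
    push Not at hcon
    have := hK.far w hwK hcon
    simp only [mem_ofPred_eq] at hwh
    linarith
  have hlow : paraCap e (1 + ε) h ⊆ K ∩ {w | -⟪e, w⟫ ≤ h} := fun w hw =>
    ⟨hK.of_mem_para w (hsmall h hhh _ (by linarith) w hw) hw.1, hw.2⟩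
  have hfin := volume_paraCap_ne_top he (c := 1 - ε) (h := h) (by linarith)
  have h1 := measureReal_mono hup hfin
  have h2 := measureReal_mono hlow (measure_ne_top_of_subset hup hfin)
  rw [volume_paraCap hn he (by linarith) hh0] at h1 h2
  have hhN : 0 < h ^ (((n:ℝ) + 1) / 2) := by positivity
  rw [abs_le] at hm hp ⊢
  have e1 : η = η / c1 * c1 := by field_simp
  have hpos : 0 < h ^ (((n:ℝ) + 1) / 2) * c1 := by positivity
  rw [← hc1_def] at h1 h2
  constructor
  · rw [e1]; nlinarith
  · rw [e1]; nlinarith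

lemma paraHat_subset {n : ℕ} {e : Euc n} (he : ‖e‖ = 1) {c h : ℝ} (hc : 0 < c) (hh : 0 < h)
    {w : Euc n} (hw : w ∈ paraHat e c h) :
    w = h • e ∨ ∃ k ∈ paraCap e c (12 * h), w ∈ segment ℝ k (h • e) := by
  refine (exists_mem_window (Win := {w | -⟪e, w⟫ ≤ 12 * h}) (isClosed_para e c)
    (convex_para e hc.le) ?_ hw).imp_right fun ⟨k, hk, hkw, hseg⟩ => ⟨k, ⟨hk, hkw⟩, hseg⟩
  · intro k hk hkw
    refine ⟨1 / 2, by norm_num, by norm_num, ?_⟩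
    simp only [para, mem_ofPred_eq, not_le] at hk hkw ⊢
    simp only [map_add, map_smul, perp_self he, inner_add_right, inner_smul_right,
      real_inner_self_eq_norm_sq, he, smul_zero, add_zero, norm_smul, mul_pow]
    norm_num
    linarith

lemma segment_bounds {n : ℕ} {e : Euc n} (he : ‖e‖ = 1) {h : ℝ} (hh : 0 < h) {r : ℝ}
    (hr : h < r) {k w : Euc n} (hk : ‖k‖ < r) (hkh : -⟪e, k⟫ ≤ 12 * h)
    (hw : w ∈ segment ℝ k (h • e)) : ‖w‖ < r ∧ -⟪e, w⟫ ≤ 12 * h := by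
  constructor
  · have := (convex_ball (0 : Euc n) r).segment_subset (x := k) (y := h • e) (by simpa using hk)
      (by simpa [norm_smul, he, abs_of_pos hh] using hr) hw
    simpa using this
  · obtain ⟨a, b, ha, hb, hab, rfl⟩ := hw
    simp only [inner_add_right, inner_smul_right, real_inner_self_eq_norm_sq, he]
    nlinarith

lemma squeeze_arith {ζ c A H X a b : ℝ} (hζ : 0 ≤ ζ) (hc : 0 ≤ c) (hA : 0 ≤ A) (hH : 0 ≤ H)
    (ha : a - 1 ≤ ζ) (hb : -ζ ≤ b - 1) (h1 : X ≤ a * H * c + (a - b) * (A) * H)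
    (h2 : b * H * c ≤ X + (a - b) * A * H) : |X - c * H| ≤ ζ * (c + 2 * A + 1) * H := by
  have k1 : (a - b) * (A * H) ≤ 2 * ζ * (A * H) := by gcongr; linarith
  have k2 : (1 - ζ) * (c * H) ≤ b * (c * H) := by gcongr; linarith
  have k3 : a * (c * H) ≤ (1 + ζ) * (c * H) := by gcongr; linarith
  have k4 : 0 ≤ ζ * H := by positivity
  rw [abs_le]
  constructor <;> linarith

lemma hat_asymptotics {n : ℕ} (hn : 1 ≤ n) {e : Euc n} (he : ‖e‖ = 1) {η : ℝ} (hη : 0 < η) :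
    ∃ ε : ℝ, 0 < ε ∧ ε ≤ 1 / 4 ∧ ∀ r c R : ℝ, 0 < r → 0 < c → 0 < R → ∃ h₀ > 0,
      ∀ K, NormalForm e K ε r c R → ∀ h, 0 < h → h < h₀ →
        |volume.real (convexHull ℝ (K ∪ {h • e}) \ K)
          - volume.real (paraHat e 1 1) * h ^ (((n:ℝ) + 1) / 2)| ≤ η * h ^ (((n:ℝ) + 1) / 2) := by
  have hc1 := volume_paraCap_pos he
  set c1 := volume.real (paraCap e 1 1) with hc1_def
  set c2 := volume.real (paraHat e 1 1) with hc2_def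
  have hc2 : 0 ≤ c2 := measureReal_nonneg
  set D := c2 + 2 * (12 ^ (((n:ℝ) + 1) / 2) * c1) + 1 with hD_def
  have hD : 0 < D := by positivity
  obtain ⟨ε, hε0, hε4, hm, hp⟩ := exists_rpow_close (-((n:ℝ) - 1) / 2) (div_pos hη hD)
  refine ⟨ε, hε0, hε4, fun r c R hr hc hR => ?_⟩
  obtain ⟨h₁, hh₁, hsmall⟩ := exists_small_paraCap he hr
  obtain ⟨θ, hθ0, hθ1, hθr, hθc⟩ : ∃ θ : ℝ, 0 < θ ∧ θ < 1 ∧ θ * R ≤ r / 2 ∧ θ * R ^ 2 ≤ c / 2 := by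
    refine ⟨min (1 / 2) (min (r / (2 * R)) (c / (2 * R ^ 2))), by positivity,
      (min_le_left _ _).trans_lt (by norm_num), ?_, ?_⟩
    · calc _ ≤ (r / (2 * R)) * R := by
            gcongr; exact (min_le_right _ _).trans (min_le_left _ _)
        _ = r / 2 := by field_simp
    · calc _ ≤ (c / (2 * R ^ 2)) * R ^ 2 := by
            gcongr; exact (min_le_right _ _).trans (min_le_right _ _)
        _ = c / 2 := by field_simp
  refine ⟨min (h₁ / 12) (min (c / 12) (min (r / 2) (θ * c / 2))), by positivity,
    fun K hK h hh0 hh => ?_⟩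
  have hhc : 12 * h < c := by
    have := hh.trans_le ((min_le_right _ _).trans (min_le_left _ _)); linarith
  have hhh : 12 * h ≤ h₁ := by
    have := hh.trans_le (min_le_left _ _); linarith
  have hhr : h < r / 2 := hh.trans_le
    ((min_le_right _ _).trans ((min_le_right _ _).trans (min_le_left _ _)))
  have hhθ : h < θ * c / 2 := hh.trans_le
    ((min_le_right _ _).trans ((min_le_right _ _).trans (min_le_right _ _)))
  set thin := paraCap e (1 - ε) (12 * h) \ paraCap e (1 + ε) (12 * h) with hthin
  have hthin_vol : volume.real thin = ((1 - ε) ^ (-((n:ℝ) - 1) / 2)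
      - (1 + ε) ^ (-((n:ℝ) - 1) / 2)) * (12 ^ (((n:ℝ) + 1) / 2) * c1)
        * h ^ (((n:ℝ) + 1) / 2) := by
    have hsub : paraCap e (1 + ε) (12 * h) ⊆ paraCap e (1 - ε) (12 * h) :=
      inter_subset_inter_left _ (para_anti e (by linarith))
    rw [hthin, measureReal_sdiff hsub
      (isClosed_paraCap _ _ _).measurableSet (volume_paraCap_ne_top he (by linarith)),
      volume_paraCap hn he (by linarith : 0 < 1 - ε) (by positivity),
      volume_paraCap hn he (by linarith : 0 < 1 + ε) (by positivity),
      Real.mul_rpow (by norm_num) hh0.le]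
    ring
  have hthin_fin : volume thin ≠ ⊤ :=
    measure_ne_top_of_subset sdiff_subset (volume_paraCap_ne_top he (by linarith))
  have hhat_fin : ∀ c' : ℝ, 0 < c' → volume (paraHat e c' h) ≠ ⊤ := by
    intro c' hc'
    obtain ⟨B, hB⟩ := isBounded_iff_forall_norm_le.1
      (isBounded_paraCap he (c := c') (h := 12 * h) hc')
    have hsub : paraHat e c' h ⊆ closedBall 0 (max B h) := by
      have hmem : h • e ∈ closedBall (0 : Euc n) (max B h) := by
        simp [norm_smul, he, abs_of_pos hh0]
      intro w hw
      rcases paraHat_subset he hc' hh0 hw with rfl | ⟨k, hk, hseg⟩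
      · exact hmem
      · refine (convex_closedBall (0 : Euc n) _).segment_subset ?_ hmem hseg
        simpa using Or.inl (hB k hk)
    exact (isBounded_closedBall.subset hsub).measure_lt_top.ne
  have hwin : ∀ w ∈ convexHull ℝ (K ∪ {h • e}) \ K,
      w = h • e ∨ ∃ k ∈ K, -⟪e, k⟫ ≤ 12 * h ∧ w ∈ segment ℝ k (h • e) := by
    intro w hw
    refine exists_mem_window (Win := {w | -⟪e, w⟫ ≤ 12 * h}) hK.isClosed hK.convex ?_ hw
    · intro k hk hkw
      simp only [mem_ofPred_eq, not_le] at hkw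
      have hin : ∀ θ : ℝ, ⟪e, θ • k + (1 - θ) • h • e⟫ = θ * ⟪e, k⟫ + (1 - θ) * h := by
        intro θ
        simp only [inner_add_right, inner_smul_right, real_inner_self_eq_norm_sq, he]; ring
      have hpe : ∀ θ : ℝ, ‖perp e (θ • k + (1 - θ) • h • e)‖ ^ 2 = θ ^ 2 * ‖perp e k‖ ^ 2 := by
        intro θ
        simp only [map_add, map_smul, perp_self he, smul_zero, add_zero, norm_smul, mul_pow,
          Real.norm_eq_abs, sq_abs]
      have hno : ∀ θ : ℝ, 0 ≤ θ → θ ≤ 1 → ‖θ • k + (1 - θ) • h • e‖ ≤ θ * ‖k‖ + h := by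
        intro θ h0 h1
        refine (norm_add_le _ _).trans ?_
        simp only [norm_smul, he, Real.norm_eq_abs, abs_of_pos hh0, abs_of_nonneg h0,
          abs_of_nonneg (sub_nonneg.2 h1)]
        nlinarith
      by_cases hkr : ‖k‖ < r
      · refine ⟨1 / 2, by norm_num, by norm_num, hK.of_mem_para _ ?_ ?_⟩
        · exact (hno _ (by norm_num) (by norm_num)).trans_lt (by linarith)
        · have := hK.mem_para k hkr hk
          simp only [para, mem_ofPred_eq, hpe, hin] at this ⊢
          nlinarith [sq_nonneg ‖perp e k‖]
      · push Not at hkr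
        refine ⟨θ, hθ0.le, hθ1, hK.of_mem_para _ ?_ ?_⟩
        · have := hK.bound k hk
          exact (hno _ hθ0.le hθ1.le).trans_lt (by nlinarith)
        · have h1 := hK.far k hk hkr
          have h2 := (norm_perp_le he k).trans (hK.bound k hk)
          simp only [para, mem_ofPred_eq, hpe, hin]
          have h3 : ‖perp e k‖ ^ 2 ≤ R ^ 2 := by gcongr
          have h4 : (1 + ε) / 2 * (θ ^ 2 * ‖perp e k‖ ^ 2) ≤ 1 * (θ ^ 2 * R ^ 2) := by
            gcongr; linarith
          nlinarith
  have htip : h • e ∉ para e (1 + ε) := by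
    simp only [para, mem_ofPred_eq, map_smul, perp_self he, inner_smul_right,
      real_inner_self_eq_norm_sq, he, not_le]
    simp; exact hh0
  have hup : convexHull ℝ (K ∪ {h • e}) \ K ⊆ paraHat e (1 - ε) h ∪ thin := by
    intro w hw
    have hkey : w ∈ convexHull ℝ (para e (1 - ε) ∪ {h • e}) ∧ -⟪e, w⟫ ≤ 12 * h
        ∧ w ∉ para e (1 + ε) := by
      rcases hwin w hw with rfl | ⟨k, hk, hkw, hseg⟩
      · refine ⟨subset_convexHull ℝ _ (by simp), ?_, htip⟩
        simp only [inner_smul_right, real_inner_self_eq_norm_sq, he]; linarith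
      · have hkr : ‖k‖ < r := by
          by_contra hcon
          push Not at hcon
          linarith [hK.far k hk hcon]
        obtain ⟨hw1, hw2⟩ := segment_bounds he hh0 (by linarith) hkr hkw hseg
        refine ⟨?_, hw2, fun hcon => hw.2 (hK.of_mem_para w hw1 hcon)⟩
        exact (convex_convexHull ℝ _).segment_subset
          (subset_convexHull ℝ _ (mem_union_left _ (hK.mem_para k hkr hk)))
          (subset_convexHull ℝ _ (mem_union_right _ (mem_singleton _))) hseg
    by_cases hwp : w ∈ para e (1 - ε)
    · exact Or.inr ⟨⟨hwp, hkey.2.1⟩, fun hcon => hkey.2.2 hcon.1⟩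
    · exact Or.inl ⟨hkey.1, hwp⟩
  have hlow : paraHat e (1 + ε) h ⊆ (convexHull ℝ (K ∪ {h • e}) \ K) ∪ thin := by
    intro w hw
    have hkey : w ∈ convexHull ℝ (K ∪ {h • e}) ∧ ‖w‖ < r ∧ -⟪e, w⟫ ≤ 12 * h := by
      rcases paraHat_subset he (by linarith) hh0 hw with rfl | ⟨k, hk, hseg⟩
      · refine ⟨subset_convexHull ℝ _ (by simp), ?_, ?_⟩
        · simp only [norm_smul, he, Real.norm_eq_abs, abs_of_pos hh0]; linarith
        · simp only [inner_smul_right, real_inner_self_eq_norm_sq, he]; linarith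
      · have hkr := hsmall _ hhh _ (by linarith) k hk
        obtain ⟨hw1, hw2⟩ := segment_bounds he hh0 (by linarith) hkr hk.2 hseg
        refine ⟨?_, hw1, hw2⟩
        exact (convex_convexHull ℝ _).segment_subset
          (subset_convexHull ℝ _ (mem_union_left _ (hK.of_mem_para k hkr hk.1)))
          (subset_convexHull ℝ _ (mem_union_right _ (mem_singleton _))) hseg
    by_cases hwK : w ∈ K
    · exact Or.inr ⟨⟨hK.mem_para w hkey.2.1 hwK, hkey.2.2⟩, fun hcon => hw.2 hcon.1⟩
    · exact Or.inl ⟨hkey.1, hwK⟩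
  have hXfin : volume (convexHull ℝ (K ∪ {h • e}) \ K) ≠ ⊤ :=
    measure_ne_top_of_subset hup
      (measure_union_ne_top (hhat_fin _ (by linarith)) hthin_fin)
  have h1 := (measureReal_mono hup
    (measure_union_ne_top (hhat_fin _ (by linarith)) hthin_fin)).trans
      (measureReal_union_le _ _)
  have h2 := (measureReal_mono hlow (measure_union_ne_top hXfin hthin_fin)).trans
      (measureReal_union_le _ _)
  rw [volume_paraHat hn he (by linarith) hh0, hthin_vol, ← hc2_def] at h1 h2
  set X := volume.real (convexHull ℝ (K ∪ {h • e}) \ K)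
  set H := h ^ (((n:ℝ) + 1) / 2)
  have hH : 0 < H := by positivity
  set A := (12:ℝ) ^ (((n:ℝ) + 1) / 2) * c1
  have hA : 0 < A := by positivity
  set a := (1 - ε) ^ (-((n:ℝ) - 1) / 2)
  set b := (1 + ε) ^ (-((n:ℝ) - 1) / 2)
  rw [abs_le] at hm hp
  have hη' : η = η / D * D := by field_simp
  rw [hη', hD_def]
  exact squeeze_arith (div_pos hη hD).le hc2 hA.le hH.le hm.2 hp.1 h1 h2

lemma volume_paraHat_pos {n : ℕ} {e : Euc n} (he : ‖e‖ = 1) :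
    0 < volume.real (paraHat e 1 1) := by
  obtain ⟨B, hB⟩ := isBounded_iff_forall_norm_le.1
    (isBounded_paraCap he (c := 1) (h := 12 * 1) one_pos)
  have hsub : paraHat e 1 1 ⊆ closedBall 0 (max B 1) := by
    have hmem : (1:ℝ) • e ∈ closedBall (0 : Euc n) (max B 1) := by simp [he]
    intro w hw
    rcases paraHat_subset he one_pos one_pos hw with rfl | ⟨k, hk, hseg⟩
    · exact hmem
    · refine (convex_closedBall (0 : Euc n) _).segment_subset ?_ hmem hseg
      simpa using Or.inl (hB k hk)
  have hfin := (isBounded_closedBall.subset hsub).measure_lt_top (μ := volume)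
  have hball : ball ((1 / 2 : ℝ) • e) (1 / 6) ⊆ paraHat e 1 1 := by
    intro w hw
    obtain ⟨d, rfl⟩ : ∃ d, w = (1 / 2 : ℝ) • e + d := ⟨w - (1 / 2 : ℝ) • e, by abel⟩
    have hd : ‖d‖ < 1 / 6 := by simpa [dist_eq_norm] using hw
    have hin : |⟪e, d⟫| < 1 / 6 := by
      have := abs_real_inner_le_norm e d
      rw [he, one_mul] at this; linarith
    have hpd := (norm_perp_le he d).trans hd.le
    rw [abs_lt] at hin
    constructor
    · have hk : (-2 : ℝ) • e + (6 : ℝ) • d ∈ para e 1 := by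
        simp only [para, mem_ofPred_eq, map_add, map_smul, perp_self he, inner_add_right,
          inner_smul_right, real_inner_self_eq_norm_sq, he, norm_smul, smul_zero, zero_add,
          Real.norm_eq_abs]
        norm_num
        have := norm_nonneg (perp e d)
        nlinarith
      refine (convex_convexHull ℝ (para e 1 ∪ {(1:ℝ) • e}))
        (subset_convexHull ℝ _ (mem_union_left _ hk))
        (subset_convexHull ℝ _ (mem_union_right _ (mem_singleton _))) (by norm_num : (0:ℝ) ≤ 1 / 6)
        (by norm_num : (0:ℝ) ≤ 5 / 6) (by norm_num) |> fun h => ?_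
      convert h using 1
      module
    · simp only [para, mem_ofPred_eq, not_le, map_add, map_smul, perp_self he, inner_add_right,
          inner_smul_right, real_inner_self_eq_norm_sq, he, smul_zero, zero_add]
      have := sq_nonneg ‖perp e d‖
      linarith
  refine ENNReal.toReal_pos ?_ hfin.ne
  exact ((measure_ball_pos volume _ (by norm_num)).trans_le (measure_mono hball)).ne'

/-- The pairs `(x, m)` of a point of `K` and a point of `L` with `⟪m, x⟫ = 1`. -/
def contact {n : ℕ} (K L : Set (Euc n)) : Set (Euc n × Euc n) :=
  {p | p.1 ∈ K ∧ p.2 ∈ L ∧ ⟪p.2, p.1⟫ = 1}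

/-- Two compact convex sets which are polar to each other. -/
structure PolarPair {n : ℕ} (K L : Set (Euc n)) : Prop where
  compact_left : IsCompact K
  convex_left : Convex ℝ K
  compact_right : IsCompact L
  convex_right : Convex ℝ L
  mem_left : ∀ z, z ∈ K ↔ ∀ m ∈ L, ⟪m, z⟫ ≤ 1
  mem_right : ∀ m, m ∈ L ↔ ∀ z ∈ K, ⟪z, m⟫ ≤ 1

lemma PolarPair.symm {n : ℕ} {K L : Set (Euc n)} (h : PolarPair K L) : PolarPair L K :=
  ⟨h.compact_right, h.convex_right, h.compact_left, h.convex_left, h.mem_right, h.mem_left⟩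

lemma contact_symm {n : ℕ} {K L : Set (Euc n)} {x m : Euc n} (h : (x, m) ∈ contact K L) :
    (m, x) ∈ contact L K :=
  ⟨h.2.1, h.1, by rw [real_inner_comm]; exact h.2.2⟩

/-- The linear map `J` identifies the polar pair `(K, L)` near the contact pair `(x, ℓ)` with the
unit paraboloid, uniformly over nearby contact pairs. -/
structure Osc {n : ℕ} (e : Euc n) (K L : Set (Euc n)) (x ℓ : Euc n) (J : Euc n →L[ℝ] Euc n) :
    Prop where
  mem : (x, ℓ) ∈ contact K L
  det_ne : J.det ≠ 0
  map_point : J x = e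
  inner_map : ∀ w, ⟪e, J w⟫ = ⟪ℓ, w⟫
  uniq_left : ∀ z ∈ K, ⟪ℓ, z⟫ = 1 → z = x
  uniq_right : ∀ m ∈ L, ⟪m, x⟫ = 1 → m = ℓ
  expand : ∀ ε > 0, ∃ r > 0, ∀ y ℓ' z m, (y, ℓ') ∈ contact K L → (z, m) ∈ contact K L →
    dist y x < r → dist ℓ' ℓ < r → dist z x < r → dist m ℓ < r →
    |1 - ⟪ℓ', z⟫ - 1 / 2 * ‖perp e (J (z - ⟪ℓ', z⟫ • y))‖ ^ 2|
      ≤ ε * ‖perp e (J (z - ⟪ℓ', z⟫ • y))‖ ^ 2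

lemma exists_gap {n : ℕ} {L : Set (Euc n)} (hL : IsCompact L) {x ℓ : Euc n}
    (hle : ∀ m ∈ L, ⟪m, x⟫ ≤ 1) (huniq : ∀ m ∈ L, ⟪m, x⟫ = 1 → m = ℓ) {r : ℝ} (hr : 0 < r) :
    ∃ c > 0, ∀ m ∈ L, r ≤ dist m ℓ → ⟪m, x⟫ ≤ 1 - c := by
  have hcomp : IsCompact (L ∩ {m | r ≤ dist m ℓ}) :=
    hL.inter_right (isClosed_le (by fun_prop) (by fun_prop))
  rcases (L ∩ {m | r ≤ dist m ℓ}).eq_empty_or_nonempty with h | h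
  · refine ⟨1, one_pos, fun m hm hmr => ?_⟩
    have : m ∈ L ∩ {m | r ≤ dist m ℓ} := ⟨hm, hmr⟩
    simp [h] at this
  · obtain ⟨m₀, hm₀, hmax⟩ := hcomp.exists_isMaxOn h
      (f := fun m : Euc n => ⟪m, x⟫) (by fun_prop)
    refine ⟨1 - ⟪m₀, x⟫, ?_, fun m hm hmr => ?_⟩
    · refine sub_pos.2 (lt_of_le_of_ne (hle _ hm₀.1) fun heq => ?_)
      have h1 := huniq _ hm₀.1 heq
      have h2 := hm₀.2
      rw [h1] at h2
      simp only [mem_ofPred_eq, dist_self] at h2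
      linarith
    · have : ⟪m, x⟫ ≤ ⟪m₀, x⟫ := hmax ⟨hm, hmr⟩
      linarith

lemma exists_norm_bound {n : ℕ} {L : Set (Euc n)} (hL : IsCompact L) :
    ∃ M > 0, ∀ m ∈ L, ‖m‖ ≤ M := by
  obtain ⟨M, hM⟩ := hL.isBounded.exists_norm_le
  exact ⟨max M 1, by positivity, fun m hm => (hM m hm).trans (le_max_left _ _)⟩

lemma Osc.near_right {n : ℕ} {e x ℓ : Euc n} {K L : Set (Euc n)} {J : Euc n →L[ℝ] Euc n}
    (hP : PolarPair K L) (hO : Osc e K L x ℓ J) {r : ℝ} (hr : 0 < r) :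
    ∃ r' > 0, ∀ z m, (z, m) ∈ contact K L → dist z x < r' → dist m ℓ < r := by
  obtain ⟨c, hc, hgap⟩ := exists_gap hP.compact_right ((hP.mem_left x).1 hO.mem.1)
    hO.uniq_right hr
  obtain ⟨M, hM, hb⟩ := exists_norm_bound hP.compact_right
  refine ⟨c / M, by positivity, fun z m hzm hz => ?_⟩
  by_contra hcon
  push Not at hcon
  have h1 := hgap m hzm.2.1 hcon
  have h2 : ⟪m, z⟫ = 1 := hzm.2.2
  have h3 : ⟪m, z - x⟫ ≤ M * dist z x := by
    rw [dist_eq_norm]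
    exact (real_inner_le_norm _ _).trans (by gcongr; exact hb m hzm.2.1)
  have h4 : M * dist z x < c := by rw [lt_div_iff₀ hM] at hz; linarith
  rw [inner_sub_right] at h3
  linarith

lemma Osc.local_form {n : ℕ} {e x ℓ : Euc n} {K L : Set (Euc n)} {J : Euc n →L[ℝ] Euc n}
    (hP : PolarPair K L) (hO : Osc e K L x ℓ J) {ε : ℝ} (hε : 0 < ε) :
    ∃ r > 0, ∀ y ℓ', (y, ℓ') ∈ contact K L → dist y x < r → dist ℓ' ℓ < r →
      ∀ z, dist z x < r →
        (z ∈ K → (1 - ε) / 2 * ‖perp e (J (z - ⟪ℓ', z⟫ • y))‖ ^ 2 ≤ 1 - ⟪ℓ', z⟫) ∧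
        ((1 + ε) / 2 * ‖perp e (J (z - ⟪ℓ', z⟫ • y))‖ ^ 2 ≤ 1 - ⟪ℓ', z⟫ → z ∈ K) := by
  obtain ⟨r₁, hr₁, hexp⟩ := hO.expand (ε / 2) (by positivity)
  obtain ⟨r₂, hr₂, hnear⟩ := hO.near_right hP hr₁
  obtain ⟨M, hM, hb⟩ := exists_norm_bound hP.compact_right
  have hLne : L.Nonempty := ⟨ℓ, hO.mem.2.1⟩
  set r₃ := min r₁ r₂ / (2 + 2 * ‖x‖ * M) with hr₃
  have hr₃0 : 0 < r₃ := by positivity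
  refine ⟨min r₁ (min (1 / (2 * M)) r₃), by positivity, fun y ℓ' hy hyx hℓ z hz => ?_⟩
  have hz2 : dist z x < 1 / (2 * M) := hz.trans_le ((min_le_right _ _).trans (min_le_left _ _))
  have hz3 : dist z x < r₃ := hz.trans_le ((min_le_right _ _).trans (min_le_right _ _))
  rw [dist_eq_norm] at hz2 hz3
  obtain ⟨m, hm, hmax⟩ := hP.compact_right.exists_isMaxOn hLne
    (f := fun m : Euc n => ⟪m, z⟫) (by fun_prop)
  have hmax' : ∀ m' ∈ L, ⟪m', z⟫ ≤ ⟪m, z⟫ := fun m' hm' => hmax hm'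
  set t := ⟪m, z⟫ with ht
  have hMd : ∀ m' ∈ L, |⟪m', z - x⟫| ≤ M * ‖z - x‖ := fun m' hm' =>
    (abs_real_inner_le_norm _ _).trans (by gcongr; exact hb m' hm')
  have ht1 : |t - 1| ≤ M * ‖z - x‖ := by
    have h1 := hMd m hm
    have h2 := hMd ℓ hO.mem.2.1
    have h3 := hmax' ℓ hO.mem.2.1
    have h4 := (hP.mem_left x).1 hO.mem.1 m hm
    have h5 : ⟪ℓ, x⟫ = 1 := hO.mem.2.2
    rw [inner_sub_right, abs_le] at h1 h2
    rw [abs_le]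
    constructor <;> linarith
  have ht2 : 1 / 2 < t := by
    have : M * ‖z - x‖ < 1 / 2 := by
      rw [lt_div_iff₀ (by positivity)] at hz2; linarith
    rw [abs_le] at ht1; linarith
  have ht0 : 0 < t := by linarith
  have hzK : z ∈ K ↔ t ≤ 1 := by
    rw [hP.mem_left]
    exact ⟨fun h => h m hm, fun h m' hm' => (hmax' m' hm').trans h⟩
  set z' := t⁻¹ • z with hz'
  have hzz : z = t • z' := by rw [hz', smul_smul, mul_inv_cancel₀ ht0.ne', one_smul]
  have hcon : (z', m) ∈ contact K L := by
    refine ⟨(hP.mem_left _).2 fun m' hm' => ?_, hm, ?_⟩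
    · rw [hz', inner_smul_right, inv_mul_le_iff₀ ht0, mul_one]; exact hmax' m' hm'
    · change ⟪m, z'⟫ = 1
      rw [hz', inner_smul_right, ← ht, inv_mul_cancel₀ ht0.ne']
  have hdist : dist z' x < min r₁ r₂ := by
    have h1 : z' - x = t⁻¹ • ((z - x) - (t - 1) • x) := by
      have : x = t⁻¹ • t • x := by rw [smul_smul, inv_mul_cancel₀ ht0.ne', one_smul]
      rw [hz']; nth_rw 1 [this]; module
    have h2 : t⁻¹ ≤ 2 := by rw [inv_le_comm₀ ht0 (by norm_num)]; linarith
    rw [dist_eq_norm, h1, norm_smul, Real.norm_eq_abs, abs_of_pos (inv_pos.2 ht0)]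
    calc _ ≤ 2 * (‖z - x‖ + M * ‖z - x‖ * ‖x‖) := by
          gcongr
          refine (norm_sub_le _ _).trans ?_
          rw [norm_smul, Real.norm_eq_abs]
          gcongr
      _ = ‖z - x‖ * (2 + 2 * ‖x‖ * M) := by ring
      _ < r₃ * (2 + 2 * ‖x‖ * M) := by gcongr
      _ = min r₁ r₂ := by rw [hr₃]; field_simp
  have key := hexp y ℓ' z' m hy hcon (hyx.trans_le (min_le_left _ _))
    (hℓ.trans_le (min_le_left _ _)) (hdist.trans_le (min_le_left _ _))
    (hnear z' m hcon (hdist.trans_le (min_le_right _ _)))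
  have hin : ⟪ℓ', z⟫ = t * ⟪ℓ', z'⟫ := by nth_rw 1 [hzz]; rw [inner_smul_right]
  have hD : ‖perp e (J (z - ⟪ℓ', z⟫ • y))‖ ^ 2
      = t ^ 2 * ‖perp e (J (z' - ⟪ℓ', z'⟫ • y))‖ ^ 2 := by
    have : z - ⟪ℓ', z⟫ • y = t • (z' - ⟪ℓ', z'⟫ • y) := by
      rw [hin]; nth_rw 1 [hzz]; module
    rw [this, map_smul, map_smul, norm_smul, mul_pow, Real.norm_eq_abs, sq_abs]
  rw [hzK, hD, hin]
  set a := ⟪ℓ', z'⟫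
  set E := ‖perp e (J (z' - a • y))‖ ^ 2
  have hE : 0 ≤ E := by positivity
  rw [abs_le] at key
  constructor
  · intro h1
    have k1 : t * ((1 - ε) / 2 * E) ≤ t * (1 - a) := by gcongr; linarith
    by_cases hε1 : ε ≤ 1
    · have k2 : t * (t * ((1 - ε) / 2 * E)) ≤ 1 * (t * ((1 - ε) / 2 * E)) := by
        have : 0 ≤ 1 - ε := by linarith
        gcongr
      linarith
    · have k3 : a ≤ 1 := by
        have := (hP.mem_left z').1 hcon.1 ℓ' hy.2.1
        exact this
      have k2 : 0 ≤ t ^ 2 * E * (ε - 1) := mul_nonneg (by positivity) (by linarith)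
      nlinarith
  · intro h1
    by_contra h2
    push Not at h2
    have k1 : t * (1 - a) ≤ t * ((1 + ε) / 2 * E) := by gcongr; linarith
    have k2 : 1 * (t * ((1 + ε) / 2 * E)) ≤ t * (t * ((1 + ε) / 2 * E)) := by gcongr
    linarith

/-- The correction of `J` adapted to a contact pair `(y, ℓ)`: it sends `y` to `e` and the
functional `⟪ℓ, ·⟫` to `⟪e, ·⟫`. -/
def frame {n : ℕ} (e : Euc n) (J : Euc n →L[ℝ] Euc n) (p : Euc n × Euc n) : Euc n →L[ℝ] Euc n :=
  (perp e).comp J + (innerSL ℝ p.2).smulRight (e - perp e (J p.1))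

lemma frame_apply {n : ℕ} (e : Euc n) (J : Euc n →L[ℝ] Euc n) (y ℓ z : Euc n) :
    frame e J (y, ℓ) z = perp e (J (z - ⟪ℓ, z⟫ • y)) + ⟪ℓ, z⟫ • e := by
  simp only [frame, add_apply, ContinuousLinearMap.comp_apply,
    ContinuousLinearMap.smulRight_apply, innerSL_apply_apply, map_sub, map_smul, smul_sub]
  abel

lemma continuous_frame {n : ℕ} (e : Euc n) (J : Euc n →L[ℝ] Euc n) :
    Continuous (frame e J) := by
  have h : frame e J = fun p => (perp e).comp J
      + ContinuousLinearMap.smulRightL ℝ (Euc n) (Euc n) (innerSL ℝ p.2)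
        (e - perp e (J p.1)) := by
    ext p : 1
    rfl
  rw [h]
  fun_prop

lemma inner_frame {n : ℕ} {e : Euc n} (he : ‖e‖ = 1) (J : Euc n →L[ℝ] Euc n) (y ℓ z : Euc n) :
    ⟪e, frame e J (y, ℓ) z⟫ = ⟪ℓ, z⟫ := by
  rw [frame_apply, inner_add_right, inner_perp he, inner_smul_right, real_inner_self_eq_norm_sq,
    he]
  ring

lemma perp_frame {n : ℕ} {e : Euc n} (he : ‖e‖ = 1) (J : Euc n →L[ℝ] Euc n) (y ℓ z : Euc n) :
    perp e (frame e J (y, ℓ) z) = perp e (J (z - ⟪ℓ, z⟫ • y)) := by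
  rw [frame_apply, map_add, map_smul, perp_perp he, perp_self he, smul_zero, add_zero]

lemma frame_self {n : ℕ} (e : Euc n) (J : Euc n →L[ℝ] Euc n) {y ℓ : Euc n} (h : ⟪ℓ, y⟫ = 1) :
    frame e J (y, ℓ) y = e := by
  rw [frame_apply, h]; simp

lemma Osc.frame_eq {n : ℕ} {e x ℓ : Euc n} {K L : Set (Euc n)} {J : Euc n →L[ℝ] Euc n}
    (he : ‖e‖ = 1) (hO : Osc e K L x ℓ J) : frame e J (x, ℓ) = J := by
  ext1 z
  rw [frame_apply, map_sub, map_smul, hO.map_point, map_sub, map_smul, perp_self he, perp_apply,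
    hO.inner_map]
  simp

/-- The affine image of a set under the frame of a contact pair, with the contact point moved
to the origin. -/
def frameImage {n : ℕ} (e : Euc n) (J : Euc n →L[ℝ] Euc n) (p : Euc n × Euc n)
    (A : Set (Euc n)) : Set (Euc n) := (fun z => frame e J p z - e) '' A

lemma volume_frameImage {n : ℕ} (e : Euc n) (J : Euc n →L[ℝ] Euc n) (p : Euc n × Euc n)
    (A : Set (Euc n)) :
    volume.real (frameImage e J p A) = |(frame e J p).det| * volume.real A := by
  have h : frameImage e J p A = (fun w => w + e) ⁻¹' (frame e J p '' A) := by
    ext w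
    simp only [frameImage, mem_image, mem_preimage, sub_eq_iff_eq_add]
  rw [h, Measure.real, measure_preimage_add_right, ← Measure.real, volume_image_real]

lemma exists_inverse_bound {n : ℕ} {J : Euc n →L[ℝ] Euc n} (hJ : J.det ≠ 0) :
    ∃ C > 0, ∀ z, ‖z‖ ≤ C * ‖J z‖ := by
  have hinj : Function.Injective (J : Euc n →ₗ[ℝ] Euc n) := by
    have : IsUnit (LinearMap.det (J : Euc n →ₗ[ℝ] Euc n)) := isUnit_iff_ne_zero.2 hJ
    exact (LinearMap.equivOfDetNeZero _ hJ).injective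
  obtain ⟨C, hC, hanti⟩ := (J : Euc n →ₗ[ℝ] Euc n).exists_antilipschitzWith
    (LinearMap.ker_eq_bot.2 hinj)
  refine ⟨C, hC, fun z => ?_⟩
  have := hanti.le_mul_dist z 0
  simpa using this

lemma det_ne_zero_of_injective {n : ℕ} {J : Euc n →L[ℝ] Euc n} (hJ : Function.Injective J) :
    J.det ≠ 0 :=
  (LinearEquiv.ofInjectiveEndo (J : Euc n →ₗ[ℝ] Euc n) hJ).isUnit_det'.ne_zero

lemma Osc.normalForm {n : ℕ} {e x ℓ : Euc n} {K L : Set (Euc n)} {J : Euc n →L[ℝ] Euc n}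
    (he : ‖e‖ = 1) (hP : PolarPair K L) (hO : Osc e K L x ℓ J) {ε ζ : ℝ} (hε : 0 < ε)
    (hζ : 0 < ζ) :
    ∃ r₀ r c R : ℝ, 0 < r₀ ∧ 0 < r ∧ 0 < c ∧ 0 < R ∧ ∀ y ℓ', (y, ℓ') ∈ contact K L →
      dist y x < r₀ → dist ℓ' ℓ < r₀ →
      NormalForm e (frameImage e J (y, ℓ') K) ε r c R ∧
      Function.Injective (frame e J (y, ℓ')) ∧ |(|J.det| / |(frame e J (y, ℓ')).det|) - 1| ≤ ζ := by
  obtain ⟨r₁, hr₁, hloc⟩ := hO.local_form hP hε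
  obtain ⟨C, hC, hCJ⟩ := exists_inverse_bound hO.det_ne
  obtain ⟨M, hM, hMK⟩ := exists_norm_bound hP.compact_left
  have hcont := (continuous_frame e J).continuousAt (x := (x, ℓ))
  have hdetc : ContinuousAt (fun p => |J.det| / |(frame e J p).det|) (x, ℓ) := by
    refine ContinuousAt.div continuousAt_const
      ((ContinuousLinearMap.continuous_det.comp (continuous_frame e J)).abs.continuousAt) ?_
    rw [hO.frame_eq he]
    exact abs_ne_zero.2 hO.det_ne
  have hev : ∀ᶠ p in 𝓝 (x, ℓ), ‖frame e J p - J‖ < min (1 / (2 * C)) 1 ∧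
      |(|J.det| / |(frame e J p).det|) - 1| < ζ := by
    have h1 := Metric.continuousAt_iff'.1 hcont (min (1 / (2 * C)) 1) (by positivity)
    have h2 := Metric.continuousAt_iff'.1 hdetc ζ hζ
    rw [hO.frame_eq he] at h1 h2
    rw [div_self (abs_ne_zero.2 hO.det_ne)] at h2
    filter_upwards [h1, h2] with p hp1 hp2
    rw [dist_eq_norm] at hp1
    rw [Real.dist_eq] at hp2
    exact ⟨hp1, hp2⟩
  obtain ⟨r₂, hr₂, hev⟩ := Metric.eventually_nhds_iff.1 hev
  set B := ‖J‖ + 1 with hB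
  have hB0 : 0 < B := by positivity
  set r := r₁ / (4 * C) with hr
  have hr0 : 0 < r := by positivity
  obtain ⟨c, hc, hgap⟩ := exists_gap hP.compact_left (x := ℓ) (ℓ := x)
    ((hP.mem_right ℓ).1 hO.mem.2.1) (fun z hz h => hO.uniq_left z hz (by rwa [real_inner_comm]))
    (r := r / (2 * B)) (by positivity)
  refine ⟨min (r₁ / 2) (min r₂ (min (r / (2 * B)) (c / (2 * M)))), r, c / 2, B * (2 * M),
    by positivity, hr0, by positivity, by positivity, fun y ℓ' hy hyx hℓ => ?_⟩
  simp only [lt_min_iff] at hyx hℓ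
  have hyx1 : dist y x < r₁ / 2 := hyx.1
  obtain ⟨hF1, hF2⟩ := hev (y := (y, ℓ')) (by
    rw [Prod.dist_eq]; exact max_lt hyx.2.1 hℓ.2.1)
  rw [lt_min_iff] at hF1
  set Θ := frame e J (y, ℓ') with hΘ
  have hself : Θ y = e := frame_self e J hy.2.2
  have hlow : ∀ z, ‖z‖ ≤ 2 * C * ‖Θ z‖ := by
    intro z
    have h1 : ‖(Θ - J) z‖ ≤ 1 / (2 * C) * ‖z‖ :=
      ((Θ - J).le_opNorm z).trans (by gcongr; exact hF1.1.le)
    have h2 : ‖J z‖ ≤ ‖Θ z‖ + ‖(Θ - J) z‖ := by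
      have : J z = Θ z - (Θ - J) z := by simp
      rw [this]; exact norm_sub_le _ _
    have h3 : C * (1 / (2 * C) * ‖z‖) = ‖z‖ / 2 := by field_simp
    have h4 := hCJ z
    have h5 : C * ‖J z‖ ≤ C * ‖Θ z‖ + C * (1 / (2 * C) * ‖z‖) := by
      rw [← mul_add]; gcongr; linarith
    linarith
  have hup : ∀ z, ‖Θ z‖ ≤ B * ‖z‖ := by
    intro z
    have h2 : ‖Θ‖ ≤ B := by
      have h3 : Θ = J + (Θ - J) := by abel
      rw [h3]
      exact (norm_add_le _ _).trans (by rw [hB]; linarith [hF1.2])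
    exact (Θ.le_opNorm z).trans (by gcongr)
  have hinj : Function.Injective Θ := by
    intro a b hab
    have := hlow (a - b)
    rw [map_sub, hab, sub_self, norm_zero, mul_zero] at this
    exact sub_eq_zero.1 (norm_le_zero_iff.1 this)
  have hsurj : Function.Surjective Θ :=
    LinearMap.surjective_of_injective (f := (Θ : Euc n →ₗ[ℝ] Euc n)) hinj
  have hfw : ∀ z, Θ z - e = Θ (z - y) := fun z => by rw [map_sub, hself]
  have hin : ∀ z, -⟪e, Θ z - e⟫ = 1 - ⟪ℓ', z⟫ := fun z => by
    rw [inner_sub_right, hΘ, inner_frame he, real_inner_self_eq_norm_sq, he]; ring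
  have hpe : ∀ z, perp e (Θ z - e) = perp e (J (z - ⟪ℓ', z⟫ • y)) := fun z => by
    rw [map_sub, perp_self he, sub_zero, hΘ, perp_frame he]
  have hnear : ∀ z, ‖Θ z - e‖ < r → dist z x < r₁ := by
    intro z hz
    have h1 := hlow (z - y)
    rw [← hfw] at h1
    have h2 : 2 * C * ‖Θ z - e‖ < 2 * C * r := by gcongr
    have h3 : 2 * C * r = r₁ / 2 := by rw [hr]; field_simp; norm_num
    have := dist_triangle z y x
    rw [dist_eq_norm z y] at this
    linarith
  have hlocal := hloc y ℓ' hy (by linarith) (by linarith [hℓ.1])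
  refine ⟨⟨?_, ?_, ?_, ?_, ?_, ?_⟩, hinj, hF2.le⟩
  · exact (hP.compact_left.image (by fun_prop)).isClosed
  · have := (hP.convex_left.linear_image (Θ : Euc n →ₗ[ℝ] Euc n)).translate (-e)
    rw [image_image] at this
    simp only [frameImage, sub_eq_neg_add]
    exact this
  · rintro _ ⟨z, hz, rfl⟩
    change ‖Θ z - e‖ ≤ _
    rw [hfw]
    refine (hup _).trans ?_
    gcongr
    linarith [norm_sub_le z y, hMK z hz, hMK y hy.1]
  · rintro _ hw ⟨z, hz, rfl⟩
    change (1 - ε) / 2 * ‖perp e (Θ z - e)‖ ^ 2 ≤ -⟪e, Θ z - e⟫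
    rw [hpe, hin]
    exact (hlocal z (hnear z hw)).1 hz
  · intro w hw hwp
    obtain ⟨z, hz⟩ := hsurj (w + e)
    obtain rfl : w = Θ z - e := by rw [hz]; abel
    refine ⟨z, (hlocal z (hnear z hw)).2 ?_, rfl⟩
    rw [← hpe, ← hin]
    exact hwp
  · rintro _ ⟨z, hz, rfl⟩ hw
    change c / 2 ≤ -⟪e, Θ z - e⟫
    change r ≤ ‖Θ z - e‖ at hw
    rw [hin]
    rw [hfw] at hw
    have h1 : r / B ≤ ‖z - y‖ := by
      rw [div_le_iff₀ hB0]; linarith [hup (z - y)]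
    have h2 := dist_triangle z x y
    rw [dist_eq_norm z y, dist_comm x y] at h2
    have h3 : r / (2 * B) = r / B / 2 := by field_simp
    have h4 := hgap z hz (by linarith [hyx.2.2.1])
    have h5 : ⟪ℓ' - ℓ, z⟫ ≤ dist ℓ' ℓ * M := by
      rw [dist_eq_norm]
      exact (real_inner_le_norm _ _).trans (by gcongr; exact hMK z hz)
    have h6 : dist ℓ' ℓ * M < c / 2 := by
      have := hℓ.2.2.2
      rw [lt_div_iff₀ (by positivity)] at this
      linarith
    rw [inner_sub_left] at h5
    rw [real_inner_comm] at h4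
    linarith

lemma ratio_arith {W ρ η ζ c H : ℝ} (hζ1 : ζ ≤ 1) (hc : 0 ≤ c)
    (hH : 0 ≤ H) (hW : |W - c * H| ≤ η / 4 * H) (hρ : |ρ - 1| ≤ ζ) (hζc : ζ * c ≤ η / 2) :
    |ρ * W - c * H| ≤ η * H := by
  have h1 : ρ * W - c * H = ρ * (W - c * H) + (ρ - 1) * (c * H) := by ring
  have h2 : |ρ| ≤ 2 := by
    have : ρ = 1 + (ρ - 1) := by ring
    rw [this]
    refine (abs_add_le _ _).trans ?_
    rw [abs_one]; linarith
  calc _ ≤ |ρ| * |W - c * H| + |ρ - 1| * (c * H) := by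
        rw [h1]
        refine (abs_add_le _ _).trans ?_
        rw [abs_mul, abs_mul, abs_of_nonneg (by positivity : 0 ≤ c * H)]
    _ ≤ 2 * (η / 4 * H) + ζ * (c * H) := by gcongr
    _ = (η / 2 + ζ * c) * H := by ring
    _ ≤ (η / 2 + η / 2) * H := by gcongr
    _ = η * H := by ring

lemma exists_small_factor {c η : ℝ} (hc : 0 ≤ c) (hη : 0 < η) :
    ∃ ζ > 0, ζ ≤ 1 ∧ ζ * c ≤ η / 2 := by
  refine ⟨min 1 (η / (2 * (c + 1))), by positivity, min_le_left _ _, ?_⟩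
  calc _ ≤ η / (2 * (c + 1)) * (c + 1) := by
        gcongr
        · exact min_le_right _ _
        · linarith
    _ = η / 2 := by field_simp

lemma Osc.cap_volume {n : ℕ} (hn : 1 ≤ n) {e x ℓ : Euc n} {K L : Set (Euc n)}
    {J : Euc n →L[ℝ] Euc n} (he : ‖e‖ = 1) (hP : PolarPair K L) (hO : Osc e K L x ℓ J) {η : ℝ}
    (hη : 0 < η) :
    ∃ r > 0, ∀ y ℓ', (y, ℓ') ∈ contact K L → dist y x < r → dist ℓ' ℓ < r →
      ∀ h, 0 < h → h < r →
        |(|J.det| * volume.real (K ∩ {z | 1 - h ≤ ⟪ℓ', z⟫}))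
          - volume.real (paraCap e 1 1) * h ^ (((n:ℝ) + 1) / 2)| ≤ η * h ^ (((n:ℝ) + 1) / 2) := by
  have hc1 := (volume_paraCap_pos he).le
  obtain ⟨ε, hε, -, hcap⟩ := cap_asymptotics hn he (show 0 < η / 4 by positivity)
  obtain ⟨ζ, hζ, hζ1, hζc⟩ := exists_small_factor hc1 hη
  obtain ⟨r₀, r, c, R, hr₀, hr, hc, hR, hnf⟩ := hO.normalForm he hP hε hζ
  obtain ⟨h₀, hh₀, hcap⟩ := hcap r c R hr hc hR
  refine ⟨min r₀ h₀, by positivity, fun y ℓ' hy hyx hℓ h hh hhr => ?_⟩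
  obtain ⟨hN, hinj, hdet⟩ := hnf y ℓ' hy (hyx.trans_le (min_le_left _ _))
    (hℓ.trans_le (min_le_left _ _))
  have h1 := hcap _ hN h hh (hhr.trans_le (min_le_right _ _))
  have h2 : frameImage e J (y, ℓ') K ∩ {w | -⟪e, w⟫ ≤ h}
      = frameImage e J (y, ℓ') (K ∩ {z | 1 - h ≤ ⟪ℓ', z⟫}) := by
    have : ∀ z, -⟪e, frame e J (y, ℓ') z - e⟫ ≤ h ↔ 1 - h ≤ ⟪ℓ', z⟫ := fun z => by
      rw [inner_sub_right, inner_frame he, real_inner_self_eq_norm_sq, he]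
      constructor <;> intro h <;> linarith
    ext w
    constructor
    · rintro ⟨⟨z, hz, rfl⟩, hw⟩
      exact ⟨z, ⟨hz, (this z).1 hw⟩, rfl⟩
    · rintro ⟨z, ⟨hz, hzw⟩, rfl⟩
      exact ⟨⟨z, hz, rfl⟩, (this z).2 hzw⟩
  have hd := abs_ne_zero.2 (det_ne_zero_of_injective hinj)
  rw [h2, volume_frameImage] at h1
  have := ratio_arith hζ1 hc1 (by positivity) h1 hdet hζc
  rwa [← mul_assoc, div_mul_cancel₀ _ hd] at this

lemma Osc.hat_volume {n : ℕ} (hn : 1 ≤ n) {e x ℓ : Euc n} {K L : Set (Euc n)}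
    {J : Euc n →L[ℝ] Euc n} (he : ‖e‖ = 1) (hP : PolarPair K L) (hO : Osc e K L x ℓ J) {η : ℝ}
    (hη : 0 < η) :
    ∃ r > 0, ∀ y ℓ', (y, ℓ') ∈ contact K L → dist y x < r → dist ℓ' ℓ < r →
      ∀ h, 0 < h → h < r →
        |(|J.det| * volume.real (convexHull ℝ (K ∪ {(1 + h) • y}) \ K))
          - volume.real (paraHat e 1 1) * h ^ (((n:ℝ) + 1) / 2)| ≤ η * h ^ (((n:ℝ) + 1) / 2) := by
  have hc1 := (volume_paraHat_pos he).le
  obtain ⟨ε, hε, -, hcap⟩ := hat_asymptotics hn he (show 0 < η / 4 by positivity)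
  obtain ⟨ζ, hζ, hζ1, hζc⟩ := exists_small_factor hc1 hη
  obtain ⟨r₀, r, c, R, hr₀, hr, hc, hR, hnf⟩ := hO.normalForm he hP hε hζ
  obtain ⟨h₀, hh₀, hcap⟩ := hcap r c R hr hc hR
  refine ⟨min r₀ h₀, by positivity, fun y ℓ' hy hyx hℓ h hh hhr => ?_⟩
  obtain ⟨hN, hinj, hdet⟩ := hnf y ℓ' hy (hyx.trans_le (min_le_left _ _))
    (hℓ.trans_le (min_le_left _ _))
  have h1 := hcap _ hN h hh (hhr.trans_le (min_le_right _ _))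
  have h2 : convexHull ℝ (frameImage e J (y, ℓ') K ∪ {h • e}) \ frameImage e J (y, ℓ') K
      = frameImage e J (y, ℓ') (convexHull ℝ (K ∪ {(1 + h) • y}) \ K) := by
    set T : Euc n →ᵃ[ℝ] Euc n :=
      (frame e J (y, ℓ') : Euc n →ₗ[ℝ] Euc n).toAffineMap - AffineMap.const ℝ (Euc n) e with hT
    have hTi : ∀ A, frameImage e J (y, ℓ') A = T '' A := fun A => rfl
    have hTy : T ((1 + h) • y) = h • e := by
      change frame e J (y, ℓ') ((1 + h) • y) - e = h • e
      rw [map_smul, frame_self e J hy.2.2]; module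
    have hTinj : Function.Injective T := fun a b hab => hinj (sub_left_injective hab)
    rw [hTi, hTi, image_sdiff hTinj, AffineMap.image_convexHull, image_union, image_singleton, hTy]
  have hd := abs_ne_zero.2 (det_ne_zero_of_injective hinj)
  rw [h2, volume_frameImage] at h1
  have := ratio_arith hζ1 hc1 (by positivity) h1 hdet hζc
  rwa [← mul_assoc, div_mul_cancel₀ _ hd] at this

lemma exists_isometry_extension {k n : ℕ} (hkn : k + 1 = n) (L : Euc k →ₗᵢ[ℝ] Euc n) {ν : Euc n}
    (hν : ‖ν‖ = 1) (hL : ∀ v, ⟪L v, ν⟫ = 0) :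
    ∃ Ψ : WithLp 2 (Euc k × ℝ) ≃ₗᵢ[ℝ] Euc n,
      ∀ v t, Ψ (WithLp.toLp 2 (v, t)) = L v + t • ν := by
  let F : WithLp 2 (Euc k × ℝ) →ₗ[ℝ] Euc n :=
    (L.toLinearMap.coprod (LinearMap.toSpanSingleton ℝ (Euc n) ν)) ∘ₗ
      (WithLp.linearEquiv 2 ℝ (Euc k × ℝ)).toLinearMap
  have hF : ∀ v t, F (WithLp.toLp 2 (v, t)) = L v + t • ν := fun v t => by simp [F]
  have hnorm : ∀ p, ‖F p‖ = ‖p‖ := by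
    rintro ⟨v, t⟩
    rw [hF, ← sq_eq_sq₀ (norm_nonneg _) (norm_nonneg _), WithLp.prod_norm_sq_eq_of_L2,
      norm_add_sq_real, inner_smul_right, hL, norm_smul, hν, L.norm_map]
    simp
  have hrank : Module.finrank ℝ (WithLp 2 (Euc k × ℝ)) = Module.finrank ℝ (Euc n) := by
    rw [(WithLp.linearEquiv 2 ℝ (Euc k × ℝ)).finrank_eq]; simp [hkn]
  exact ⟨LinearIsometry.toLinearIsometryEquiv ⟨F, hnorm⟩ hrank, hF⟩

lemma exists_selfAdjoint_sqrt {k : ℕ} {A : Euc k →ₗ[ℝ] Euc k} (hA : A.IsPositive) :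
    ∃ B : Euc k →ₗ[ℝ] Euc k, B.IsSymmetric ∧ B ∘ₗ B = A := by
  set b := hA.isSymmetric.eigenvectorBasis (by simp : Module.finrank ℝ (Euc k) = k)
  set l := hA.isSymmetric.eigenvalues (by simp : Module.finrank ℝ (Euc k) = k)
  have hl : ∀ i, 0 ≤ l i := hA.nonneg_eigenvalues _
  let B : Euc k →ₗ[ℝ] Euc k :=
    ∑ i, (innerₛₗ ℝ (b i)).smulRight (√(l i) • b i)
  have hB : ∀ w, B w = ∑ i, ⟪b i, w⟫ • √(l i) • b i := fun w => by
    simp [B]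
  have hBb : ∀ j, B (b j) = √(l j) • b j := fun j => by
    rw [hB, Finset.sum_eq_single j]
    · simp
    · intro i _ hij; simp [b.inner_eq_ite, hij]
    · simp
  refine ⟨B, fun u w => ?_, ?_⟩
  · rw [hB, hB, sum_inner, inner_sum]
    refine Finset.sum_congr rfl fun i _ => ?_
    simp only [inner_smul_left, inner_smul_right]
    rw [real_inner_comm u]
    simp; ring
  · refine b.toBasis.ext fun i => ?_
    rw [b.coe_toBasis, LinearMap.comp_apply, hBb, map_smul, hBb, smul_smul,
      Real.mul_self_sqrt (hl i)]
    exact (hA.isSymmetric.apply_eigenvectorBasis _ i).symm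

lemma det_eq_det_inner {k : ℕ} (A : Euc k →ₗ[ℝ] Euc k) :
    LinearMap.det A = (Matrix.of fun i j : Fin k =>
      ⟪A (EuclideanSpace.single i 1), EuclideanSpace.single j 1⟫).det := by
  rw [← LinearMap.det_toMatrix (EuclideanSpace.basisFun (Fin k) ℝ).toBasis, ← Matrix.det_transpose]
  congr 1
  ext i j
  simp [LinearMap.toMatrix_apply, EuclideanSpace.inner_single_right]

lemma abs_det_frame_comp {k n : ℕ} (I Ψ : WithLp 2 (Euc k × ℝ) ≃ₗᵢ[ℝ] Euc n)
    (B : Euc k →ₗ[ℝ] Euc k) (a : Euc k) (c : ℝ) (J : Euc n →ₗ[ℝ] Euc n)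
    (hJ : ∀ v t, J (Ψ (WithLp.toLp 2 (v, t))) = I (WithLp.toLp 2 (B (v - t • a), c * t))) :
    |LinearMap.det J| = |LinearMap.det B| * |c| := by
  let P : (Euc k × ℝ) →ₗ[ℝ] (Euc k × ℝ) := B.prodMap (c • LinearMap.id)
  let T : (Euc k × ℝ) →ₗ[ℝ] (Euc k × ℝ) :=
    LinearMap.transvection (LinearMap.snd ℝ (Euc k) ℝ) (-a, 0)
  have hT : LinearMap.det T = 1 := by
    simp [T, LinearMap.transvection.det]
  have hP : LinearMap.det P = LinearMap.det B * c := by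
    simp [P, LinearMap.det_prodMap]
  let e := WithLp.linearEquiv 2 ℝ (Euc k × ℝ)
  let W : WithLp 2 (Euc k × ℝ) →ₗ[ℝ] WithLp 2 (Euc k × ℝ) :=
    e.symm.toLinearMap ∘ₗ (P ∘ₗ T) ∘ₗ e.toLinearMap
  have hW : LinearMap.det W = LinearMap.det B * c := by
    have := LinearMap.det_conj (P ∘ₗ T) e.symm
    simp only [LinearEquiv.symm_symm] at this
    rw [← hP, ← mul_one (LinearMap.det P), ← hT, ← LinearMap.det_comp, ← this]
  have hJW : J ∘ₗ Ψ.toLinearEquiv.toLinearMap = I.toLinearEquiv.toLinearMap ∘ₗ W := by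
    ext1 p
    obtain ⟨v, t⟩ := p
    have : T (v, t) = (v - t • a, t) := by
      simp [T, LinearMap.transvection.apply, sub_eq_add_neg]
    change J (Ψ (WithLp.toLp 2 (v, t))) = I (WithLp.toLp 2 (P (T (v, t))))
    rw [hJ, this]; simp [P]
  have hrank : Module.finrank ℝ (WithLp 2 (Euc k × ℝ)) = Module.finrank ℝ (Euc n) :=
    I.toLinearEquiv.finrank_eq
  have h1 := LinearMap.normDet_comp_of_finrank_eq Ψ.toLinearEquiv.toLinearMap J hrank
  have h2 := LinearMap.normDet_comp_of_finrank_eq W I.toLinearEquiv.toLinearMap rfl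
  have h3 : LinearMap.normDet Ψ.toLinearEquiv.toLinearMap = 1 :=
    Ψ.toLinearIsometry.normDet_eq_one
  have h4 : LinearMap.normDet I.toLinearEquiv.toLinearMap = 1 :=
    I.toLinearIsometry.normDet_eq_one
  rw [hJW, h2, h3, h4, LinearMap.normDet_eq_abs_det, LinearMap.normDet_eq_abs_det, hW, abs_mul]
    at h1
  linarith

lemma det_mul_det_of_inner {n : ℕ} {J J' : Euc n →ₗ[ℝ] Euc n}
    (h : ∀ m w, ⟪J' m, J w⟫ = ⟪m, w⟫) : |LinearMap.det J'| * |LinearMap.det J| = 1 := by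
  have h1 : J'.adjoint ∘ₗ J = LinearMap.id := by
    ext1 w
    refine ext_inner_left ℝ fun m => ?_
    simp [LinearMap.adjoint_inner_right, h]
  have h2 : |LinearMap.det (LinearMap.adjoint J')| = |LinearMap.det J'| := by
    have e := (EuclideanSpace.basisFun (Fin n) ℝ)
    rw [← LinearMap.det_toMatrix e.toBasis, ← LinearMap.det_toMatrix e.toBasis,
      LinearMap.toMatrix_adjoint, Matrix.det_conjTranspose]
    simp
  rw [← h2, ← abs_mul, ← LinearMap.det_comp, h1]; simp

lemma exists_riesz (k : ℕ) :
    ∃ ι : (Euc k →L[ℝ] ℝ) →L[ℝ] Euc k, ∀ φ w, ⟪ι φ, w⟫ = φ w := by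
  let b := EuclideanSpace.basisFun (Fin k) ℝ
  refine ⟨∑ i, (ContinuousLinearMap.apply ℝ ℝ (b i)).smulRight (b i), fun φ w => ?_⟩
  conv_rhs => rw [← b.sum_repr' w]
  simp [sum_inner, inner_smul_left, mul_comm, map_sum]

lemma exists_second_order_expansion {k : ℕ} {f : Euc k → ℝ} {τ : ℝ} (hτ : 0 < τ)
    (hf : ContDiffOn ℝ 2 f (ball 0 τ)) :
    ∃ (g : Euc k → Euc k) (A : Euc k →L[ℝ] Euc k),
      (∀ u w, ⟪A u, w⟫ = iteratedFDeriv ℝ 2 f 0 ![u, w]) ∧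
      (∀ u w, ⟪A u, w⟫ = ⟪u, A w⟫) ∧
      (∀ v ∈ ball (0 : Euc k) τ, HasFDerivAt f (innerSL ℝ (g v)) v) ∧
      (fderiv ℝ f 0 = 0 → g 0 = 0) ∧
      ContinuousAt g 0 ∧
      (fun p : Euc k × Euc k => g p.2 - g p.1 - A (p.2 - p.1)) =o[𝓝 0] (fun p => p.2 - p.1) ∧
      (fun p : Euc k × Euc k => f p.2 - f p.1 - ⟪g p.1, p.2 - p.1⟫
        - 1 / 2 * ⟪A (p.2 - p.1), p.2 - p.1⟫) =o[𝓝 0] (fun p => ‖p.2 - p.1‖ ^ 2) := by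
  have hball : ball (0 : Euc k) τ ∈ 𝓝 0 := ball_mem_nhds _ hτ
  have hf0 : ContDiffAt ℝ 2 f 0 := hf.contDiffAt hball
  obtain ⟨ι, hι⟩ := exists_riesz k
  let g : Euc k → Euc k := fun v => ι (fderiv ℝ f v)
  let A : Euc k →L[ℝ] Euc k := ι.comp (fderiv ℝ (fderiv ℝ f) 0)
  have hA : ∀ u w, ⟪A u, w⟫ = fderiv ℝ (fderiv ℝ f) 0 u w := fun u w => hι _ _
  have hsymm : ∀ u w, ⟪A u, w⟫ = ⟪u, A w⟫ := fun u w => by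
    rw [hA, ← real_inner_comm u, hA]
    exact (hf0.isSymmSndFDerivAt (by simp)).eq u w
  have hdf : ∀ v ∈ ball (0 : Euc k) τ, HasFDerivAt f (innerSL ℝ (g v)) v := fun v hv => by
    have h1 : DifferentiableAt ℝ f v :=
      (hf.contDiffAt (isOpen_ball.mem_nhds hv)).differentiableAt (by norm_num)
    have h2 : innerSL ℝ (g v) = fderiv ℝ f v := by ext w; exact hι _ _
    rw [h2]; exact h1.hasFDerivAt
  have hg : HasStrictFDerivAt g A 0 := by
    have h1 : ContDiffAt ℝ 1 (fderiv ℝ f) 0 := hf0.fderiv_right (by norm_num)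
    have h2 := h1.hasStrictFDerivAt (by norm_num)
    exact ι.hasStrictFDerivAt.comp 0 h2
  have hgo : (fun p : Euc k × Euc k => g p.2 - g p.1 - A (p.2 - p.1)) =o[𝓝 0]
      (fun p => p.2 - p.1) := by
    have h1 := hg.isLittleO
    have h2 : Tendsto (Prod.swap : Euc k × Euc k → _) (𝓝 0) (𝓝 ((0 : Euc k), (0 : Euc k))) :=
      continuous_swap.tendsto' _ _ rfl
    exact h1.comp_tendsto h2
  refine ⟨g, A, fun u w => ?_, hsymm, hdf, fun h0 => by simp [g, h0], hg.continuousAt, hgo, ?_⟩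
  · rw [hA, iteratedFDeriv_two_apply]; simp
  rw [Asymptotics.isLittleO_iff]
  intro c hc
  have h1 := (Asymptotics.isLittleO_iff.1 hgo) hc
  rw [Metric.eventually_nhds_iff_ball] at h1 ⊢
  obtain ⟨r, hr, h1⟩ := h1
  refine ⟨min r τ, by positivity, ?_⟩
  rintro ⟨v, w⟩ hp
  have hp' : ‖v‖ < min r τ ∧ ‖w‖ < min r τ := by
    rw [mem_ball_zero_iff, Prod.norm_def, max_lt_iff] at hp; exact hp
  let φ : Euc k → ℝ := fun x => f x - ⟪g v, x⟫ - 1 / 2 * ⟪A (x - v), x - v⟫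
  have hφ : ∀ x ∈ segment ℝ v w, HasFDerivWithinAt φ (innerSL ℝ (g x - g v - A (x - v)))
      (segment ℝ v w) x := by
    intro x hx
    have hx' : x ∈ ball (0 : Euc k) (min r τ) :=
      (convex_ball _ _).segment_subset (by simpa using hp'.1) (by simpa using hp'.2) hx
    have d1 := hdf x (ball_subset_ball (min_le_right _ _) hx')
    have d2 : HasFDerivAt (fun x : Euc k => ⟪g v, x⟫) (innerSL ℝ (g v)) x :=
      (innerSL ℝ (g v)).hasFDerivAt
    have d3 : HasFDerivAt (fun x : Euc k => x - v) (ContinuousLinearMap.id ℝ _) x :=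
      (hasFDerivAt_id x).sub_const v
    have d4 := (A.hasFDerivAt.comp x d3).inner ℝ d3
    have d5 := (d1.sub d2).sub (d4.const_mul (1 / 2))
    refine (d5.congr_fderiv ?_).hasFDerivWithinAt
    ext y
    simp [inner_sub_left]
    have := hsymm y (x - v)
    rw [map_sub, inner_sub_right, inner_sub_right, real_inner_comm (A x),
      real_inner_comm (A v)] at this
    rw [inner_sub_right]
    linarith
  have hbd : ∀ x ∈ segment ℝ v w, ‖innerSL ℝ (g x - g v - A (x - v))‖ ≤ c * ‖w - v‖ := by
    intro x hx
    have hx' : x ∈ ball (0 : Euc k) (min r τ) :=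
      (convex_ball _ _).segment_subset (by simpa using hp'.1) (by simpa using hp'.2) hx
    rw [innerSL_apply_norm]
    have h2 := h1 (v, x) (by
      rw [mem_ball_zero_iff, Prod.norm_def, max_lt_iff]
      exact ⟨hp'.1.trans_le (min_le_left _ _),
        (mem_ball_zero_iff.1 hx').trans_le (min_le_left _ _)⟩)
    refine h2.trans ?_
    gcongr
    exact norm_sub_le_of_mem_segment hx
  have h3 := (convex_segment v w).norm_image_sub_le_of_norm_hasFDerivWithin_le hφ hbd
    (left_mem_segment ℝ v w) (right_mem_segment ℝ v w)
  have h4 : φ w - φ v = f w - f v - ⟪g v, w - v⟫ - 1 / 2 * ⟪A (w - v), w - v⟫ := by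
    simp only [φ, sub_self, inner_sub_right]; ring
  rw [h4] at h3
  rw [Real.norm_of_nonneg (by positivity : (0:ℝ) ≤ ‖w - v‖ ^ 2)]
  refine h3.trans (le_of_eq ?_)
  ring

lemma isLittleO_sub_half_sq {α : Type*} {k : ℕ} {F : Filter α} {B : Euc k →L[ℝ] Euc k} {C : ℝ}
    (hB : ∀ u, ‖u‖ ≤ C * ‖B u‖) {u D : α → Euc k} {Q : α → ℝ}
    (hQ : (fun p => Q p - 1 / 2 * ‖B (u p)‖ ^ 2) =o[F] (fun p => ‖u p‖ ^ 2))
    (hD : (fun p => D p - B (u p)) =o[F] u) :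
    (fun p => Q p - 1 / 2 * ‖D p‖ ^ 2) =o[F] (fun p => ‖D p‖ ^ 2) := by
  have hu : u =O[F] (fun p => B (u p)) := Asymptotics.IsBigO.of_bound C (.of_forall fun p => hB _)
  have hBu : (fun p => B (u p)) =O[F] D :=
    (hD.trans_isBigO hu).right_isBigO_add.congr_right fun p => by simp
  have huD : u =O[F] D := hu.trans hBu
  have h1 : (fun p => Q p - 1 / 2 * ‖B (u p)‖ ^ 2) =o[F] (fun p => ‖D p‖ ^ 2) :=
    hQ.trans_isBigO (huD.norm_norm.pow 2)
  have h2 : (fun p => ‖D p‖ - ‖B (u p)‖) =o[F] (fun p => ‖D p‖) := by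
    refine (Asymptotics.IsBigO.of_bound 1 (.of_forall fun p => ?_)).trans_isLittleO
      (hD.trans_isBigO huD).norm_right
    simpa using abs_norm_sub_norm_le (D p) (B (u p))
  have h3 : (fun p => ‖D p‖ + ‖B (u p)‖) =O[F] (fun p => ‖D p‖) :=
    (Asymptotics.isBigO_refl _ _).add hBu.norm_norm
  have h4 := ((h2.mul_isBigO h3).const_mul_left (1 / 2)).congr_right fun p => (sq _).symm
  refine (h1.sub h4).congr_left (fun p => ?_)
  ring

/-- Data of a second order expansion of a hypersurface which is a graph over its tangent
hyperplane at `x`. -/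
structure GraphModel {k n : ℕ} (L : Euc k →ₗᵢ[ℝ] Euc n) (ν x : Euc n) (a : Euc k) (h : ℝ)
    (f : Euc k → ℝ) (g : Euc k → Euc k) (A : Euc k →L[ℝ] Euc k) : Prop where
  pos : 0 < h
  norm_normal : ‖ν‖ = 1
  inner_normal : ∀ v, ⟪L v, ν⟫ = 0
  inner_base : ⟪x, ν⟫ = h
  inner_tangent : ∀ v, ⟪L v, x⟫ = ⟪v, a⟫
  f_zero : f 0 = 0
  g_zero : g 0 = 0
  tendsto_f : Tendsto f (𝓝 0) (𝓝 0)
  tendsto_g : Tendsto g (𝓝 0) (𝓝 0)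
  sub_g : (fun p : Euc k × Euc k => g p.2 - g p.1 - A (p.2 - p.1)) =o[𝓝 0] (fun p => p.2 - p.1)
  sub_f : (fun p : Euc k × Euc k => f p.2 - f p.1 - ⟪g p.1, p.2 - p.1⟫
        - 1 / 2 * ⟪A (p.2 - p.1), p.2 - p.1⟫) =o[𝓝 0] (fun p => ‖p.2 - p.1‖ ^ 2)

/-- The point of the graph of `-f` over `v`. -/
def graphPt {k n : ℕ} (L : Euc k →ₗᵢ[ℝ] Euc n) (ν x : Euc n) (f : Euc k → ℝ) (v : Euc k) : Euc n :=
  x + L v - f v • ν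

/-- The support function of the normal direction at the point of the graph over `v`. -/
def graphDen {k : ℕ} (a : Euc k) (h : ℝ) (f : Euc k → ℝ) (g : Euc k → Euc k) (v : Euc k) : ℝ :=
  h + ⟪a, g v⟫ + ⟪g v, v⟫ - f v

/-- The point of the polar body dual to the point of the graph over `v`. -/
def graphDual {k n : ℕ} (L : Euc k →ₗᵢ[ℝ] Euc n) (ν : Euc n) (a : Euc k) (h : ℝ)
    (f : Euc k → ℝ) (g : Euc k → Euc k) (v : Euc k) : Euc n :=
  (graphDen a h f g v)⁻¹ • (ν + L (g v))

section
variable {k n : ℕ} {L : Euc k →ₗᵢ[ℝ] Euc n} {ν x : Euc n} {a : Euc k} {h : ℝ}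
  {f : Euc k → ℝ} {g : Euc k → Euc k} {A : Euc k →L[ℝ] Euc k}

lemma GraphModel.inner_graph (M : GraphModel L ν x a h f g A) (v w : Euc k) :
    ⟪ν + L (g v), graphPt L ν x f w⟫ = h - f w + ⟪g v, a⟫ + ⟪g v, w⟫ := by
  have h1 : ⟪ν, L w⟫ = 0 := by rw [real_inner_comm]; exact M.inner_normal w
  have h2 : ⟪ν, ν⟫ = 1 := by rw [real_inner_self_eq_norm_sq, M.norm_normal]; norm_num
  have h3 : ⟪ν, x⟫ = h := by rw [real_inner_comm]; exact M.inner_base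
  simp only [graphPt, inner_add_left, inner_add_right, inner_sub_right, inner_smul_right, h1, h2, h3,
    M.inner_normal, M.inner_tangent, L.inner_map_map]
  ring

lemma GraphModel.tendsto_den (M : GraphModel L ν x a h f g A) :
    Tendsto (graphDen a h f g) (𝓝 0) (𝓝 h) := by
  have h1 : Tendsto (fun v => h + ⟪a, g v⟫ + ⟪g v, v⟫ - f v) (𝓝 0)
      (𝓝 (h + ⟪a, (0 : Euc k)⟫ + ⟪(0 : Euc k), (0 : Euc k)⟫ - 0)) :=
    ((tendsto_const_nhds.add (tendsto_const_nhds.inner M.tendsto_g)).add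
      (M.tendsto_g.inner tendsto_id)).sub M.tendsto_f
  rw [inner_zero_right, inner_zero_right, add_zero, add_zero, sub_zero] at h1
  exact h1

lemma tendsto_fst_zero : Tendsto (Prod.fst : Euc k × Euc k → Euc k) (𝓝 0) (𝓝 0) :=
  continuous_fst.tendsto' _ _ rfl

lemma tendsto_snd_zero : Tendsto (Prod.snd : Euc k × Euc k → Euc k) (𝓝 0) (𝓝 0) :=
  continuous_snd.tendsto' _ _ rfl

lemma tendsto_swap_zero : Tendsto (Prod.swap : Euc k × Euc k → Euc k × Euc k) (𝓝 0) (𝓝 0) :=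
  continuous_swap.tendsto' _ _ rfl

lemma GraphModel.tendsto_inv_den (M : GraphModel L ν x a h f g A) :
    Tendsto (fun v => (graphDen a h f g v)⁻¹) (𝓝 0) (𝓝 h⁻¹) :=
  M.tendsto_den.inv₀ M.pos.ne'

lemma isBigO_quadratic (A : Euc k →L[ℝ] Euc k) (F : Filter (Euc k × Euc k)) :
    (fun p : Euc k × Euc k => ⟪A (p.2 - p.1), p.2 - p.1⟫) =O[F] (fun p => ‖p.2 - p.1‖ ^ 2) := by
  refine Asymptotics.IsBigO.of_bound ‖A‖ (.of_forall fun p => ?_)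
  rw [Real.norm_of_nonneg (by positivity : (0:ℝ) ≤ ‖p.2 - p.1‖ ^ 2), sq, ← mul_assoc]
  exact (norm_inner_le_norm _ _).trans (by gcongr; exact A.le_opNorm _)

lemma isLittleO_sq_sub : (fun p : Euc k × Euc k => ‖p.2 - p.1‖ ^ 2) =o[𝓝 0]
    (fun p => p.2 - p.1) := by
  have h1 : Tendsto (fun p : Euc k × Euc k => ‖p.2 - p.1‖) (𝓝 0) (𝓝 0) := by
    refine Continuous.tendsto' (by fun_prop) _ _ (by simp)
  have h2 := ((Asymptotics.isLittleO_one_iff ℝ).2 h1).mul_isBigO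
    (Asymptotics.isBigO_refl (fun p : Euc k × Euc k => ‖p.2 - p.1‖) (𝓝 0))
  refine (h2.congr (fun p => (sq _).symm) (fun p => one_mul _)).of_norm_right

lemma GraphModel.gap (M : GraphModel L ν x a h f g A) :
    (fun p : Euc k × Euc k => 1 - ⟪graphDual L ν a h f g p.1, graphPt L ν x f p.2⟫
      - 1 / 2 * (h⁻¹ * ⟪A (p.2 - p.1), p.2 - p.1⟫)) =o[𝓝 0] (fun p => ‖p.2 - p.1‖ ^ 2) := by
  have hμ := M.tendsto_inv_den.comp tendsto_fst_zero
  have h1 := M.sub_f.mul_isBigO (hμ.isBigO_one ℝ)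
  have h2 : Tendsto (fun p : Euc k × Euc k => (graphDen a h f g p.1)⁻¹ - h⁻¹) (𝓝 0) (𝓝 0) := by
    simpa using hμ.sub_const h⁻¹
  have h3 := ((isBigO_quadratic A (𝓝 0)).mul_isLittleO
    ((Asymptotics.isLittleO_one_iff ℝ).2 h2)).const_mul_left (1 / 2)
  refine (h1.add h3).congr' ?_ (.of_forall fun p => by simp)
  have hne : ∀ᶠ p : Euc k × Euc k in 𝓝 0, graphDen a h f g p.1 ≠ 0 :=
    tendsto_fst_zero.eventually (M.tendsto_den.eventually_ne M.pos.ne')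
  filter_upwards [hne] with p hp
  rw [graphDual, inner_smul_left, M.inner_graph]
  have h4 : (graphDen a h f g p.1)⁻¹ * (h + ⟪g p.1, a⟫ + ⟪g p.1, p.1⟫ - f p.1) = 1 := by
    rw [real_inner_comm a]; exact inv_mul_cancel₀ hp
  simp only [Function.comp, conj_trivial]
  rw [inner_sub_right (g p.1)]
  linear_combination h4

lemma GraphModel.gap_isBigO (M : GraphModel L ν x a h f g A) :
    (fun p : Euc k × Euc k => 1 - ⟪graphDual L ν a h f g p.1, graphPt L ν x f p.2⟫)
      =O[𝓝 0] (fun p => ‖p.2 - p.1‖ ^ 2) := by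
  have h1 := ((isBigO_quadratic A (𝓝 0)).const_mul_left h⁻¹).const_mul_left (1 / 2)
  exact (M.gap.isBigO.add h1).congr_left fun p => by ring

lemma GraphModel.isLittleO_sub_f (M : GraphModel L ν x a h f g A) :
    (fun p : Euc k × Euc k => f p.2 - f p.1) =o[𝓝 0] (fun p => p.2 - p.1) := by
  have h1 : (fun p : Euc k × Euc k => ⟪g p.1, p.2 - p.1⟫) =o[𝓝 0] (fun p => p.2 - p.1) := by
    have h2 := (M.tendsto_g.comp (tendsto_fst_zero (k := k))).norm
    rw [norm_zero] at h2
    have h3 := ((Asymptotics.isLittleO_one_iff ℝ).2 h2).mul_isBigO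
      (Asymptotics.isBigO_refl (fun p : Euc k × Euc k => ‖p.2 - p.1‖) (𝓝 0))
    simp only [one_mul] at h3
    refine (Asymptotics.IsBigO.of_bound 1 (.of_forall fun p => ?_)).trans_isLittleO
      h3.of_norm_right
    rw [one_mul, norm_mul, norm_norm]
    simpa using norm_inner_le_norm (𝕜 := ℝ) (g p.1) (p.2 - p.1)
  have h4 := (M.sub_f.isBigO.add ((isBigO_quadratic A (𝓝 0)).const_mul_left (1 / 2))).trans_isLittleO
    isLittleO_sq_sub
  exact (h4.add h1).congr_left fun p => by ring

lemma GraphModel.isBigO_sub_g (M : GraphModel L ν x a h f g A) :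
    (fun p : Euc k × Euc k => g p.2 - g p.1) =O[𝓝 0]
      (fun p => p.2 - p.1) := by
  exact (M.sub_g.isBigO.add (A.isBigO_comp (fun p : Euc k × Euc k => p.2 - p.1) (𝓝 0))).congr_left
    fun p => by simp

lemma GraphModel.isBigO_sub_den (M : GraphModel L ν x a h f g A) :
    (fun p : Euc k × Euc k => graphDen a h f g p.2 - graphDen a h f g p.1)
      =O[𝓝 0] (fun p => p.2 - p.1) := by
  have hin : ∀ {u w : Euc k × Euc k → Euc k}, u =O[𝓝 0] (fun p => p.2 - p.1) →
      w =O[𝓝 0] (fun _ => (1:ℝ)) → (fun p => ⟪u p, w p⟫) =O[𝓝 0] (fun p => p.2 - p.1) := by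
    intro u w hu hw
    have h1 := hu.norm_norm.mul hw.norm_norm
    simp only [norm_one, mul_one] at h1
    refine ((Asymptotics.IsBigO.of_bound 1 (.of_forall fun p => ?_)).trans h1).of_norm_right
    rw [one_mul, norm_mul, norm_norm, norm_norm]
    exact norm_inner_le_norm _ _
  have h1 := hin M.isBigO_sub_g (Asymptotics.isBigO_const_const a one_ne_zero _)
  have h2 := hin M.isBigO_sub_g (tendsto_snd_zero.isBigO_one ℝ)
  have h3 := hin (Asymptotics.isBigO_refl _ _)
    ((M.tendsto_g.comp (tendsto_fst_zero (k := k))).isBigO_one ℝ)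
  refine (((h1.add h2).add h3).sub M.isLittleO_sub_f.isBigO).congr_left fun p => ?_
  simp only [graphDen, Function.comp, inner_sub_left]
  rw [real_inner_comm _ a, real_inner_comm _ a, real_inner_comm (g p.1) p.2,
    real_inner_comm (g p.1) p.1]
  ring

lemma GraphModel.tangential_graphPt (M : GraphModel L ν x a h f g A) {P : Euc n →L[ℝ] Euc k}
    (hP : ∀ v w, ⟪v, P w⟫ = ⟪L v, w⟫) (v : Euc k) : P (graphPt L ν x f v) = a + v := by
  refine ext_inner_left ℝ fun w => ?_
  rw [hP, graphPt, inner_sub_right, inner_add_right, inner_smul_right, M.inner_normal,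
    M.inner_tangent, L.inner_map_map, inner_add_right]
  ring

lemma GraphModel.tangential_graphDual (M : GraphModel L ν x a h f g A) {P : Euc n →L[ℝ] Euc k}
    (hP : ∀ v w, ⟪v, P w⟫ = ⟪L v, w⟫) (v : Euc k) :
    P (graphDual L ν a h f g v) = (graphDen a h f g v)⁻¹ • g v := by
  refine ext_inner_left ℝ fun w => ?_
  rw [hP, graphDual, inner_smul_right, inner_add_right, M.inner_normal, L.inner_map_map,
    inner_smul_right]
  ring

lemma GraphModel.normal_graphPt (M : GraphModel L ν x a h f g A) (v : Euc k) :
    ⟪h⁻¹ • ν, graphPt L ν x f v⟫ = 1 - f v / h := by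
  have h1 : ⟪ν, L v⟫ = 0 := by rw [real_inner_comm]; exact M.inner_normal v
  have h2 : ⟪ν, ν⟫ = 1 := by rw [real_inner_self_eq_norm_sq, M.norm_normal]; norm_num
  have h3 : ⟪ν, x⟫ = h := by rw [real_inner_comm]; exact M.inner_base
  have := M.pos.ne'
  rw [inner_smul_left, graphPt, inner_sub_right, inner_add_right, inner_smul_right, h1, h2, h3]
  simp
  field_simp

/-- `1 - ⟪m, z⟫` for the dual point over `p.1` and the graph point over `p.2`. -/
def graphGap {k n : ℕ} (L : Euc k →ₗᵢ[ℝ] Euc n) (ν x : Euc n) (a : Euc k) (h : ℝ)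
    (f : Euc k → ℝ) (g : Euc k → Euc k) (p : Euc k × Euc k) : ℝ :=
  1 - ⟪graphDual L ν a h f g p.1, graphPt L ν x f p.2⟫

lemma isLittleO_smul_of_tendsto {E F : Type*} [NormedAddCommGroup E] [NormedSpace ℝ E]
    [NormedAddCommGroup F] {α : Type*} {l : Filter α} {c : α → ℝ} {w : α → F} {d : α → E}
    (hc : c =O[l] w) (hd : Tendsto d l (𝓝 0)) : (fun p => c p • d p) =o[l] w := by
  have h1 := hc.norm_right.smul_isLittleO ((Asymptotics.isLittleO_one_iff ℝ).2 hd)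
  exact (h1.congr_right fun p => by simp).of_norm_right

lemma GraphModel.isLittleO_left (M : GraphModel L ν x a h f g A) {P : Euc n →L[ℝ] Euc k}
    (hP : ∀ v w, ⟪v, P w⟫ = ⟪L v, w⟫) (B : Euc k →L[ℝ] Euc k) :
    (fun p : Euc k × Euc k =>
      B (P (graphPt L ν x f p.2 - (1 - graphGap L ν x a h f g p) • graphPt L ν x f p.1)
        - ⟪h⁻¹ • ν, graphPt L ν x f p.2
            - (1 - graphGap L ν x a h f g p) • graphPt L ν x f p.1⟫ • a) - B (p.2 - p.1))
      =o[𝓝 0] (fun p => p.2 - p.1) := by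
  have hq : graphGap L ν x a h f g =o[𝓝 0] (fun p => p.2 - p.1) :=
    M.gap_isBigO.trans_isLittleO isLittleO_sq_sub
  have h1 : Tendsto (fun p : Euc k × Euc k => p.1 + (f p.1 / h) • a) (𝓝 0) (𝓝 0) := by
    have h2 := (M.tendsto_f.comp (tendsto_fst_zero (k := k))).div_const h
    have h3 := (tendsto_fst_zero (k := k)).add (h2.smul_const a)
    simpa using h3
  have h2 := isLittleO_smul_of_tendsto hq.isBigO h1
  have h3 : (fun p : Euc k × Euc k => ((f p.2 - f p.1) / h) • a) =o[𝓝 0] (fun p => p.2 - p.1) := by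
    have h4 := M.isLittleO_sub_f.const_mul_left h⁻¹
    have h5 := (h4.norm_right.smul_isBigO
      (Asymptotics.isBigO_const_const a (one_ne_zero (α := ℝ)) (𝓝 (0 : Euc k × Euc k))))
    refine (h5.congr (fun p => ?_) (fun p => ?_)).of_norm_right
    · rw [div_eq_inv_mul]
    · simp
  refine ((B.isBigO_comp _ _).trans_isLittleO (h2.add h3)).congr_left fun p => ?_
  rw [← map_sub]
  congr 1
  rw [map_sub, map_smul, inner_sub_right, inner_smul_right, M.normal_graphPt, M.normal_graphPt,
    M.tangential_graphPt hP, M.tangential_graphPt hP]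
  module

lemma GraphModel.isLittleO_right (M : GraphModel L ν x a h f g A) {P : Euc n →L[ℝ] Euc k}
    (hP : ∀ v w, ⟪v, P w⟫ = ⟪L v, w⟫) {B B' : Euc k →L[ℝ] Euc k}
    (hB : ∀ v, B' (h⁻¹ • A v) = B v) :
    (fun p : Euc k × Euc k =>
      B' (P (graphDual L ν a h f g p.2
        - (1 - graphGap L ν x a h f g p.swap) • graphDual L ν a h f g p.1)) - B (p.2 - p.1))
      =o[𝓝 0] (fun p => p.2 - p.1) := by
  have hq : (fun p : Euc k × Euc k => graphGap L ν x a h f g p.swap) =O[𝓝 0] (fun p => p.2 - p.1) := by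
    have h1 := (M.gap_isBigO.trans_isLittleO isLittleO_sq_sub).comp_tendsto
      (tendsto_swap_zero (k := k))
    refine (h1.isBigO.norm_right.congr_right fun p => ?_).of_norm_right
    exact norm_sub_rev _ _
  have hμ1 := M.tendsto_inv_den.comp (tendsto_fst_zero (k := k))
  have hμ2 := M.tendsto_inv_den.comp (tendsto_snd_zero (k := k))
  have hg1 := M.tendsto_g.comp (tendsto_fst_zero (k := k))
  have h1 : Tendsto (fun p : Euc k × Euc k => (graphDen a h f g p.1)⁻¹ • g p.1) (𝓝 0) (𝓝 0) := by
    simpa using hμ1.smul hg1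
  have t1 := isLittleO_smul_of_tendsto hq h1
  have t2 : (fun p : Euc k × Euc k => (graphDen a h f g p.2)⁻¹ • (g p.2 - g p.1 - A (p.2 - p.1)))
      =o[𝓝 0] (fun p => p.2 - p.1) := by
    have h2 := (hμ2.isBigO_one ℝ).smul_isLittleO M.sub_g
    exact h2.congr_right fun p => by simp
  have t3 : (fun p : Euc k × Euc k => ((graphDen a h f g p.2)⁻¹ - h⁻¹) • A (p.2 - p.1))
      =o[𝓝 0] (fun p => p.2 - p.1) := by
    have h2 : Tendsto (fun p : Euc k × Euc k => (graphDen a h f g p.2)⁻¹ - h⁻¹) (𝓝 0) (𝓝 0) := by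
      simpa using hμ2.sub_const h⁻¹
    have h3 := ((Asymptotics.isLittleO_one_iff ℝ).2 h2).smul_isBigO
      (A.isBigO_comp (fun p : Euc k × Euc k => p.2 - p.1) (𝓝 0))
    exact h3.congr_right fun p => by simp
  have t4 : (fun p : Euc k × Euc k => ((graphDen a h f g p.2)⁻¹ - (graphDen a h f g p.1)⁻¹) • g p.1)
      =o[𝓝 0] (fun p => p.2 - p.1) := by
    refine isLittleO_smul_of_tendsto ?_ hg1
    have h2 := ((hμ1.mul hμ2).isBigO_one ℝ).mul M.isBigO_sub_den.neg_left.norm_right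
    refine (h2.congr' ?_ (.of_forall fun p => one_mul _)).of_norm_right
    have hne1 := tendsto_fst_zero.eventually (M.tendsto_den.eventually_ne M.pos.ne')
    have hne2 := tendsto_snd_zero.eventually (M.tendsto_den.eventually_ne M.pos.ne')
    filter_upwards [hne1, hne2] with p hp1 hp2
    simp only [Function.comp]
    field_simp
    ring
  refine ((B'.isBigO_comp _ _).trans_isLittleO (((t2.add t3).add t4).add t1)).congr_left fun p => ?_
  rw [← hB, ← map_sub]
  congr 1
  rw [P.map_sub, P.map_smul, M.tangential_graphDual hP, M.tangential_graphDual hP]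
  module

lemma norm_perp_frame (I : WithLp 2 (Euc k × ℝ) ≃ₗᵢ[ℝ] Euc n) (v : Euc k) (t : ℝ) :
    ‖perp (I (WithLp.toLp 2 (0, 1))) (I (WithLp.toLp 2 (v, t)))‖ = ‖v‖ := by
  have h1 : perp (I (WithLp.toLp 2 (0, 1))) (I (WithLp.toLp 2 (v, t)))
      = I (WithLp.toLp 2 (v, 0)) := by
    rw [perp_apply, I.inner_map_map, WithLp.prod_inner_apply, ← map_smul, ← map_sub]
    rw [← WithLp.toLp_smul, ← WithLp.toLp_sub]
    congr 2
    ext <;> simp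
  rw [h1, I.norm_map, ← sq_eq_sq₀ (norm_nonneg _) (norm_nonneg _), WithLp.prod_norm_sq_eq_of_L2]
  simp

end

/-- The map `w ↦ I (Φ w, ⟪ℓ, w⟫)`. -/
def frameMap {k n : ℕ} (I : WithLp 2 (Euc k × ℝ) ≃ₗᵢ[ℝ] Euc n) (Φ : Euc n →L[ℝ] Euc k)
    (ℓ : Euc n) : Euc n →L[ℝ] Euc n :=
  I.toContinuousLinearEquiv.toContinuousLinearMap ∘L
    (WithLp.prodContinuousLinearEquiv 2 ℝ (Euc k) ℝ).symm.toContinuousLinearMap ∘L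
      (Φ.prod (innerSL ℝ ℓ))

section
variable {k n : ℕ} {L : Euc k →ₗᵢ[ℝ] Euc n} {ν x : Euc n} {a : Euc k} {h : ℝ}
  {f : Euc k → ℝ} {g : Euc k → Euc k} {A : Euc k →L[ℝ] Euc k}

lemma frameMap_apply (I : WithLp 2 (Euc k × ℝ) ≃ₗᵢ[ℝ] Euc n) (Φ : Euc n →L[ℝ] Euc k)
    (ℓ w : Euc n) : frameMap I Φ ℓ w = I (WithLp.toLp 2 (Φ w, ⟪ℓ, w⟫)) := rfl

lemma inner_frameMap (I : WithLp 2 (Euc k × ℝ) ≃ₗᵢ[ℝ] Euc n) (Φ : Euc n →L[ℝ] Euc k)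
    (ℓ w : Euc n) : ⟪I (WithLp.toLp 2 (0, 1)), frameMap I Φ ℓ w⟫ = ⟪ℓ, w⟫ := by
  rw [frameMap_apply, I.inner_map_map, WithLp.prod_inner_apply]; simp

lemma norm_perp_frameMap (I : WithLp 2 (Euc k × ℝ) ≃ₗᵢ[ℝ] Euc n) (Φ : Euc n →L[ℝ] Euc k)
    (ℓ w : Euc n) : ‖perp (I (WithLp.toLp 2 (0, 1))) (frameMap I Φ ℓ w)‖ = ‖Φ w‖ := by
  rw [frameMap_apply, norm_perp_frame]

lemma GraphModel.eventually_left (M : GraphModel L ν x a h f g A) {P : Euc n →L[ℝ] Euc k}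
    (hP : ∀ v w, ⟪v, P w⟫ = ⟪L v, w⟫) {B : Euc k →L[ℝ] Euc k} {C : ℝ}
    (hB : ∀ u, ‖u‖ ≤ C * ‖B u‖) (hBA : ∀ u, ‖B u‖ ^ 2 = h⁻¹ * ⟪A u, u⟫) {ε : ℝ} (hε : 0 < ε) :
    ∃ r > 0, ∀ v w, ‖v‖ < r → ‖w‖ < r →
      |graphGap L ν x a h f g (v, w) - 1 / 2 * ‖B (P (graphPt L ν x f w
            - (1 - graphGap L ν x a h f g (v, w)) • graphPt L ν x f v)
          - ⟪h⁻¹ • ν, graphPt L ν x f w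
            - (1 - graphGap L ν x a h f g (v, w)) • graphPt L ν x f v⟫ • a)‖ ^ 2|
        ≤ ε * ‖B (P (graphPt L ν x f w
            - (1 - graphGap L ν x a h f g (v, w)) • graphPt L ν x f v)
          - ⟪h⁻¹ • ν, graphPt L ν x f w
            - (1 - graphGap L ν x a h f g (v, w)) • graphPt L ν x f v⟫ • a)‖ ^ 2 := by
  have h1 := M.gap
  simp only [← hBA] at h1
  have h2 := (Asymptotics.isLittleO_iff.1
    (isLittleO_sub_half_sq hB h1 (M.isLittleO_left hP B))) hε
  rw [Metric.eventually_nhds_iff_ball] at h2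
  obtain ⟨r, hr, h2⟩ := h2
  refine ⟨r, hr, fun v w hv hw => ?_⟩
  have h3 := h2 (v, w) (by rw [mem_ball_zero_iff, Prod.norm_def, max_lt_iff]; exact ⟨hv, hw⟩)
  rw [Real.norm_eq_abs, norm_pow, norm_norm] at h3
  exact h3

lemma GraphModel.eventually_right (M : GraphModel L ν x a h f g A) {P : Euc n →L[ℝ] Euc k}
    (hP : ∀ v w, ⟪v, P w⟫ = ⟪L v, w⟫) {B B' : Euc k →L[ℝ] Euc k} {C : ℝ}
    (hB : ∀ u, ‖u‖ ≤ C * ‖B u‖) (hBA : ∀ u, ‖B u‖ ^ 2 = h⁻¹ * ⟪A u, u⟫)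
    (hB' : ∀ v, B' (h⁻¹ • A v) = B v) {ε : ℝ} (hε : 0 < ε) :
    ∃ r > 0, ∀ v w, ‖v‖ < r → ‖w‖ < r →
      |graphGap L ν x a h f g (w, v) - 1 / 2 * ‖B' (P (graphDual L ν a h f g w
            - (1 - graphGap L ν x a h f g (w, v)) • graphDual L ν a h f g v))‖ ^ 2|
        ≤ ε * ‖B' (P (graphDual L ν a h f g w
            - (1 - graphGap L ν x a h f g (w, v)) • graphDual L ν a h f g v))‖ ^ 2 := by
  have h0 := M.gap
  simp only [← hBA] at h0
  have h1 : (fun p : Euc k × Euc k => graphGap L ν x a h f g p.swap - 1 / 2 * ‖B (p.2 - p.1)‖ ^ 2)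
      =o[𝓝 0] (fun p => ‖p.2 - p.1‖ ^ 2) := by
    refine (h0.comp_tendsto (tendsto_swap_zero (k := k))).congr (fun p => ?_) (fun p => ?_)
    · simp only [Function.comp, Prod.fst_swap, Prod.snd_swap]
      rw [← norm_neg (B (p.1 - p.2)), ← map_neg, neg_sub]
      rfl
    · simp [norm_sub_rev]
  have h2 := (Asymptotics.isLittleO_iff.1
    (isLittleO_sub_half_sq hB h1 (M.isLittleO_right hP hB'))) hε
  rw [Metric.eventually_nhds_iff_ball] at h2
  obtain ⟨r, hr, h2⟩ := h2
  refine ⟨r, hr, fun v w hv hw => ?_⟩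
  have h3 := h2 (v, w) (by rw [mem_ball_zero_iff, Prod.norm_def, max_lt_iff]; exact ⟨hv, hw⟩)
  rw [Real.norm_eq_abs, norm_pow, norm_norm] at h3
  exact h3

lemma eq_of_expand {S T : Set (Euc n)} {e ℓ : Euc n} {J : Euc n →L[ℝ] Euc n}
    (hPP : PolarPair S T) (hmem : (x, ℓ) ∈ contact S T) (hdet : J.det ≠ 0)
    (hin : ∀ w, ⟪e, J w⟫ = ⟪ℓ, w⟫)
    (hexp : ∀ ε > 0, ∃ r > 0, ∀ y ℓ' z m, (y, ℓ') ∈ contact S T → (z, m) ∈ contact S T →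
      dist y x < r → dist ℓ' ℓ < r → dist z x < r → dist m ℓ < r →
      |1 - ⟪ℓ', z⟫ - 1 / 2 * ‖perp e (J (z - ⟪ℓ', z⟫ • y))‖ ^ 2|
        ≤ ε * ‖perp e (J (z - ⟪ℓ', z⟫ • y))‖ ^ 2) {z : Euc n} (hz : z ∈ S) (hz1 : ⟪ℓ, z⟫ = 1) :
    z = x := by
  obtain ⟨r, hr, H⟩ := hexp (1 / 4) (by norm_num)
  have hcont : Tendsto (fun t : ℝ => x + t • (z - x)) (𝓝[>] 0) (𝓝 x) := by
    have : Continuous (fun t : ℝ => x + t • (z - x)) := by fun_prop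
    exact (this.tendsto' 0 x (by simp)).mono_left nhdsWithin_le_nhds
  have hev := (hcont.eventually (ball_mem_nhds x hr)).and
    (Ioo_mem_nhdsGT (zero_lt_one (α := ℝ)))
  obtain ⟨t, ht1, ht0, ht⟩ := hev.exists
  have hin1 : ⟪ℓ, x + t • (z - x)⟫ = 1 := by
    rw [inner_add_right, inner_smul_right, inner_sub_right, hz1, hmem.2.2]; ring
  have hzt : (x + t • (z - x), ℓ) ∈ contact S T := by
    refine ⟨?_, hmem.2.1, hin1⟩
    exact hPP.convex_left.add_smul_sub_mem hmem.1 hz ⟨ht0.le, ht.le⟩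
  have h1 := H x ℓ _ ℓ hmem hzt (by simpa using hr) (by simpa using hr) ht1 (by simpa using hr)
  rw [hin1, one_smul, add_sub_cancel_left, map_smul, map_smul] at h1
  have h2 : perp e (J (z - x)) = 0 := by
    have h3 : ‖t • perp e (J (z - x))‖ ^ 2 ≤ 0 := by
      have := neg_le_abs (1 - 1 - 1 / 2 * ‖t • perp e (J (z - x))‖ ^ 2)
      linarith
    have h4 : ‖t • perp e (J (z - x))‖ = 0 := by nlinarith [norm_nonneg (t • perp e (J (z - x)))]
    exact (smul_eq_zero.1 (norm_eq_zero.1 h4)).resolve_left ht0.ne'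
  rw [perp_apply, hin, inner_sub_right, hz1, hmem.2.2] at h2
  have h5 : J (z - x) = 0 := by simpa using h2
  obtain ⟨C, hC, hb⟩ := exists_inverse_bound hdet
  have h6 := hb (z - x)
  rw [h5, norm_zero, mul_zero] at h6
  exact sub_eq_zero.1 (norm_le_zero_iff.1 h6)

lemma GraphModel.exists_osc (M : GraphModel L ν x a h f g A) {S T : Set (Euc n)}
    (hkn : k + 1 = n) (I : WithLp 2 (Euc k × ℝ) ≃ₗᵢ[ℝ] Euc n) (hPP : PolarPair S T)
    (hmem : (x, h⁻¹ • ν) ∈ contact S T) {ρ : ℝ} (hρ : 0 < ρ)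
    (hC : ∀ y m, (y, m) ∈ contact S T → dist y x < ρ →
      ∃ v, ‖v‖ ≤ dist y x ∧ y = graphPt L ν x f v ∧ m = graphDual L ν a h f g v)
    (hA : (A : Euc k →ₗ[ℝ] Euc k).IsPositive)
    (hdet : 0 < LinearMap.det (A : Euc k →ₗ[ℝ] Euc k)) :
    ∃ J J' : Euc n →L[ℝ] Euc n,
      Osc (I (WithLp.toLp 2 (0, 1))) S T x (h⁻¹ • ν) J ∧
      Osc (I (WithLp.toLp 2 (0, 1))) T S (h⁻¹ • ν) x J' ∧
      |J.det| ^ 2 = LinearMap.det (A : Euc k →ₗ[ℝ] Euc k) / h ^ (n + 1) ∧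
      |J'.det| * |J.det| = 1 := by
  have hh := M.pos
  have hA' : (h⁻¹ • (A : Euc k →ₗ[ℝ] Euc k)).IsPositive := by
    refine hA.smul_of_nonneg ?_
    positivity
  obtain ⟨B₀, hB₀s, hB₀⟩ := exists_selfAdjoint_sqrt hA'
  have hdB : LinearMap.det B₀ ^ 2 = LinearMap.det (A : Euc k →ₗ[ℝ] Euc k) / h ^ k := by
    rw [sq, ← LinearMap.det_comp, hB₀, LinearMap.det_smul]
    simp; field_simp
  have hdB0 : LinearMap.det B₀ ≠ 0 := by
    intro h0
    rw [h0] at hdB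
    have : 0 < LinearMap.det (A : Euc k →ₗ[ℝ] Euc k) / h ^ k := by positivity
    rw [← hdB] at this
    norm_num at this
  let eB := LinearEquiv.ofIsUnitDet (f := B₀) (v := (EuclideanSpace.basisFun (Fin k) ℝ).toBasis)
    (v' := (EuclideanSpace.basisFun (Fin k) ℝ).toBasis)
    (by rw [LinearMap.det_toMatrix]; exact hdB0.isUnit)
  let B : Euc k →L[ℝ] Euc k := B₀.toContinuousLinearMap
  let B' : Euc k →L[ℝ] Euc k := eB.symm.toLinearMap.toContinuousLinearMap
  have hBsym : ∀ u w, ⟪B u, w⟫ = ⟪u, B w⟫ := hB₀s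
  have hBB : ∀ u, B (B u) = h⁻¹ • A u := fun u => congrArg (fun F => F u) hB₀
  have hB'B : ∀ u, B' (B u) = u := fun u => eB.symm_apply_apply u
  have hBB' : ∀ u, B (B' u) = u := fun u => eB.apply_symm_apply u
  have hB'sym : ∀ u w, ⟪B' u, B w⟫ = ⟪u, w⟫ := fun u w => by rw [← hBsym, hBB']
  have hBA : ∀ u, ‖B u‖ ^ 2 = h⁻¹ * ⟪A u, u⟫ := fun u => by
    rw [← real_inner_self_eq_norm_sq, ← hBsym, hBB, inner_smul_left]; simp
  have hB' : ∀ v, B' (h⁻¹ • A v) = B v := fun v => by rw [← hBB, hB'B]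
  obtain ⟨C, -, hBC⟩ := exists_inverse_bound (n := k) (J := B) hdB0
  let P : Euc n →L[ℝ] Euc k := ContinuousLinearMap.adjoint L.toContinuousLinearMap
  have hP : ∀ v w, ⟪v, P w⟫ = ⟪L v, w⟫ := fun v w => by
    simp [P, ContinuousLinearMap.adjoint_inner_right]
  have hPx : P x = a := ext_inner_left ℝ fun v => by rw [hP, M.inner_tangent]
  have hPν : P (h⁻¹ • ν) = 0 := ext_inner_left ℝ fun v => by
    rw [hP, inner_smul_right, M.inner_normal]; simp
  set ℓ := h⁻¹ • ν with hℓ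
  have hPL : ∀ v, P (L v) = v := fun v => ext_inner_left ℝ fun w => by rw [hP, L.inner_map_map]
  let Φ : Euc n →L[ℝ] Euc k := B ∘L (P - (innerSL ℝ ℓ).smulRight a)
  have hΦ : ∀ w, Φ w = B (P w - ⟪ℓ, w⟫ • a) := fun w => by simp [Φ]
  let J := frameMap I Φ ℓ
  let J' := frameMap I (B' ∘L P) x
  have hνL : ∀ v, ⟪ν, L v⟫ = 0 := fun v => by rw [real_inner_comm]; exact M.inner_normal v
  have hνν : ⟪ν, ν⟫ = 1 := by rw [real_inner_self_eq_norm_sq, M.norm_normal]; norm_num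
  have hxL : ∀ v, ⟪x, L v⟫ = ⟪a, v⟫ := fun v => by
    rw [real_inner_comm, M.inner_tangent, real_inner_comm]
  have hPν' : P ν = 0 := ext_inner_left ℝ fun v => by rw [hP, M.inner_normal]; simp
  obtain ⟨Ψ, hΨ⟩ := exists_isometry_extension hkn L M.norm_normal M.inner_normal
  have hPΨ : ∀ v t, P (Ψ (WithLp.toLp 2 (v, t))) = v := fun v t => by
    rw [hΨ, P.map_add, hPL, P.map_smul, hPν', smul_zero, add_zero]
  have hℓΨ : ∀ v t, ⟪ℓ, Ψ (WithLp.toLp 2 (v, t))⟫ = h⁻¹ * t := fun v t => by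
    rw [hΨ, hℓ, inner_smul_left, inner_add_right, hνL, inner_smul_right, hνν]; simp
  have hJΨ : ∀ v t, J (Ψ (WithLp.toLp 2 (v, t)))
      = I (WithLp.toLp 2 (B (v - t • h⁻¹ • a), h⁻¹ * t)) := fun v t => by
    rw [frameMap_apply, hΦ, hPΨ, hℓΨ, smul_smul, mul_comm t]
  have hJJ' : ∀ m w, ⟪J' m, J w⟫ = ⟪m, w⟫ := by
    intro m w
    obtain ⟨⟨v, t⟩, rfl⟩ := Ψ.surjective w
    obtain ⟨⟨v', t'⟩, rfl⟩ := Ψ.surjective m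
    have hxm : ⟪x, Ψ (WithLp.toLp 2 (v', t'))⟫ = ⟪a, v'⟫ + h * t' := by
      rw [hΨ, inner_add_right, hxL, inner_smul_right, M.inner_base, mul_comm]
    rw [hJΨ, frameMap_apply, I.inner_map_map, WithLp.prod_inner_apply, hxm, Ψ.inner_map_map,
      WithLp.prod_inner_apply]
    simp only [ContinuousLinearMap.comp_apply, hPΨ]
    rw [hB'sym, inner_sub_right, inner_smul_right, inner_smul_right, real_inner_comm a v']
    simp
    field_simp
    ring
  have hJdet : |J.det| = |LinearMap.det B₀| * |h⁻¹| :=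
    abs_det_frame_comp I Ψ B₀ (h⁻¹ • a) h⁻¹ (J : Euc n →ₗ[ℝ] Euc n) hJΨ
  have hJ'J : |J'.det| * |J.det| = 1 := det_mul_det_of_inner hJJ'
  have hJ0 : J.det ≠ 0 := fun h0 => by rw [h0] at hJ'J; simp at hJ'J
  have hJ'0 : J'.det ≠ 0 := fun h0 => by rw [h0] at hJ'J; simp at hJ'J
  have hpt : J x = I (WithLp.toLp 2 (0, 1)) := by
    rw [frameMap_apply, hΦ, hPx, hmem.2.2]; simp
  have hpt' : J' ℓ = I (WithLp.toLp 2 (0, 1)) := by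
    rw [frameMap_apply, real_inner_comm, hmem.2.2]; simp [hPν]
  have hexp : ∀ ε > 0, ∃ r > 0, ∀ y ℓ' z m, (y, ℓ') ∈ contact S T → (z, m) ∈ contact S T →
      dist y x < r → dist ℓ' ℓ < r → dist z x < r → dist m ℓ < r →
      |1 - ⟪ℓ', z⟫ - 1 / 2 * ‖perp (I (WithLp.toLp 2 (0, 1))) (J (z - ⟪ℓ', z⟫ • y))‖ ^ 2|
        ≤ ε * ‖perp (I (WithLp.toLp 2 (0, 1))) (J (z - ⟪ℓ', z⟫ • y))‖ ^ 2 := by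
    intro ε hε
    obtain ⟨r, hr, H⟩ := M.eventually_left hP hBC hBA hε
    refine ⟨min r ρ, lt_min hr hρ, fun y ℓ' z m hy hz hyx _ hzx _ => ?_⟩
    obtain ⟨v, hv, rfl, rfl⟩ := hC y ℓ' hy (hyx.trans_le (min_le_right _ _))
    obtain ⟨w, hw, rfl, rfl⟩ := hC z m hz (hzx.trans_le (min_le_right _ _))
    have h1 := H v w (hv.trans_lt (hyx.trans_le (min_le_left _ _)))
      (hw.trans_lt (hzx.trans_le (min_le_left _ _)))
    rw [norm_perp_frameMap, hΦ]
    simpa only [graphGap, sub_sub_cancel] using h1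
  have hexp' : ∀ ε > 0, ∃ r > 0, ∀ y ℓ' z m, (y, ℓ') ∈ contact T S → (z, m) ∈ contact T S →
      dist y ℓ < r → dist ℓ' x < r → dist z ℓ < r → dist m x < r →
      |1 - ⟪ℓ', z⟫ - 1 / 2 * ‖perp (I (WithLp.toLp 2 (0, 1))) (J' (z - ⟪ℓ', z⟫ • y))‖ ^ 2|
        ≤ ε * ‖perp (I (WithLp.toLp 2 (0, 1))) (J' (z - ⟪ℓ', z⟫ • y))‖ ^ 2 := by
    intro ε hε
    obtain ⟨r, hr, H⟩ := M.eventually_right hP hBC hBA hB' hε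
    refine ⟨min r ρ, lt_min hr hρ, fun m y m' z hy hz _ hyx _ hzx => ?_⟩
    obtain ⟨v, hv, rfl, rfl⟩ := hC y m (contact_symm hy) (hyx.trans_le (min_le_right _ _))
    obtain ⟨w, hw, rfl, rfl⟩ := hC z m' (contact_symm hz) (hzx.trans_le (min_le_right _ _))
    have h1 := H v w (hv.trans_lt (hyx.trans_le (min_le_left _ _)))
      (hw.trans_lt (hzx.trans_le (min_le_left _ _)))
    rw [norm_perp_frameMap, real_inner_comm]
    simpa only [graphGap, sub_sub_cancel, ContinuousLinearMap.comp_apply] using h1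
  have huniq : ∀ z ∈ S, ⟪ℓ, z⟫ = 1 → z = x := fun z hz hz1 =>
    eq_of_expand hPP hmem hJ0 (inner_frameMap I Φ ℓ) hexp hz hz1
  have huniq' : ∀ m ∈ T, ⟪x, m⟫ = 1 → m = ℓ := fun m hm hm1 =>
    eq_of_expand hPP.symm (contact_symm hmem) hJ'0 (inner_frameMap I _ x) hexp' hm hm1
  refine ⟨J, J', ⟨hmem, hJ0, hpt, inner_frameMap I Φ ℓ, huniq, fun m hm h1 => huniq' m hm ?_, hexp⟩,
    ⟨contact_symm hmem, hJ'0, hpt', inner_frameMap I _ x, huniq', fun m hm h1 => huniq m hm ?_,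
      hexp'⟩, ?_, hJ'J⟩
  · rw [real_inner_comm]; exact h1
  · rw [real_inner_comm]; exact h1
  · rw [hJdet, mul_pow, sq_abs, sq_abs, hdB, ← hkn]
    field_simp
    ring
end

lemma mem_frontier_of_contact {n : ℕ} {S T : Set (Euc n)} (hPP : PolarPair S T) {y m : Euc n}
    (h : (y, m) ∈ contact S T) : y ∈ frontier S := by
  rw [hPP.compact_left.isClosed.frontier_eq]
  refine ⟨h.1, fun hint => ?_⟩
  have hcont : Tendsto (fun t : ℝ => (1 + t) • y) (𝓝[>] 0) (𝓝 y) := by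
    have : Continuous (fun t : ℝ => (1 + t) • y) := by fun_prop
    exact (this.tendsto' 0 y (by simp)).mono_left nhdsWithin_le_nhds
  obtain ⟨t, ht, ht0⟩ := ((hcont.eventually (mem_interior_iff_mem_nhds.1 hint)).and
    (self_mem_nhdsWithin (a := (0:ℝ)) (s := Ioi 0))).exists
  have h1 := (hPP.mem_left _).1 ht m h.2.1
  rw [inner_smul_right, h.2.2] at h1
  have : (0:ℝ) < t := ht0
  linarith

lemma isPositive_of_isLittleO {k : ℕ} {f : Euc k → ℝ} {A : Euc k →L[ℝ] Euc k}
    (hsymm : ∀ u w, ⟪A u, w⟫ = ⟪u, A w⟫) {r : ℝ} (hr : 0 < r) (hf : ∀ w, ‖w‖ < r → 0 ≤ f w)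
    (ho : (fun w => f w - 1 / 2 * ⟪A w, w⟫) =o[𝓝 0] (fun w => ‖w‖ ^ 2)) :
    (A : Euc k →ₗ[ℝ] Euc k).IsPositive := by
  rw [LinearMap.isPositive_iff]
  refine ⟨hsymm, fun u => ?_⟩
  change 0 ≤ ⟪A u, u⟫
  by_contra hneg
  push Not at hneg
  have hu : 0 < ‖u‖ := by
    rw [norm_pos_iff]; rintro rfl; simp at hneg
  set c := -⟪A u, u⟫ / (4 * ‖u‖ ^ 2) with hc
  have hc0 : 0 < c := by rw [hc]; apply div_pos <;> [linarith; positivity]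
  have hcont : Tendsto (fun t : ℝ => t • u) (𝓝[>] 0) (𝓝 0) := by
    have : Continuous (fun t : ℝ => t • u) := by fun_prop
    exact (this.tendsto' 0 0 (by simp)).mono_left nhdsWithin_le_nhds
  obtain ⟨t, ⟨h1, h2⟩, ht0⟩ := ((hcont.eventually ((Asymptotics.isLittleO_iff.1 ho hc0).and
    (ball_mem_nhds 0 hr))).and (self_mem_nhdsWithin (a := (0:ℝ)) (s := Ioi 0))).exists
  have ht : 0 < t := ht0
  have h3 := hf _ (mem_ball_zero_iff.1 h2)
  rw [map_smul, inner_smul_left, inner_smul_right, norm_smul, Real.norm_eq_abs,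
    Real.norm_eq_abs, abs_of_nonneg (by positivity : 0 ≤ (‖t‖ * ‖u‖) ^ 2), Real.norm_eq_abs,
    abs_of_pos ht] at h1
  have h4 := (le_abs_self _).trans h1
  simp only [conj_trivial] at h4
  have h5 : c * (t * ‖u‖) ^ 2 = -⟪A u, u⟫ / 4 * t ^ 2 := by rw [hc]; field_simp
  rw [h5] at h4
  nlinarith [mul_pos ht ht, mul_pos (mul_pos ht ht) (neg_pos.2 hneg)]

lemma exists_osc_of_curvature {n : ℕ} (hn : 2 ≤ n) {S T : Set (Euc n)} (hPP : PolarPair S T)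
    {x ν : Euc n} {κ : ℝ} (hx : x ∈ frontier S) (hν : IsOuterNormalAt S x ν)
    (hG : IsGaussCurvatureAt S x ν κ) (hκ : 0 < κ) (hpos : 0 < ⟪x, ν⟫)
    (I : WithLp 2 (Euc (n - 1) × ℝ) ≃ₗᵢ[ℝ] Euc n) :
    ∃ J J' : Euc n →L[ℝ] Euc n,
      Osc (I (WithLp.toLp 2 (0, 1))) S T x (⟪x, ν⟫⁻¹ • ν) J ∧
      Osc (I (WithLp.toLp 2 (0, 1))) T S (⟪x, ν⟫⁻¹ • ν) x J' ∧
      |J.det| ^ 2 = κ / ⟪x, ν⟫ ^ (n + 1) ∧ |J'.det| * |J.det| = 1 := by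
  obtain ⟨L, f, τ, ε, hτ, hε, hL, hf, hf0, hdf0, hfr, hk⟩ := hG
  obtain ⟨g, A, hA, hsymm, hdf, hg0, hgc, hgo, hfo⟩ := exists_second_order_expansion hτ hf
  have hkn : n - 1 + 1 = n := by omega
  have hSc := hPP.compact_left.isClosed
  set h := ⟪x, ν⟫ with hh
  let a : Euc (n - 1) := ContinuousLinearMap.adjoint L.toContinuousLinearMap x
  have ha : ∀ v, ⟪L v, x⟫ = ⟪v, a⟫ := fun v => by
    simp [a, ContinuousLinearMap.adjoint_inner_right]
  have hfc : Tendsto f (𝓝 0) (𝓝 0) := by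
    have := (hdf 0 (mem_ball_self hτ)).continuousAt.tendsto
    rwa [hf0] at this
  have hgc' : Tendsto g (𝓝 0) (𝓝 0) := by
    have := hgc.tendsto
    rwa [hg0 hdf0] at this
  have M : GraphModel L ν x a h f g A :=
    ⟨hpos, hν.1, hL, rfl, ha, hf0, hg0 hdf0, hfc, hgc', hgo, hfo⟩
  obtain ⟨r₀, hr₀, hgraph⟩ : ∃ r₀ > 0, ∀ w, ‖w‖ < r₀ → ‖w‖ < τ ∧ graphPt L ν x f w ∈ S := by
    have h1 : Tendsto (graphPt L ν x f) (𝓝 0) (𝓝 x) := by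
      have h2 : Tendsto (fun w => x + L w - f w • ν) (𝓝 0) (𝓝 (x + L 0 - (0:ℝ) • ν)) :=
        (tendsto_const_nhds.add (L.continuous.tendsto 0)).sub (hfc.smul_const ν)
      rw [map_zero, zero_smul, add_zero, sub_zero] at h2; exact h2
    have h3 := (h1.eventually (ball_mem_nhds x hε)).and (ball_mem_nhds 0 hτ)
    rw [Metric.eventually_nhds_iff_ball] at h3
    obtain ⟨r₀, hr₀, h3⟩ := h3
    refine ⟨r₀, hr₀, fun w hw => ?_⟩
    obtain ⟨h4, h5⟩ := h3 w (by simpa using hw)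
    have h6 : graphPt L ν x f w ∈ frontier S ∩ ball x ε := by
      rw [hfr]; exact ⟨⟨w, h5, rfl⟩, h4⟩
    exact ⟨mem_ball_zero_iff.1 h5, hSc.frontier_subset h6.1⟩
  have hxS : x ∈ S := hSc.frontier_subset hx
  have hmem : (x, h⁻¹ • ν) ∈ contact S T := by
    refine ⟨hxS, (hPP.mem_right _).2 fun z hz => ?_, ?_⟩
    · rw [inner_smul_right, inv_mul_le_iff₀ hpos, mul_one]; exact hν.2 z hz
    · rw [inner_smul_left, real_inner_comm, ← hh]; simp [hpos.ne']
  have hpositive : (A : Euc (n - 1) →ₗ[ℝ] Euc (n - 1)).IsPositive := by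
    refine isPositive_of_isLittleO (f := f) hsymm hr₀ (fun w hw => ?_) ?_
    · have h1 := (hPP.mem_right _).1 hmem.2.1 _ (hgraph w hw).2
      rw [real_inner_comm, M.normal_graphPt] at h1
      have : 0 ≤ f w / h := by linarith
      exact (div_nonneg_iff.1 this).elim (fun h => h.1) fun h => absurd h.2 (not_le.2 hpos)
    · have h1 : Tendsto (fun w : Euc (n - 1) => ((0 : Euc (n - 1)), w)) (𝓝 0) (𝓝 0) :=
        (Continuous.tendsto' (by fun_prop) _ _ rfl)
      refine (hfo.comp_tendsto h1).congr (fun w => ?_) (fun w => ?_)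
      · simp [hf0, hg0 hdf0]
      · simp
  have hdet : LinearMap.det (A : Euc (n - 1) →ₗ[ℝ] Euc (n - 1)) = κ := by
    rw [det_eq_det_inner, hk]
    congr 1
    ext i j
    exact hA _ _
  have hchart : ∀ y m, (y, m) ∈ contact S T → dist y x < min r₀ ε →
      ∃ v, ‖v‖ ≤ dist y x ∧ y = graphPt L ν x f v ∧ m = graphDual L ν a h f g v := by
    intro y m hy hyx
    have h1 : y ∈ frontier S ∩ ball x ε :=
      ⟨mem_frontier_of_contact hPP hy, hyx.trans_le (min_le_right _ _)⟩
    rw [hfr] at h1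
    obtain ⟨⟨v, hv, hyv⟩, -⟩ := h1
    change y = graphPt L ν x f v at hyv
    have hvn : ‖v‖ ≤ dist y x := by
      have h2 : ⟪L v, y - x⟫ = ‖v‖ * ‖v‖ := by
        rw [hyv, graphPt, add_sub_assoc, add_sub_cancel_left, inner_sub_right, L.inner_map_map,
          inner_smul_right, hL, real_inner_self_eq_norm_mul_norm]; ring
      have h3 := real_inner_le_norm (L v) (y - x)
      rw [h2, L.norm_map] at h3
      rw [dist_eq_norm]
      rcases (norm_nonneg v).eq_or_lt with h0 | h0
      · rw [← h0]; positivity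
      · exact le_of_mul_le_mul_left h3 h0
    refine ⟨v, hvn, hyv, ?_⟩
    have hvr : ‖v‖ < r₀ := hvn.trans_lt (hyx.trans_le (min_le_left _ _))
    have hder : HasFDerivAt (fun w => ⟪m, graphPt L ν x f w⟫)
        ((innerSL ℝ m).comp (L.toContinuousLinearMap - (innerSL ℝ (g v)).smulRight ν)) v := by
      refine (innerSL ℝ m).hasFDerivAt.comp v ?_
      exact (L.toContinuousLinearMap.hasFDerivAt.const_add x).sub ((hdf v hv).smul_const ν)
    have hmax : IsLocalMax (fun w => ⟪m, graphPt L ν x f w⟫) v := by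
      filter_upwards [isOpen_ball.mem_nhds (mem_ball_zero_iff.2 hvr)] with w hw
      rw [← hyv, hy.2.2]
      exact (hPP.mem_left _).1 (hgraph w (mem_ball_zero_iff.1 hw)).2 m hy.2.1
    have hzero := hmax.hasFDerivAt_eq_zero hder
    have hLw : ∀ w, ⟪m, L w⟫ = ⟪m, ν⟫ * ⟪g v, w⟫ := fun w => by
      have := congrArg (fun F => F w) hzero
      simp at this
      linarith
    have hm : m = ⟪m, ν⟫ • (ν + L (g v)) := by
      obtain ⟨Ψ, hΨ⟩ := exists_isometry_extension hkn L hν.1 hL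
      refine ext_inner_right ℝ fun z => ?_
      obtain ⟨⟨w, t⟩, rfl⟩ := Ψ.surjective z
      have h2 : ⟪ν, L w⟫ = 0 := by rw [real_inner_comm]; exact hL w
      have h3 : ⟪ν, ν⟫ = 1 := by rw [real_inner_self_eq_norm_sq, hν.1]; norm_num
      rw [hΨ, inner_smul_left, inner_add_right, inner_smul_right, hLw]
      simp only [inner_add_left, inner_add_right, inner_smul_right, h2, h3, hL, L.inner_map_map]
      simp
      ring
    have h4 := hy.2.2
    rw [hm, hyv, inner_smul_left, M.inner_graph] at h4
    have h5 : ⟪m, ν⟫ = (graphDen a h f g v)⁻¹ := by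
      refine eq_inv_of_mul_eq_one_left ?_
      rw [← h4, graphDen, real_inner_comm a]
      simp
      left; ring
    rw [graphDual, ← h5]; exact hm
  obtain ⟨J, J', h1, h2, h3, h4⟩ := M.exists_osc hkn I hPP hmem (lt_min hr₀ hε) hchart hpositive
    (by rw [hdet]; exact hκ)
  exact ⟨J, J', h1, h2, by rw [h3, hdet], h4⟩

/-- `F p h` is asymptotic to `b p * h ^ N`, locally uniformly in `p ∈ Γ`. -/
def LocallyAsymptotic {X : Type*} [PseudoMetricSpace X] (Γ : Set X) (F : X → ℝ → ℝ) (b : X → ℝ)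
    (N : ℝ) : Prop :=
  ∀ p ∈ Γ, ∀ η > 0, ∃ r > 0, ∀ q ∈ Γ, dist q p < r → ∀ h, 0 < h → h < r →
    |F q h - b p * h ^ N| ≤ η * h ^ N

lemma LocallyAsymptotic.abs_sub_le {X : Type*} [PseudoMetricSpace X] {Γ : Set X} {F : X → ℝ → ℝ}
    {b : X → ℝ} {N : ℝ} (H : LocallyAsymptotic Γ F b N) {p : X} (hp : p ∈ Γ) {η : ℝ} (hη : 0 < η) :
    ∃ r > 0, ∀ q ∈ Γ, dist q p < r → |b q - b p| ≤ η := by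
  obtain ⟨r, hr, h1⟩ := H p hp (η / 2) (by positivity)
  refine ⟨r, hr, fun q hq hqp => ?_⟩
  obtain ⟨r', hr', h2⟩ := H q hq (η / 2) (by positivity)
  have hm : 0 < min r r' := lt_min hr hr'
  have h3 := h1 q hq hqp (min r r' / 2) (by positivity)
    ((half_lt_self hm).trans_le (min_le_left _ _))
  have h4 := h2 q hq (by simpa using hr') (min r r' / 2) (by positivity)
    ((half_lt_self hm).trans_le (min_le_right _ _))
  have hpow : 0 < (min r r' / 2) ^ N := by positivity
  have h5 : |(b q - b p) * (min r r' / 2) ^ N| ≤ η * (min r r' / 2) ^ N := by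
    rw [abs_le] at *
    constructor <;> linarith
  rw [abs_mul, abs_of_pos hpow] at h5
  exact le_of_mul_le_mul_right h5 hpow

lemma LocallyAsymptotic.continuousOn {X : Type*} [PseudoMetricSpace X] {Γ : Set X}
    {F : X → ℝ → ℝ} {b : X → ℝ} {N : ℝ} (H : LocallyAsymptotic Γ F b N) : ContinuousOn b Γ := by
  rw [Metric.continuousOn_iff]
  intro p hp ε hε
  obtain ⟨r, hr, h⟩ := H.abs_sub_le hp (half_pos hε)
  exact ⟨r, hr, fun q hq hqp => (h q hq hqp).trans_lt (half_lt_self hε)⟩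

lemma LocallyAsymptotic.uniform {X : Type*} [PseudoMetricSpace X] {Γ : Set X}
    {F : X → ℝ → ℝ} {b : X → ℝ} {N : ℝ} (H : LocallyAsymptotic Γ F b N) (hΓ : IsCompact Γ) {η : ℝ}
    (hη : 0 < η) :
    ∃ r > 0, ∀ q ∈ Γ, ∀ h, 0 < h → h < r → |F q h - b q * h ^ N| ≤ η * h ^ N := by
  suffices h : ∃ r > 0, ∀ q ∈ Γ, q ∈ Γ → ∀ h, 0 < h → h < r →
      |F q h - b q * h ^ N| ≤ η * h ^ N by
    obtain ⟨r, hr, h⟩ := h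
    exact ⟨r, hr, fun q hq => h q hq hq⟩
  refine hΓ.induction_on (p := fun s => ∃ r > 0, ∀ q ∈ s, q ∈ Γ → ∀ h, 0 < h → h < r →
      |F q h - b q * h ^ N| ≤ η * h ^ N) ⟨1, one_pos, by simp⟩ ?_ ?_ ?_
  · rintro s t hst ⟨r, hr, h⟩
    exact ⟨r, hr, fun q hq => h q (hst hq)⟩
  · rintro s t ⟨r, hr, h⟩ ⟨r', hr', h'⟩
    refine ⟨min r r', lt_min hr hr', fun q hq hqΓ x hx hxr => ?_⟩
    rcases hq with hq | hq
    · exact h q hq hqΓ x hx (hxr.trans_le (min_le_left _ _))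
    · exact h' q hq hqΓ x hx (hxr.trans_le (min_le_right _ _))
  · intro p hp
    obtain ⟨r, hr, h1⟩ := H p hp (η / 2) (by positivity)
    obtain ⟨r', hr', h2⟩ := H.abs_sub_le hp (half_pos hη)
    refine ⟨ball p (min r r'), mem_nhdsWithin_of_mem_nhds (ball_mem_nhds p (lt_min hr hr')), r, hr,
      fun q hq hqΓ x hx hxr => ?_⟩
    have h3 := h1 q hqΓ (hq.trans_le (min_le_left _ _)) x hx hxr
    have h4 := h2 q hqΓ (hq.trans_le (min_le_right _ _))
    have hpow : 0 < x ^ N := by positivity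
    have h5 : |(b q - b p) * x ^ N| ≤ η / 2 * x ^ N := by
      rw [abs_mul, abs_of_pos hpow]; gcongr
    rw [abs_le] at *
    constructor <;> linarith

/-- A polar pair whose caps and illumination caps have volumes governed by the function `G` on the
contact pairs. -/
structure CapModel {n : ℕ} (S T : Set (Euc n)) (G : Euc n × Euc n → ℝ) (N V C : ℝ) : Prop where
  polar : PolarPair S T
  uniq_left : ∀ p ∈ contact S T, ∀ z ∈ S, ⟪p.2, z⟫ = 1 → z = p.1
  uniq_right : ∀ p ∈ contact S T, ∀ m ∈ T, ⟪m, p.1⟫ = 1 → m = p.2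
  cont : ContinuousOn G (contact S T)
  pos : ∀ p ∈ contact S T, 0 < G p
  cap : ∀ η > 0, ∃ r > 0, ∀ p ∈ contact S T, ∀ h, 0 < h → h < r →
    |volume.real (S ∩ {z | 1 - h ≤ ⟪p.2, z⟫}) - V * (h / G p) ^ N| ≤ η * h ^ N
  hat : ∀ η > 0, ∃ r > 0, ∀ p ∈ contact S T, ∀ h, 0 < h → h < r →
    |volume.real (convexHull ℝ (T ∪ {(1 + h) • p.2}) \ T) - C * (h * G p) ^ N| ≤ η * h ^ N

lemma isCompact_contact {n : ℕ} {S T : Set (Euc n)} (h : PolarPair S T) :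
    IsCompact (contact S T) := by
  have h1 : contact S T = S ×ˢ T ∩ {p | ⟪p.2, p.1⟫ = 1} := by
    ext p; simp [contact, and_assoc]
  rw [h1]
  exact (h.compact_left.prod h.compact_right).inter_right
    (isClosed_eq (by fun_prop) continuous_const)

lemma capModel_of_osc {n : ℕ} (hn : 1 ≤ n) {e : Euc n} (he : ‖e‖ = 1) {S T : Set (Euc n)}
    (hPP : PolarPair S T) {G : Euc n × Euc n → ℝ} {V : ℝ} (hV : 0 < V)
    (hG : ∀ p ∈ contact S T, 0 < G p)
    (H : ∀ p ∈ contact S T, ∃ J J' : Euc n →L[ℝ] Euc n, Osc e S T p.1 p.2 J ∧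
      Osc e T S p.2 p.1 J' ∧ |J'.det| * |J.det| = 1 ∧
      |J.det| * V = volume.real (paraCap e 1 1) * G p ^ (((n:ℝ) + 1) / 2)) :
    CapModel S T G (((n:ℝ) + 1) / 2) V
      (volume.real (paraHat e 1 1) * volume.real (paraCap e 1 1) / V) := by
  set N := ((n:ℝ) + 1) / 2 with hN
  have hN0 : 0 < N := by positivity
  have hc1 := volume_paraCap_pos he
  have hc2 := volume_paraHat_pos he
  set c₁ := volume.real (paraCap e 1 1)
  set c₂ := volume.real (paraHat e 1 1)
  have hcap : LocallyAsymptotic (contact S T)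
      (fun p h => volume.real (S ∩ {z | 1 - h ≤ ⟪p.2, z⟫})) (fun p => V / G p ^ N) N := by
    intro p hp η hη
    obtain ⟨J, J', hJ, hJ', hdet, hGp⟩ := H p hp
    have hJ0 : 0 < |J.det| := abs_pos.2 hJ.det_ne
    have hGN : 0 < G p ^ N := Real.rpow_pos_of_pos (hG p hp) _
    obtain ⟨r, hr, h1⟩ := hJ.cap_volume hn he hPP (show 0 < |J.det| * η by positivity)
    refine ⟨r, hr, fun q hq hqp h hh hhr => ?_⟩
    have h2 := h1 q.1 q.2 hq ((le_max_left _ _).trans_lt hqp) ((le_max_right _ _).trans_lt hqp)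
      h hh hhr
    have h3 : c₁ = |J.det| * (V / G p ^ N) := by
      rw [mul_div_assoc', hGp]; field_simp
    change |_ - c₁ * _| ≤ _ at h2
    rw [h3, mul_assoc, mul_assoc, ← mul_sub, abs_mul, abs_abs] at h2
    exact le_of_mul_le_mul_left h2 hJ0
  have hhat : LocallyAsymptotic (contact S T)
      (fun p h => volume.real (convexHull ℝ (T ∪ {(1 + h) • p.2}) \ T))
      (fun p => c₂ * c₁ / V * G p ^ N) N := by
    intro p hp η hη
    obtain ⟨J, J', hJ, hJ', hdet, hGp⟩ := H p hp
    have hJ0 : 0 < |J'.det| := abs_pos.2 hJ'.det_ne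
    obtain ⟨r, hr, h1⟩ := hJ'.hat_volume hn he hPP.symm (show 0 < |J'.det| * η by positivity)
    refine ⟨r, hr, fun q hq hqp h hh hhr => ?_⟩
    have h2 := h1 q.2 q.1 (contact_symm hq) ((le_max_right _ _).trans_lt hqp)
      ((le_max_left _ _).trans_lt hqp) h hh hhr
    have h3 : c₂ = |J'.det| * (c₂ * c₁ / V * G p ^ N) := by
      have : c₂ * c₁ / V * G p ^ N = c₂ * |J.det| := by
        rw [mul_div_assoc, mul_assoc, div_mul_eq_mul_div, ← hGp]; field_simp
      rw [this, mul_left_comm, hdet, mul_one]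
    change |_ - c₂ * _| ≤ _ at h2
    rw [h3, mul_assoc _ (c₂ * c₁ / V * G p ^ N), mul_assoc _ η, ← mul_sub, abs_mul, abs_abs] at h2
    exact le_of_mul_le_mul_left h2 hJ0
  refine ⟨hPP, fun p hp => ?_, fun p hp => ?_, ?_, hG, fun η hη => ?_, fun η hη => ?_⟩
  · obtain ⟨J, J', hJ, -⟩ := H p hp
    exact hJ.uniq_left
  · obtain ⟨J, J', hJ, -⟩ := H p hp
    exact hJ.uniq_right
  · have h1 : ContinuousOn (fun p => (V / (V / G p ^ N)) ^ N⁻¹) (contact S T) := by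
      refine ContinuousOn.rpow_const (continuousOn_const.div hcap.continuousOn fun p hp => ?_)
        fun p hp => Or.inr (by positivity)
      have hGN : 0 < G p ^ N := Real.rpow_pos_of_pos (hG p hp) _
      positivity
    refine h1.congr fun p hp => ?_
    change G p = (V / (V / G p ^ N)) ^ N⁻¹
    rw [div_div_cancel₀ hV.ne', Real.rpow_rpow_inv (hG p hp).le hN0.ne']
  · obtain ⟨r, hr, h⟩ := hcap.uniform (isCompact_contact hPP) hη
    refine ⟨r, hr, fun p hp x hx hxr => ?_⟩
    have := h p hp x hx hxr
    rwa [div_mul_eq_mul_div, mul_div_assoc, ← Real.div_rpow hx.le (hG p hp).le] at this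
  · obtain ⟨r, hr, h⟩ := hhat.uniform (isCompact_contact hPP) hη
    refine ⟨r, hr, fun p hp x hx hxr => ?_⟩
    have := h p hp x hx hxr
    rwa [mul_assoc, mul_comm (G p ^ N), ← Real.mul_rpow hx.le (hG p hp).le] at this

lemma PolarPair.exists_ball {n : ℕ} {S T : Set (Euc n)} (hP : PolarPair S T) :
    ∃ r > 0, closedBall 0 r ⊆ S := by
  obtain ⟨M, hM, hb⟩ := exists_norm_bound hP.compact_right
  refine ⟨1 / M, by positivity, fun z hz => (hP.mem_left z).2 fun m hm => ?_⟩
  have h1 := real_inner_le_norm m z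
  rw [mem_closedBall_zero_iff] at hz
  have h2 : ‖m‖ * ‖z‖ ≤ M * (1 / M) := by gcongr; exact hb m hm
  rw [mul_one_div_cancel hM.ne'] at h2
  linarith

lemma PolarPair.exists_contact {n : ℕ} {S T : Set (Euc n)} (hP : PolarPair S T) {v : Euc n}
    (hv : v ≠ 0) : ∃ c : ℝ, 0 < c ∧ ∃ y, (y, c⁻¹ • v) ∈ contact S T := by
  obtain ⟨r, hr, hball⟩ := hP.exists_ball
  have hv0 : 0 < ‖v‖ := norm_pos_iff.2 hv
  have hw : (r / ‖v‖) • v ∈ S := hball (by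
    rw [mem_closedBall_zero_iff, norm_smul, Real.norm_eq_abs, abs_of_pos (by positivity)]
    field_simp; rfl)
  obtain ⟨y, hy, hmax⟩ := hP.compact_left.exists_isMaxOn ⟨_, hw⟩
    (f := fun z : Euc n => ⟪v, z⟫) (by fun_prop)
  have hpos : 0 < ⟪v, y⟫ := by
    have h1 : ⟪v, (r / ‖v‖) • v⟫ ≤ ⟪v, y⟫ := hmax hw
    rw [inner_smul_right, real_inner_self_eq_norm_sq] at h1
    exact lt_of_lt_of_le (by positivity) h1
  refine ⟨⟪v, y⟫, hpos, y, hy, (hP.mem_right _).2 fun z hz => ?_, ?_⟩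
  · have h1 : ⟪v, z⟫ ≤ ⟪v, y⟫ := hmax hz
    rw [inner_smul_right, real_inner_comm v z, inv_mul_le_iff₀ hpos, mul_one]
    exact h1
  · rw [inner_smul_left]
    simp [hpos.ne']

lemma PolarPair.mem_of_contact {n : ℕ} {S T : Set (Euc n)} (hP : PolarPair S T) {z : Euc n}
    (h : ∀ p ∈ contact S T, ⟪p.2, z⟫ ≤ 1) : z ∈ S := by
  refine (hP.mem_left z).2 fun m hm => ?_
  rcases eq_or_ne m 0 with rfl | hm0
  · simp
  obtain ⟨c, hc, y, hy⟩ := hP.exists_contact hm0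
  have h1 : c ≤ 1 := by
    have h2 := hy.2.2
    change ⟪c⁻¹ • m, y⟫ = 1 at h2
    rw [inner_smul_left] at h2
    simp only [map_inv₀, conj_trivial] at h2
    rw [inv_mul_eq_one₀ hc.ne'] at h2
    rw [h2, real_inner_comm]
    exact (hP.mem_right m).1 hm y hy.1
  have h3 := h _ hy
  change ⟪c⁻¹ • m, z⟫ ≤ 1 at h3
  rw [inner_smul_left] at h3
  simp only [map_inv₀, conj_trivial] at h3
  rw [inv_mul_le_iff₀ hc] at h3
  linarith

lemma PolarPair.exists_bound {n : ℕ} {S T : Set (Euc n)} (hP : PolarPair S T) :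
    ∃ M > 0, ∀ p ∈ contact S T, ∀ z, ⟪p.2, z⟫ ≤ M * ‖z‖ := by
  obtain ⟨M, hM, hb⟩ := exists_norm_bound hP.compact_right
  exact ⟨M, hM, fun p hp z => (real_inner_le_norm _ _).trans (by gcongr; exact hb _ hp.2.1)⟩

lemma mem_floatingBody {n : ℕ} {K : Set (Euc n)} (hK : IsCompact K) {δ : ℝ} (hδ : 0 ≤ δ)
    {z : Euc n} :
    z ∈ floatingBody K δ ↔ ∀ v ≠ 0, ∀ c,
      volume.real (K ∩ {y | c ≤ ⟪v, y⟫}) ≤ δ * volume.real K → ⟪v, z⟫ ≤ c := by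
  have h : ∀ v c, volume (K ∩ {y | c ≤ ⟪v, y⟫}) ≤ ENNReal.ofReal δ * volume K ↔
      volume.real (K ∩ {y | c ≤ ⟪v, y⟫}) ≤ δ * volume.real K := fun v c => by
    have h1 : volume (K ∩ {y | c ≤ ⟪v, y⟫}) ≠ ⊤ :=
      ((measure_mono inter_subset_left).trans_lt hK.measure_lt_top).ne
    rw [← ENNReal.toReal_le_toReal h1
      (ENNReal.mul_ne_top ENNReal.ofReal_ne_top hK.measure_lt_top.ne), ENNReal.toReal_mul,
      ENNReal.toReal_ofReal hδ]
    rfl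
  simp only [floatingBody, mem_iInter, mem_ofPred_eq, h]

lemma mem_illuminationBody {n : ℕ} {K : Set (Euc n)} (hK : IsCompact K) {δ : ℝ}
    (hδ : 0 ≤ δ) {x : Euc n} :
    x ∈ illuminationBody K δ ↔ volume.real (convexHull ℝ (K ∪ {x}) \ K) ≤ δ * volume.real K := by
  have hb : volume (convexHull ℝ (K ∪ {x})) ≠ ⊤ :=
    ((isBounded_convexHull.2 (hK.isBounded.union Bornology.isBounded_singleton)).measure_lt_top).ne
  have h1 : x ∈ illuminationBody K δ ↔
      volume.real (convexHull ℝ (K ∪ {x})) ≤ (1 + δ) * volume.real K := by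
    rw [illuminationBody, mem_ofPred_eq, ← ENNReal.toReal_le_toReal hb
      (ENNReal.mul_ne_top ENNReal.ofReal_ne_top hK.measure_lt_top.ne), ENNReal.toReal_mul,
      ENNReal.toReal_ofReal (by positivity)]
    rfl
  rw [h1, measureReal_sdiff (subset_union_left.trans (subset_convexHull ℝ _)) hK.measurableSet
    hb, add_mul, one_mul]
  constructor <;> intro h <;> linarith

lemma illuminationBody_mono {n : ℕ} (K : Set (Euc n)) {δ δ' : ℝ} (h : δ ≤ δ') :
    illuminationBody K δ ⊆ illuminationBody K δ' := fun x hx =>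
  le_trans (α := ENNReal) hx (by gcongr)

lemma subset_illuminationBody {n : ℕ} {K : Set (Euc n)} (hK : IsCompact K) (hc : Convex ℝ K)
    {δ : ℝ} (hδ : 0 ≤ δ) : K ⊆ illuminationBody K δ := fun x hx => by
  rw [mem_illuminationBody hK hδ, union_eq_self_of_subset_right (singleton_subset_iff.2 hx),
    hc.convexHull_eq, sdiff_self]
  simp only [measureReal_empty]
  positivity

lemma polarBody_anti {n : ℕ} {K L : Set (Euc n)} (h : K ⊆ L) : polarBody L ⊆ polarBody K :=
  fun _ hy x hx => hy x (h hx)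

lemma isBounded_illuminationBody {n : ℕ} (hn : 1 ≤ n) {K : Set (Euc n)} (hK : IsCompact K) {r : ℝ}
    (hr : 0 < r) (hball : closedBall 0 r ⊆ K) {δ : ℝ} (hδ : 0 ≤ δ) :
    ∃ R > 0, ∀ x ∈ illuminationBody K δ, ‖x‖ ≤ R := by
  set β := volume.real (ball (0 : Euc n) (r / 2)) with hβ
  have hβ0 : 0 < β := by
    rw [hβ]
    exact ENNReal.toReal_pos (measure_ball_pos _ _ (by positivity)).ne' measure_ball_lt_top.ne
  refine ⟨2 * r * ((1 + δ) * volume.real K) / β + 1, by positivity, fun x hx => ?_⟩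
  rcases eq_or_ne x 0 with rfl | hx0
  · rw [norm_zero]; positivity
  have hx1 : 0 < ‖x‖ := norm_pos_iff.2 hx0
  set e := ‖x‖⁻¹ • x with he
  have he1 : ‖e‖ = 1 := by rw [he, norm_smul, norm_inv, norm_norm, inv_mul_cancel₀ hx1.ne']
  have hxe : x = ‖x‖ • e := by rw [he, smul_smul, mul_inv_cancel₀ hx1.ne', one_smul]
  set b := 1 + ‖x‖ / (2 * r) with hb
  have hb0 : 0 < b := by positivity
  have hsub : (fun w => aniso e 1 b w + (1 / 4 : ℝ) • x) '' ball 0 (r / 2)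
      ⊆ convexHull ℝ (K ∪ {x}) := by
    rintro _ ⟨w, hw, rfl⟩
    rw [mem_ball_zero_iff] at hw
    have h1 : |⟪e, w⟫| ≤ r / 2 := by
      have := abs_real_inner_le_norm e w
      rw [he1, one_mul] at this; linarith
    rw [abs_le] at h1
    set t := 1 / 4 + ⟪e, w⟫ / (2 * r) with ht
    have ht0 : 0 ≤ t := by
      have : -(1/4) ≤ ⟪e, w⟫ / (2 * r) := by rw [le_div_iff₀ (by positivity)]; linarith
      linarith
    have ht1 : t ≤ 1 / 2 := by
      have : ⟪e, w⟫ / (2 * r) ≤ 1 / 4 := by rw [div_le_iff₀ (by positivity)]; linarith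
      linarith
    have h2 : aniso e 1 b w + (1 / 4 : ℝ) • x = (1 - t) • ((1 - t)⁻¹ • w) + t • x := by
      have h3 : (1 : ℝ) - t ≠ 0 := by linarith
      rw [smul_smul, mul_inv_cancel₀ h3, one_smul, aniso_apply, perp_apply]
      have h4 : t • x = (1 / 4 : ℝ) • x + (⟪e, w⟫ / (2 * r) * ‖x‖) • e := by
        conv_rhs => rw [mul_smul, ← hxe, ← add_smul]
      rw [h4, hb]
      module
    change aniso e 1 b w + (1 / 4 : ℝ) • x ∈ _
    rw [h2]
    refine convex_convexHull ℝ (K ∪ {x}) (subset_convexHull ℝ _ (Or.inl (hball ?_)))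
      (subset_convexHull ℝ _ (Or.inr rfl)) (by linarith) ht0 (by ring)
    rw [mem_closedBall_zero_iff, norm_smul, norm_inv, Real.norm_eq_abs,
      abs_of_pos (by linarith), inv_mul_le_iff₀ (by linarith)]
    nlinarith
  have hfin : volume (convexHull ℝ (K ∪ {x})) ≠ ⊤ :=
    ((isBounded_convexHull.2 (hK.isBounded.union Bornology.isBounded_singleton)).measure_lt_top).ne
  have h1 : b * β ≤ volume.real (convexHull ℝ (K ∪ {x})) := by
    refine le_trans (le_of_eq ?_) (measureReal_mono hsub hfin)
    have h2 : (fun w => aniso e 1 b w + (1 / 4 : ℝ) • x) '' ball 0 (r / 2)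
        = (fun z => z + (1 / 4 : ℝ) • x) '' (aniso e 1 b '' ball 0 (r / 2)) := by
      rw [image_image]
    rw [h2, Measure.real, image_add_right, measure_preimage_add_right]
    change _ = volume.real _
    rw [volume_image_real, det_aniso hn he1 one_ne_zero]
    simp [abs_of_pos hb0, hβ]
  have h2 : volume.real (convexHull ℝ (K ∪ {x})) ≤ (1 + δ) * volume.real K := by
    have := ENNReal.toReal_mono
      (ENNReal.mul_ne_top ENNReal.ofReal_ne_top hK.measure_lt_top.ne) hx
    rwa [ENNReal.toReal_mul, ENNReal.toReal_ofReal (by positivity)] at this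
  have h3 : ‖x‖ / (2 * r) * β ≤ (1 + δ) * volume.real K := by
    refine le_trans ?_ (h1.trans h2)
    rw [hb]; nlinarith
  have h4 : ‖x‖ ≤ 2 * r * ((1 + δ) * volume.real K) / β := by
    rw [le_div_iff₀ hβ0]
    rw [div_mul_eq_mul_div, div_le_iff₀ (by positivity)] at h3
    linarith
  linarith

lemma exists_tolerance {A B N k : ℝ} (hA : 0 < A) (hB : 0 < B) (hN : 0 < N) (hk : 0 < k)
    (hk1 : k ≠ 1) :
    ∃ η > 0, ∀ s > 0, ∀ h, 0 ≤ h → h ≤ k * B * s → ∀ X, |X - A * (k * s) ^ N| ≤ η * h ^ N →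
      (k < 1 → X < A * s ^ N) ∧ (1 < k → A * s ^ N < X) := by
  have hkN : k ^ N ≠ 1 := fun h => hk1 (by
    have := Real.rpow_rpow_inv hk.le hN.ne'
    rw [h, Real.one_rpow] at this; exact this.symm)
  have hd : 0 < |1 - k ^ N| := abs_pos.2 (sub_ne_zero.2 hkN.symm)
  refine ⟨|1 - k ^ N| * A / (2 * (k * B) ^ N), by positivity, fun s hs h hh hhs X hX => ?_⟩
  have h1 : h ^ N ≤ (k * B) ^ N * s ^ N := by
    rw [← Real.mul_rpow (by positivity) hs.le]
    exact Real.rpow_le_rpow hh hhs hN.le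
  have hkB : 0 < (k * B) ^ N := by positivity
  have h2 : |1 - k ^ N| * A / (2 * (k * B) ^ N) * h ^ N ≤ |1 - k ^ N| * A / 2 * s ^ N := by
    calc _ ≤ |1 - k ^ N| * A / (2 * (k * B) ^ N) * ((k * B) ^ N * s ^ N) := by gcongr
      _ = _ := by field_simp
  have h3 := abs_le.1 (hX.trans h2)
  rw [Real.mul_rpow hk.le hs.le] at h3
  have hAs : 0 < A * s ^ N := by positivity
  constructor <;> intro hk2
  · have h4 : k ^ N < 1 := Real.rpow_lt_one hk.le hk2 hN
    rw [abs_of_pos (by linarith)] at h3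
    nlinarith
  · have h4 : 1 < k ^ N := Real.one_lt_rpow hk2 hN
    rw [abs_of_neg (by linarith)] at h3
    nlinarith

namespace CapModel

variable {n : ℕ} {S T : Set (Euc n)} {G : Euc n × Euc n → ℝ} {N V C : ℝ}

lemma cap_compare (M : CapModel S T G N V C) (hN : 0 < N) (hV : 0 < V) {g₁ : ℝ} (hg₁ : 0 < g₁)
    (hi : ∀ p ∈ contact S T, G p ≤ g₁) {k : ℝ} (hk : 0 < k) (hk1 : k ≠ 1) :
    ∃ s₀ > 0, ∀ s, 0 < s → s < s₀ → ∀ p ∈ contact S T,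
      (k < 1 → volume.real (S ∩ {z | 1 - k * s * G p ≤ ⟪p.2, z⟫}) < s ^ N * V) ∧
      (1 < k → s ^ N * V < volume.real (S ∩ {z | 1 - k * s * G p ≤ ⟪p.2, z⟫})) := by
  obtain ⟨η, hη, htol⟩ := exists_tolerance hV hg₁ hN hk hk1
  obtain ⟨r, hr, hcap⟩ := M.cap η hη
  refine ⟨r / (k * g₁), by positivity, fun s hs hsr p hp => ?_⟩
  have hG := M.pos p hp
  have h1 : k * s * G p ≤ k * g₁ * s := by nlinarith [hi p hp, mul_pos hk hs]
  have h2 : k * g₁ * s < r := by rw [lt_div_iff₀ (by positivity)] at hsr; linarith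
  have h3 := hcap p hp (k * s * G p) (by positivity) (h1.trans_lt h2)
  rw [mul_div_cancel_right₀ _ hG.ne'] at h3
  rw [mul_comm (s ^ N)]
  exact htol s hs _ (by positivity) h1 _ h3

lemma hat_compare (M : CapModel S T G N V C) (hN : 0 < N) (hC : 0 < C) {g₀ τ : ℝ} (hg₀ : 0 < g₀)
    (lo : ∀ p ∈ contact S T, g₀ ≤ G p) (hτ : 0 < τ) {k : ℝ} (hk : 0 < k) (hk1 : k ≠ 1) :
    ∃ s₀ > 0, ∀ s, 0 < s → s < s₀ → ∀ p ∈ contact S T,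
      (k < 1 → volume.real (convexHull ℝ (T ∪ {(1 + k * s * (τ / G p)) • p.2}) \ T)
        < C * (s * τ) ^ N) ∧
      (1 < k → C * (s * τ) ^ N
        < volume.real (convexHull ℝ (T ∪ {(1 + k * s * (τ / G p)) • p.2}) \ T)) := by
  obtain ⟨η, hη, htol⟩ := exists_tolerance (A := C * τ ^ N) (B := τ / g₀) (by positivity)
    (by positivity) hN hk hk1
  obtain ⟨r, hr, hhat⟩ := M.hat η hη
  refine ⟨r / (k * (τ / g₀)), by positivity, fun s hs hsr p hp => ?_⟩
  have hG := M.pos p hp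
  have h1 : k * s * (τ / G p) ≤ k * (τ / g₀) * s := by
    rw [mul_right_comm]; gcongr; exact lo p hp
  have h2 : k * (τ / g₀) * s < r := by rw [lt_div_iff₀ (by positivity)] at hsr; linarith
  have h3 := hhat p hp (k * s * (τ / G p)) (by positivity) (h1.trans_lt h2)
  have h4 : k * s * (τ / G p) * G p = τ * (k * s) := by field_simp
  rw [h4, Real.mul_rpow hτ.le (by positivity), ← mul_assoc] at h3
  rw [mul_comm s, Real.mul_rpow hτ.le hs.le, ← mul_assoc]
  exact htol s hs _ (by positivity) h1 _ h3

lemma le_of_mem_floatingBody (M : CapModel S T G N V C) (hN : 0 < N) (hV : 0 < V)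
    (hVS : V = volume.real S) {g₁ : ℝ} (hg₁ : 0 < g₁)
    (hi : ∀ p ∈ contact S T, G p ≤ g₁) {η : ℝ} (hη : 0 < η) (hη1 : η < 1) :
    ∃ s₀ > 0, ∀ s, 0 < s → s < s₀ → ∀ z ∈ floatingBody S (s ^ N), ∀ p ∈ contact S T,
      ⟪p.2, z⟫ ≤ 1 - (1 - η) * s * G p := by
  obtain ⟨s₀, hs₀, h⟩ := M.cap_compare hN hV hg₁ hi (k := 1 - η) (by linarith) (by linarith)
  refine ⟨s₀, hs₀, fun s hs hs1 z hz p hp => ?_⟩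
  rw [mem_floatingBody M.polar.compact_left (by positivity)] at hz
  refine hz p.2 (fun h0 => ?_) _ ?_
  · have := hp.2.2
    rw [h0, inner_zero_left] at this
    exact zero_ne_one this
  · rw [← hVS]
    exact ((h s hs hs1 p hp).1 (by linarith)).le

lemma mem_floatingBody_of_le (M : CapModel S T G N V C) (hN : 0 < N) (hV : 0 < V)
    (hVS : V = volume.real S) {g₁ : ℝ} (hg₁ : 0 < g₁)
    (hi : ∀ p ∈ contact S T, G p ≤ g₁) {η : ℝ} (hη : 0 < η) :
    ∃ s₀ > 0, ∀ s, 0 < s → s < s₀ → ∀ z,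
      (∀ p ∈ contact S T, ⟪p.2, z⟫ ≤ 1 - (1 + η) * s * G p) → z ∈ floatingBody S (s ^ N) := by
  obtain ⟨s₀, hs₀, h⟩ := M.cap_compare hN hV hg₁ hi (k := 1 + η) (by linarith) (by linarith)
  refine ⟨s₀, hs₀, fun s hs hs1 z hz => ?_⟩
  rw [mem_floatingBody M.polar.compact_left (by positivity), ← hVS]
  intro v hv c hc
  by_contra! hcon
  obtain ⟨a, ha, y, hy⟩ := M.polar.exists_contact hv
  have h1 := (h s hs hs1 _ hy).2 (by linarith)
  have h2 := hz _ hy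
  refine absurd (h1.trans_le (le_trans (measureReal_mono ?_ ?_) hc)) (lt_irrefl _)
  · refine inter_subset_inter_right _ fun w hw => ?_
    have h3 := h2.trans hw
    change ⟪a⁻¹ • v, z⟫ ≤ ⟪a⁻¹ • v, w⟫ at h3
    rw [real_inner_smul_left, real_inner_smul_left] at h3
    exact hcon.le.trans (le_of_mul_le_mul_left h3 (inv_pos.2 ha))
  · exact ((measure_mono inter_subset_left).trans_lt M.polar.compact_left.measure_lt_top).ne

lemma le_of_mem_polarBody (M : CapModel S T G N V C) (hN : 0 < N) (hC : 0 < C)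
    (hT : 0 < volume.real T) {g₀ τ : ℝ} (hg₀ : 0 < g₀)
    (lo : ∀ p ∈ contact S T, g₀ ≤ G p) (hτ : 0 < τ) {η : ℝ} (hη : 0 < η) (hη1 : η < 1) :
    ∃ s₀ > 0, ∀ s, 0 < s → s < s₀ →
      ∀ z ∈ polarBody (illuminationBody T (C * (s * τ) ^ N / volume.real T)),
      ∀ p ∈ contact S T, (1 + (1 - η) * s * (τ / G p)) * ⟪p.2, z⟫ ≤ 1 := by
  obtain ⟨s₀, hs₀, h⟩ := M.hat_compare hN hC hg₀ lo hτ (k := 1 - η) (by linarith) (by linarith)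
  refine ⟨s₀, hs₀, fun s hs hs1 z hz p hp => ?_⟩
  rw [← real_inner_smul_left]
  refine hz _ ?_
  rw [mem_illuminationBody M.polar.compact_right (by positivity), div_mul_cancel₀ _ hT.ne']
  exact ((h s hs hs1 p hp).1 (by linarith)).le

lemma mem_polarBody_of_le (M : CapModel S T G N V C) (hN : 0 < N) (hC : 0 < C)
    (hT : 0 < volume.real T) {g₀ τ : ℝ} (hg₀ : 0 < g₀)
    (lo : ∀ p ∈ contact S T, g₀ ≤ G p) (hτ : 0 < τ) {η : ℝ} (hη : 0 < η) :
    ∃ s₀ > 0, ∀ s, 0 < s → s < s₀ → ∀ z,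
      (∀ p ∈ contact S T, (1 + (1 + η) * s * (τ / G p)) * ⟪p.2, z⟫ ≤ 1) →
      z ∈ polarBody (illuminationBody T (C * (s * τ) ^ N / volume.real T)) := by
  obtain ⟨s₀, hs₀, h⟩ := M.hat_compare hN hC hg₀ lo hτ (k := 1 + η) (by linarith) (by linarith)
  refine ⟨s₀, hs₀, fun s hs hs1 z hz x hx => ?_⟩
  rcases eq_or_ne x 0 with rfl | hx0
  · simp
  rw [mem_illuminationBody M.polar.compact_right (by positivity), div_mul_cancel₀ _ hT.ne'] at hx
  obtain ⟨a, ha, y, hy⟩ := M.polar.exists_contact hx0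
  set ℓ := a⁻¹ • x with hℓ
  have hxℓ : x = a • ℓ := by rw [hℓ, smul_smul, mul_inv_cancel₀ ha.ne', one_smul]
  have h1 := (h s hs hs1 _ hy).2 (by linarith)
  have hG := M.pos _ hy
  have h2 := hz _ hy
  set b := 1 + (1 + η) * s * (τ / G (y, ℓ)) with hb
  have hb1 : 1 < b := by
    have : 0 < (1 + η) * s * (τ / G (y, ℓ)) := by positivity
    linarith
  have hab : a ≤ b := by
    by_contra! hcon
    refine absurd (h1.trans_le (le_trans (measureReal_mono ?_ ?_) hx)) (lt_irrefl _)
    · refine sdiff_subset_sdiff_left (convexHull_min (union_subset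
        (subset_union_left.trans (subset_convexHull ℝ _)) (singleton_subset_iff.2 ?_))
        (convex_convexHull ℝ _))
      have h3 : b • ℓ = ((a - b) / (a - 1)) • ℓ + ((b - 1) / (a - 1)) • x := by
        rw [hxℓ, smul_smul _ a, ← add_smul]
        congr 1
        have : a - 1 ≠ 0 := by linarith
        field_simp; ring
      change b • ℓ ∈ _
      rw [h3]
      refine convex_convexHull ℝ (T ∪ {x}) (subset_convexHull ℝ _ (Or.inl hy.2.1))
        (subset_convexHull ℝ _ (Or.inr rfl)) (div_nonneg (by linarith) (by linarith))
        (div_nonneg (by linarith) (by linarith)) ?_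
      have : a - 1 ≠ 0 := by linarith
      field_simp; ring
    · exact ((measure_mono sdiff_subset).trans_lt (isBounded_convexHull.2
        (M.polar.compact_right.isBounded.union Bornology.isBounded_singleton)).measure_lt_top).ne
  rw [hxℓ, real_inner_smul_left]
  change b * ⟪ℓ, z⟫ ≤ 1 at h2
  rcases le_total 0 ⟪ℓ, z⟫ with h4 | h4
  · nlinarith
  · nlinarith

lemma radial_le (M : CapModel S T G N V C) {g : Euc n × Euc n → ℝ}
    (hg : ContinuousOn g (contact S T)) (hg0 : ∀ p ∈ contact S T, 0 ≤ g p)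
    {p₀ : Euc n × Euc n} (hp₀ : p₀ ∈ contact S T) {η : ℝ} (hη : 0 < η) :
    ∃ s₀ > 0, ∀ s, 0 < s → s < s₀ → 0 ≤ 1 - s * (g p₀ + η) ∧ ∀ p ∈ contact S T,
      ⟪p.2, (1 - s * (g p₀ + η)) • p₀.1⟫ ≤ 1 - s * g p := by
  have hP := M.polar
  obtain ⟨r, hr, hgr⟩ := Metric.continuousOn_iff.1 hg p₀ hp₀ η hη
  have hcomp : IsCompact (contact S T ∩ {p | r ≤ dist p p₀}) :=
    (isCompact_contact hP).inter_right (isClosed_le (by fun_prop) (by fun_prop))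
  obtain ⟨c, hc, hc1, hgap⟩ : ∃ c > 0, c ≤ 1 ∧ ∀ p ∈ contact S T, r ≤ dist p p₀ →
      ⟪p.2, p₀.1⟫ ≤ 1 - c := by
    rcases (contact S T ∩ {p | r ≤ dist p p₀}).eq_empty_or_nonempty with h | h
    · refine ⟨1, one_pos, le_rfl, fun p hp hpr => ?_⟩
      have : p ∈ contact S T ∩ {p | r ≤ dist p p₀} := ⟨hp, hpr⟩
      simp [h] at this
    · obtain ⟨q, hq, hmax⟩ := hcomp.exists_isMaxOn h
        (f := fun p : Euc n × Euc n => ⟪p.2, p₀.1⟫) (by fun_prop)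
      have hle := (hP.mem_left _).1 hp₀.1 _ hq.1.2.1
      have hlt : ⟪q.2, p₀.1⟫ < 1 := by
        refine lt_of_le_of_ne hle fun heq => ?_
        have h1 := M.uniq_right _ hp₀ _ hq.1.2.1 heq
        have h2 := M.uniq_left _ hp₀ _ hq.1.1 (by rw [← h1]; exact hq.1.2.2)
        have h3 : q = p₀ := Prod.ext h2 h1
        have h4 : r ≤ dist q p₀ := hq.2
        rw [h3, dist_self] at h4
        linarith
      refine ⟨min 1 (1 - ⟪q.2, p₀.1⟫), lt_min one_pos (by linarith), min_le_left _ _,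
        fun p hp hpr => ?_⟩
      have h1 : ⟪p.2, p₀.1⟫ ≤ ⟪q.2, p₀.1⟫ := hmax ⟨hp, hpr⟩
      have h2 := min_le_right 1 (1 - ⟪q.2, p₀.1⟫)
      linarith
  obtain ⟨B, hB⟩ := (isCompact_contact hP).bddAbove_image hg
  have hB' : ∀ p ∈ contact S T, g p ≤ max B 1 := fun p hp =>
    (hB (mem_image_of_mem _ hp)).trans (le_max_left _ _)
  have hB0 : 0 < max B 1 := by positivity
  have hp0 := hg0 p₀ hp₀
  refine ⟨min (1 / (g p₀ + η)) (c / max B 1), by positivity, fun s hs hs1 => ?_⟩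
  have h1 : s * (g p₀ + η) < 1 := by
    rw [← lt_div_iff₀ (by positivity)]; exact hs1.trans_le (min_le_left _ _)
  have h2 : s * max B 1 < c := by
    rw [← lt_div_iff₀ (by positivity)]; exact hs1.trans_le (min_le_right _ _)
  refine ⟨by linarith, fun p hp => ?_⟩
  rw [real_inner_smul_right]
  rcases lt_or_ge (dist p p₀) r with h3 | h3
  · have h4 := hgr p hp h3
    rw [Real.dist_eq, abs_lt] at h4
    have h5 := (hP.mem_left _).1 hp₀.1 _ hp.2.1
    nlinarith
  · have h4 := hgap p hp h3
    have h5 := hB' p hp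
    have h6 : 0 ≤ s * (g p₀ + η) := by positivity
    nlinarith

lemma div_bounds {g gm gM : ℝ} (hgm : 0 < gm) (h : gm ≤ g) (h' : g ≤ gM) :
    gm ≤ gM * gm / g ∧ gM * gm / g ≤ gM := by
  have hg : 0 < g := hgm.trans_le h
  constructor
  · rw [le_div_iff₀ hg]; nlinarith
  · rw [div_le_iff₀ hg]; nlinarith

lemma one_le_cubic {s P Q R g ε : ℝ} (hs : 0 < s) (hs1 : s < 1) (hP : 0 ≤ P) (hPg : P ≤ g)
    (hQ : 0 ≤ Q) (hQg : Q ≤ 2 * g) (hR : 0 < R) (h : ε / 2 ≤ P - Q + R)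
    (hε : s * (2 * (2 * g ^ 2 + 2 * g * R + 2 * g ^ 2 * R)) < ε) :
    1 ≤ (1 + s * P) * ((1 + s * R) * (1 - s * Q)) := by
  have hg : 0 ≤ g := hP.trans hPg
  have b1 : P * Q ≤ g * (2 * g) := by gcongr
  have b2 : R * Q ≤ R * (2 * g) := by gcongr
  have b3 : P * Q * R ≤ g * (2 * g) * R := by gcongr
  have b4 : s * (P * Q * R) ≤ 1 * (P * Q * R) := by gcongr
  have b5 : s * (P * Q + R * Q + s * (P * Q * R))
      ≤ s * (2 * g ^ 2 + 2 * g * R + 2 * g ^ 2 * R) := by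
    apply mul_le_mul_of_nonneg_left _ hs.le; linarith
  have b6 : 0 ≤ s * (P * R) := by positivity
  have b7 : 0 ≤ s * (P - Q + R + s * (P * R) - s * (P * Q + R * Q + s * (P * Q * R))) := by
    apply mul_nonneg hs.le; linarith
  linarith

lemma exists_dilation (M : CapModel S T G N V C) (hN : 0 < N) (hV : 0 < V)
    (hVS : V = volume.real S) (hC : 0 < C) (hT : 0 < volume.real T) {gm gM : ℝ} (hgm : 0 < gm)
    (lo : ∀ p ∈ contact S T, gm ≤ G p) (hi : ∀ p ∈ contact S T, G p ≤ gM) (hgM : gm ≤ gM)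
    {ε : ℝ} (hε : 0 < ε) :
    ∃ s₀ > 0, ∀ s, 0 < s → s < s₀ → ∃ δ' > 0,
      (1 + s * (gM - gm + ε))⁻¹ • floatingBody S (s ^ N) ⊆ polarBody (illuminationBody T δ') ∧
      polarBody (illuminationBody T δ') ⊆ (1 + s * (gM - gm + ε)) • floatingBody S (s ^ N) := by
  have hgM0 : 0 < gM := hgm.trans_le hgM
  have hτ : 0 < gM * gm := by positivity
  set η := min (1 / 2) (ε / (4 * gM)) with hη
  have hη0 : 0 < η := by positivity
  have hη1 : η < 1 := (min_le_left _ _).trans_lt (by norm_num)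
  have hηε : 2 * η * gM ≤ ε / 2 := by
    have : η ≤ ε / (4 * gM) := min_le_right _ _
    rw [le_div_iff₀ (by positivity)] at this
    linarith
  obtain ⟨s₁, hs₁, h1⟩ := M.le_of_mem_floatingBody hN hV hVS hgM0 hi hη0 hη1
  obtain ⟨s₂, hs₂, h2⟩ := M.mem_floatingBody_of_le hN hV hVS hgM0 hi hη0
  obtain ⟨s₃, hs₃, h3⟩ := M.le_of_mem_polarBody hN hC hT hgm lo hτ hη0 hη1
  obtain ⟨s₄, hs₄, h4⟩ := M.mem_polarBody_of_le hN hC hT hgm lo hτ hη0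
  set R := gM - gm + ε with hR
  have hR0 : 0 < R := by linarith
  set K := 2 * gM ^ 2 + 2 * gM * R + 2 * gM ^ 2 * R with hK
  have hK0 : 0 < K := by positivity
  refine ⟨min (min s₁ s₂) (min (min s₃ s₄) (min 1 (ε / (2 * K)))), by positivity,
    fun s hs hs0 => ?_⟩
  simp only [lt_min_iff] at hs0
  obtain ⟨⟨hs1, hs2⟩, ⟨hs3, hs4⟩, hs5, hs6⟩ := hs0
  rw [lt_div_iff₀ (by positivity)] at hs6
  have ha : 0 < 1 + s * R := by positivity
  refine ⟨C * (s * (gM * gm)) ^ N / volume.real T, by positivity, ?_, fun z hz => ?_⟩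
  · rintro _ ⟨z, hz, rfl⟩
    refine h4 s hs hs4 _ fun p hp => ?_
    have h5 := h1 s hs hs1 z hz p hp
    obtain ⟨h6, h7⟩ := div_bounds hgm (lo p hp) (hi p hp)
    have h8 := lo p hp
    have h9 := hi p hp
    change _ * ⟪p.2, (1 + s * R)⁻¹ • z⟫ ≤ 1
    rw [real_inner_smul_right, mul_left_comm, inv_mul_le_iff₀ ha, mul_one]
    set q := gM * gm / G p
    have hq0 : 0 < q := hgm.trans_le h6
    have hP : 0 < 1 + (1 + η) * s * q := by positivity
    refine (mul_le_mul_of_nonneg_left h5 hP.le).trans ?_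
    have h10 : 0 ≤ ((1 + η) * s * q) * ((1 - η) * s * G p) := by
      have : 0 ≤ 1 - η := by linarith
      have := M.pos p hp
      positivity
    have h11 : (1 + η) * q - (1 - η) * G p ≤ R := by
      have : η * (q + G p) ≤ η * (gM + gM) := by gcongr
      linarith
    have h12 := mul_le_mul_of_nonneg_left h11 hs.le
    linarith
  · rw [mem_smul_set_iff_inv_smul_mem₀ ha.ne']
    refine h2 s hs hs2 _ fun p hp => ?_
    have h5 := h3 s hs hs3 z hz p hp
    obtain ⟨h6, h7⟩ := div_bounds hgm (lo p hp) (hi p hp)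
    have h8 := lo p hp
    have h9 := hi p hp
    rw [real_inner_smul_right, inv_mul_le_iff₀ ha]
    have hη2 : 0 ≤ 1 - η := by linarith
    have hGp := M.pos p hp
    obtain ⟨P, hP⟩ : ∃ P, P = (1 - η) * (gM * gm / G p) := ⟨_, rfl⟩
    obtain ⟨Q, hQ⟩ : ∃ Q, Q = (1 + η) * G p := ⟨_, rfl⟩
    have hP0 : 0 ≤ P := by rw [hP]; positivity
    have hPM : P ≤ gM := by rw [hP]; nlinarith
    have hQ0 : 0 ≤ Q := by rw [hQ]; positivity
    have hQM : Q ≤ 2 * gM := by rw [hQ]; nlinarith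
    have hPQ : ε / 2 ≤ P - Q + R := by
      have : η * (gM * gm / G p + G p) ≤ η * (gM + gM) := by gcongr
      rw [hP, hQ]; linarith
    have e1 : (1 - η) * s * (gM * gm / G p) = s * P := by rw [hP]; ring
    have e2 : (1 + η) * s * G p = s * Q := by rw [hQ]; ring
    rw [e1] at h5
    rw [e2]
    have hsP : 0 < 1 + s * P := by positivity
    refine le_of_mul_le_mul_left (h5.trans ?_) hsP
    exact one_le_cubic hs hs5 hP0 hPM hQ0 hQM hR0 hPQ hs6

lemma le_dilation (M : CapModel S T G N V C) (hN : 0 < N) (hV : 0 < V)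
    (hVS : V = volume.real S) (hC : 0 < C) (hT : 0 < volume.real T)
    {pm pM : Euc n × Euc n} (hpm : pm ∈ contact S T) (hpM : pM ∈ contact S T)
    (lo : ∀ p ∈ contact S T, G pm ≤ G p) (hi : ∀ p ∈ contact S T, G p ≤ G pM)
    {ε : ℝ} (hε : 0 < ε) :
    ∃ s₀ > 0, ∀ s, 0 < s → s < s₀ → ∀ δ', ∀ a, 1 ≤ a →
      a⁻¹ • floatingBody S (s ^ N) ⊆ polarBody (illuminationBody T δ') →
      polarBody (illuminationBody T δ') ⊆ a • floatingBody S (s ^ N) →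
      1 + s * (G pM - G pm - ε) ≤ a := by
  have hgm := M.pos pm hpm
  have hgM0 := M.pos pM hpM
  have hgM := lo pM hpM
  set gm := G pm with hgm'
  set gM := G pM with hgM'
  have hτ : 0 < gM * gm := by positivity
  set η := min (1 / 2) (ε / (2 * (2 * gM + 1))) with hη
  have hη0 : 0 < η := by positivity
  have hη2 : η ≤ 1 / 2 := min_le_left _ _
  have hη1 : η < 1 := hη2.trans_lt (by norm_num)
  have hηε : η * (2 * gM + 1) ≤ ε / 2 := by
    have : η ≤ ε / (2 * (2 * gM + 1)) := min_le_right _ _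
    rw [le_div_iff₀ (by positivity)] at this
    linarith
  obtain ⟨s₁, hs₁, h1⟩ := M.le_of_mem_floatingBody hN hV hVS hgM0 hi hη0 hη1
  obtain ⟨s₂, hs₂, h2⟩ := M.mem_floatingBody_of_le hN hV hVS hgM0 hi hη0
  obtain ⟨s₃, hs₃, h3⟩ := M.le_of_mem_polarBody hN hC hT hgm lo hτ hη0 hη1
  obtain ⟨s₄, hs₄, h4⟩ := M.mem_polarBody_of_le hN hC hT hgm lo hτ hη0
  obtain ⟨s₅, hs₅, h5⟩ := M.radial_le (g := fun p => (1 + η) * G p)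
    (continuousOn_const.mul M.cont) (fun p hp => by have := M.pos p hp; positivity) hpm hη0
  obtain ⟨s₆, hs₆, h6⟩ := M.radial_le (g := fun p => (1 + η) * (gM * gm / G p))
    (continuousOn_const.mul (continuousOn_const.div M.cont fun p hp => (M.pos p hp).ne'))
    (fun p hp => by have := M.pos p hp; positivity) hpM hη0
  have e1 : gM * gm / gm = gM := mul_div_cancel_right₀ _ hgm.ne'
  have e2 : gM * gm / gM = gm := mul_div_cancel_left₀ _ hgM0.ne'
  simp only [← hgM', e2, ← hgm'] at h5 h6
  set X := (1 + η) * gm + η with hX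
  set Y := (1 - η) * gM with hY
  have hη3 : 0 < 1 - η := by linarith
  have hX0 : 0 < X := by positivity
  have hY0 : 0 < Y := by positivity
  have hXM : X ≤ 2 * gM + 1 := by rw [hX]; nlinarith
  have hYM : Y ≤ gM := by rw [hY]; nlinarith
  have hXY : X * Y ≤ (2 * gM + 1) * gM := by gcongr
  have hYX : gM - gm - ε / 2 ≤ Y - X := by rw [hX, hY]; nlinarith
  refine ⟨min (min s₁ s₂) (min (min s₃ s₄) (min (min s₅ s₆) (ε / (2 * ((2 * gM + 1) * gM))))),
    by positivity, fun s hs hs0 δ' a ha hsub hsup => ?_⟩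
  simp only [lt_min_iff] at hs0
  obtain ⟨⟨hs1, hs2⟩, ⟨hs3, hs4⟩, ⟨hs5, hs6⟩, hs7⟩ := hs0
  rw [lt_div_iff₀ (by positivity)] at hs7
  have ha0 : 0 < a := by linarith
  suffices hmain : (1 - s * X) * (1 + s * Y) ≤ a by
    refine le_trans ?_ hmain
    have b1 : s * (X * Y) ≤ s * ((2 * gM + 1) * gM) := by gcongr
    have b2 : 0 ≤ s * (Y - X - s * (X * Y) - (gM - gm - ε)) := by
      apply mul_nonneg hs.le; linarith
    linarith
  rcases le_total (C * (s * (gM * gm)) ^ N / volume.real T) δ' with hδ | hδ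
  · have hq : (1 - s * X) • pm.1 ∈ floatingBody S (s ^ N) := by
      refine h2 s hs hs2 _ fun p hp => ?_
      rw [mul_comm (1 + η) s, mul_assoc]
      exact (h5 s hs hs5).2 p hp
    have h7 := h3 s hs hs3 _ (polarBody_anti (illuminationBody_mono T hδ)
      (hsub (smul_mem_smul_set hq))) pm hpm
    rw [real_inner_smul_right, real_inner_smul_right, hpm.2.2, mul_one, ← hgm', e1, mul_left_comm,
      inv_mul_le_iff₀ ha0, mul_one] at h7
    rw [hY]
    linarith
  · have hq : (1 - s * X) • pM.1 ∈ polarBody (illuminationBody T δ') := by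
      refine polarBody_anti (illuminationBody_mono T hδ) (h4 s hs hs4 _ fun p hp => ?_)
      have h7 := (h6 s hs hs6).2 p hp
      have hGp := M.pos p hp
      have h8 : 0 < (1 + η) * (gM * gm / G p) := by positivity
      rw [mul_comm (1 + η) s, mul_assoc]
      set Z := (1 + η) * (gM * gm / G p)
      have h9 : 0 < 1 + s * Z := by positivity
      refine (mul_le_mul_of_nonneg_left h7 h9.le).trans ?_
      nlinarith [mul_pos hs h8]
    have h7 := hsup hq
    rw [mem_smul_set_iff_inv_smul_mem₀ ha0.ne'] at h7
    have h8 := h1 s hs hs1 _ h7 pM hpM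
    rw [real_inner_smul_right, real_inner_smul_right, hpM.2.2, mul_one, ← hgM',
      inv_mul_le_iff₀ ha0] at h8
    have e3 : (1 - η) * s * gM = s * Y := by rw [hY]; ring
    rw [e3] at h8
    have h9 : 0 < 1 + s * Y := by positivity
    refine (mul_le_mul_of_nonneg_right h8 h9.le).trans ?_
    have h10 : 0 ≤ a * (s * Y) ^ 2 := by positivity
    linarith

end CapModel

lemma exists_dilation_of_balls {n : ℕ} {A B : Set (Euc n)} {r R : ℝ} (hr : 0 < r)
    (hA : closedBall 0 r ⊆ A) (hB : closedBall 0 r ⊆ B) (hA' : A ⊆ closedBall 0 R)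
    (hB' : B ⊆ closedBall 0 R) : ∃ a : ℝ, 1 ≤ a ∧ a⁻¹ • A ⊆ B ∧ B ⊆ a • A := by
  have h : ∀ w : Euc n, ‖w‖ ≤ R → ‖(max 1 (R / r) : ℝ)⁻¹ • w‖ ≤ r := fun w hw => by
    rw [norm_smul, norm_inv, Real.norm_eq_abs, abs_of_pos (by positivity),
      inv_mul_le_iff₀ (by positivity)]
    refine hw.trans ?_
    have := le_max_right 1 (R / r)
    rwa [div_le_iff₀ hr] at this
  refine ⟨max 1 (R / r), le_max_left _ _, ?_, fun z hz => ?_⟩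
  · rintro _ ⟨z, hz, rfl⟩
    exact hB (mem_closedBall_zero_iff.2 (h z (mem_closedBall_zero_iff.1 (hA' hz))))
  · rw [mem_smul_set_iff_inv_smul_mem₀ (by positivity)]
    exact hA (mem_closedBall_zero_iff.2 (h z (mem_closedBall_zero_iff.1 (hB' hz))))

namespace CapModel

variable {n : ℕ} {S T : Set (Euc n)} {G : Euc n × Euc n → ℝ} {N V C : ℝ}

lemma exists_some_dilation (M : CapModel S T G N V C) (hn : 1 ≤ n) (hN : 0 < N) (hV : 0 < V)
    (hVS : V = volume.real S) {gM : ℝ} (hgM : 0 < gM) (hi : ∀ p ∈ contact S T, G p ≤ gM) :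
    ∃ s₀ > 0, ∀ s, 0 < s → s < s₀ → ∀ δ' > 0, ∃ a : ℝ, 1 ≤ a ∧
      a⁻¹ • floatingBody S (s ^ N) ⊆ polarBody (illuminationBody T δ') ∧
      polarBody (illuminationBody T δ') ⊆ a • floatingBody S (s ^ N) := by
  have hP := M.polar
  obtain ⟨s₁, hs₁, h1⟩ := M.le_of_mem_floatingBody hN hV hVS hgM hi (η := 1 / 2) (by norm_num)
    (by norm_num)
  obtain ⟨s₂, hs₂, h2⟩ := M.mem_floatingBody_of_le hN hV hVS hgM hi (η := 1) one_pos
  obtain ⟨B, hB, hbound⟩ := hP.exists_bound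
  obtain ⟨R, hR, hSR⟩ := exists_norm_bound hP.compact_left
  refine ⟨min s₁ (min s₂ (1 / (4 * gM))), by positivity, fun s hs hs0 δ' hδ' => ?_⟩
  simp only [lt_min_iff] at hs0
  obtain ⟨hs1, hs2, hs3⟩ := hs0
  rw [lt_div_iff₀ (by positivity)] at hs3
  obtain ⟨r, hr, hball⟩ := hP.symm.exists_ball
  obtain ⟨R', hR', hTR⟩ := isBounded_illuminationBody hn hP.compact_right hr hball hδ'.le
  refine exists_dilation_of_balls (r := min (1 / (2 * B)) (1 / R')) (R := R) (by positivity)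
    (fun z hz => h2 s hs hs2 z fun p hp => ?_) (fun z hz x hx => ?_) (fun z hz => ?_)
    (fun z hz => ?_)
  · rw [mem_closedBall_zero_iff, le_min_iff] at hz
    have h3 := hbound p hp z
    have h4 : B * ‖z‖ ≤ B * (1 / (2 * B)) := by gcongr; exact hz.1
    have h5 : B * (1 / (2 * B)) = 1 / 2 := by field_simp
    have h6 := hi p hp
    nlinarith
  · rw [mem_closedBall_zero_iff, le_min_iff] at hz
    have h3 := real_inner_le_norm x z
    have h4 : ‖x‖ * ‖z‖ ≤ R' * (1 / R') := by gcongr; exacts [hTR x hx, hz.2]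
    rw [mul_one_div_cancel hR'.ne'] at h4
    linarith
  · refine mem_closedBall_zero_iff.2 (hSR z (hP.mem_of_contact fun p hp => ?_))
    have h3 := h1 s hs hs1 z hz p hp
    have h4 := M.pos p hp
    have h5 : 0 < (1 - 1 / 2) * s * G p := by
      have : (0:ℝ) < 1 - 1 / 2 := by norm_num
      positivity
    linarith
  · refine mem_closedBall_zero_iff.2 (hSR z ((hP.mem_left z).2 fun m hm =>
      hz m (subset_illuminationBody hP.compact_right hP.convex_right hδ'.le hm)))

lemma abs_dualDist_sub_le (M : CapModel S (polarBody S) G N V C) (hn : 1 ≤ n) (hN : 0 < N)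
    (hV : 0 < V) (hVS : V = volume.real S) (hC : 0 < C) (hT : 0 < volume.real (polarBody S))
    {pm pM : Euc n × Euc n} (hpm : pm ∈ contact S (polarBody S))
    (hpM : pM ∈ contact S (polarBody S)) (lo : ∀ p ∈ contact S (polarBody S), G pm ≤ G p)
    (hi : ∀ p ∈ contact S (polarBody S), G p ≤ G pM) {ε : ℝ} (hε : 0 < ε) :
    ∃ s₀ > 0, ∀ s, 0 < s → s < s₀ →
      |(dualDist S (s ^ N) - 1) / s - (G pM - G pm)| ≤ ε := by
  obtain ⟨s₁, hs₁, h1⟩ := M.exists_dilation hN hV hVS hC hT (M.pos pm hpm) lo hi (lo pM hpM) hε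
  obtain ⟨s₂, hs₂, h2⟩ := M.le_dilation hN hV hVS hC hT hpm hpM lo hi hε
  obtain ⟨s₃, hs₃, h3⟩ := M.exists_some_dilation hn hN hV hVS (M.pos pM hpM) hi
  refine ⟨min s₁ (min s₂ s₃), by positivity, fun s hs hs0 => ?_⟩
  simp only [lt_min_iff] at hs0
  obtain ⟨hs1, hs2, hs3⟩ := hs0
  have hlow : ∀ δ' > 0, 1 + s * (G pM - G pm - ε) ≤
      bodyDist (floatingBody S (s ^ N)) (polarBody (illuminationBody (polarBody S) δ')) :=
    fun δ' hδ' => le_csInf (h3 s hs hs3 δ' hδ') fun a ha => h2 s hs hs2 δ' a ha.1 ha.2.1 ha.2.2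
  obtain ⟨δ₀, hδ₀, hsub, hsup⟩ := h1 s hs hs1
  have hmin := lo pM hpM
  have hup : bodyDist (floatingBody S (s ^ N))
      (polarBody (illuminationBody (polarBody S) δ₀)) ≤ 1 + s * (G pM - G pm + ε) := by
    refine csInf_le ⟨1, fun a ha => ha.1⟩ ⟨?_, hsub, hsup⟩
    have : 0 ≤ s * (G pM - G pm + ε) := mul_nonneg hs.le (by linarith)
    linarith
  have hd1 : 1 + s * (G pM - G pm - ε) ≤ dualDist S (s ^ N) := by
    refine le_csInf ⟨_, δ₀, hδ₀, rfl⟩ ?_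
    rintro _ ⟨δ', hδ', rfl⟩
    exact hlow δ' hδ'
  have hd2 : dualDist S (s ^ N) ≤ 1 + s * (G pM - G pm + ε) := by
    refine le_trans (csInf_le ?_ ⟨δ₀, hδ₀, rfl⟩) hup
    refine ⟨1 + s * (G pM - G pm - ε), ?_⟩
    rintro _ ⟨δ', hδ', rfl⟩
    exact hlow δ' hδ'
  rw [abs_le]
  constructor
  · rw [le_sub_iff_add_le, le_div_iff₀ hs]; linarith
  · rw [sub_le_iff_le_add, div_le_iff₀ hs]; linarith

end CapModel

lemma IsSymConvexBody.exists_ball {n : ℕ} {S : Set (Euc n)} (hS : IsSymConvexBody S) :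
    ∃ r > 0, closedBall 0 r ⊆ S := by
  obtain ⟨-, hconv, ⟨x, hx⟩, hsymm⟩ := hS
  have hx' : -x ∈ interior S := by
    have h1 : interior S = -interior S := by
      conv_lhs => rw [hsymm]
      exact ((Homeomorph.neg (Euc n)).preimage_interior S).symm
    rw [h1]; simpa using hx
  have h0 : (0 : Euc n) ∈ interior S := by
    have := hconv.interior hx hx' (a := 1 / 2) (b := 1 / 2) (by norm_num) (by norm_num)
      (by norm_num)
    simpa using this
  exact Metric.nhds_basis_closedBall.mem_iff.1 (mem_interior_iff_mem_nhds.1 h0)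

lemma IsSymConvexBody.polarPair {n : ℕ} {S : Set (Euc n)} (hS : IsSymConvexBody S) :
    PolarPair S (polarBody S) := by
  obtain ⟨r, hr, hball⟩ := hS.exists_ball
  obtain ⟨hcomp, hconv, -, -⟩ := hS
  have hclosed : IsClosed (polarBody S) := by
    have : polarBody S = ⋂ x ∈ S, {y | ⟪x, y⟫ ≤ 1} := by ext; simp [polarBody]
    rw [this]
    exact isClosed_biInter fun x _ => isClosed_le (by fun_prop) continuous_const
  have hsub : polarBody S ⊆ closedBall 0 (1 / r) := fun y hy => by
    rw [mem_closedBall_zero_iff]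
    rcases eq_or_ne y 0 with rfl | hy0
    · rw [norm_zero]; positivity
    have hy1 : 0 < ‖y‖ := norm_pos_iff.2 hy0
    have h1 := hy ((r / ‖y‖) • y) (hball (by
      rw [mem_closedBall_zero_iff, norm_smul, Real.norm_eq_abs, abs_of_pos (by positivity)]
      field_simp; rfl))
    rw [real_inner_smul_left, real_inner_self_eq_norm_sq] at h1
    rw [le_div_iff₀ hr]
    calc ‖y‖ * r = r / ‖y‖ * ‖y‖ ^ 2 := by field_simp
      _ ≤ 1 := h1
  refine ⟨hcomp, hconv, (isCompact_closedBall 0 (1 / r)).of_isClosed_subset hclosed hsub, ?_,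
    fun z => ⟨fun hz m hm => ?_, fun h => ?_⟩, fun m => Iff.rfl⟩
  · intro y hy z hz a b ha hb hab x hx
    have h1 := hy x hx
    have h2 := hz x hx
    rw [inner_add_right, real_inner_smul_right, real_inner_smul_right]
    nlinarith
  · rw [real_inner_comm]; exact hm z hz
  · by_contra hz
    obtain ⟨f, c, hf, hc⟩ := geometric_hahn_banach_closed_point hconv hcomp.isClosed hz
    have hc0 : 0 < c := by
      have := hf 0 (hball (mem_closedBall_self hr.le))
      simpa using this
    obtain ⟨w, rfl⟩ := (InnerProductSpace.toDual ℝ (Euc n)).surjective f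
    simp only [InnerProductSpace.toDual_apply_apply] at hf hc
    have h1 := h (c⁻¹ • w) fun x hx => by
      rw [real_inner_smul_right, real_inner_comm, inv_mul_le_iff₀ hc0, mul_one]
      exact (hf x hx).le
    rw [real_inner_smul_left, inv_mul_le_iff₀ hc0, mul_one] at h1
    linarith

lemma IsOuterNormalAt.inner_pos {n : ℕ} {S : Set (Euc n)} {x ν : Euc n}
    (hν : IsOuterNormalAt S x ν) {r : ℝ} (hr : 0 < r) (hball : closedBall 0 r ⊆ S) :
    0 < ⟪x, ν⟫ := by
  have h1 := hν.2 (r • ν) (hball (by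
    rw [mem_closedBall_zero_iff, norm_smul, hν.1, mul_one, Real.norm_eq_abs, abs_of_pos hr]))
  rw [real_inner_smul_left, real_inner_self_eq_norm_sq, hν.1] at h1
  linarith

lemma nonempty_isometry {n : ℕ} (hn : 1 ≤ n) :
    Nonempty (WithLp 2 (Euc (n - 1) × ℝ) ≃ₗᵢ[ℝ] Euc n) := by
  have h : Module.finrank ℝ (WithLp 2 (Euc (n - 1) × ℝ)) = n := by
    rw [(WithLp.linearEquiv 2 ℝ (Euc (n - 1) × ℝ)).finrank_eq, Module.finrank_prod]
    simp; omega
  exact ⟨((stdOrthonormalBasis ℝ (WithLp 2 (Euc (n - 1) × ℝ))).reindex (finCongr h)).repr⟩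

lemma rpow_Gfun {n : ℕ} (hn : 1 ≤ n) {V ω κ h d : ℝ} (hV : 0 < V) (hω : 0 < ω) (hκ : 0 < κ)
    (hh : 0 < h) (hd : 0 ≤ d) (hdet : d ^ 2 = κ / h ^ (n + 1)) :
    d * V = ω * 2 ^ ((((n - 1 : ℕ) : ℝ) + 2) / 2) / (((n - 1 : ℕ) : ℝ) + 2) *
      (((n + 1 : ℝ) ^ ((2:ℝ) / (n + 1)) / 2) * (V / ω) ^ ((2:ℝ) / (n + 1)) *
        κ ^ ((1:ℝ) / (n + 1)) / h) ^ (((n : ℝ) + 1) / 2) := by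
  have hcast : ((n - 1 : ℕ) : ℝ) + 2 = n + 1 := by
    rw [Nat.cast_sub hn]; push_cast; ring
  have hn1 : (0:ℝ) < n + 1 := by positivity
  have e1 : (2:ℝ) / (n + 1) * (((n : ℝ) + 1) / 2) = 1 := by field_simp
  have e2 : (1:ℝ) / (n + 1) * (((n : ℝ) + 1) / 2) = 1 / 2 := by field_simp
  have hd' : d = κ ^ ((1:ℝ) / 2) / h ^ (((n : ℝ) + 1) / 2) := by
    rw [← Real.sqrt_sq hd, hdet, Real.sqrt_eq_rpow, Real.div_rpow hκ.le (by positivity),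
      ← Real.rpow_natCast, ← Real.rpow_mul hh.le]
    congr 2; push_cast; ring
  rw [hcast, Real.div_rpow (by positivity) hh.le, Real.mul_rpow (by positivity) (by positivity),
    Real.mul_rpow (by positivity) (by positivity), Real.div_rpow (by positivity) (by norm_num),
    ← Real.rpow_mul hn1.le, ← Real.rpow_mul (by positivity), ← Real.rpow_mul hκ.le, e1, e2,
    Real.rpow_one, Real.rpow_one, hd']
  field_simp

lemma exists_capModel {n : ℕ} (hn : 2 ≤ n) (S : Set (Euc n)) (u : Euc n → Euc n) (κ : Euc n → ℝ)
    (hS : IsSymConvexBody S) (hC2 : IsC2Body S u κ) (hκ : ∀ x ∈ frontier S, 0 < κ x) :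
    ∃ C > 0, CapModel S (polarBody S) (fun p => Gfun S u κ p.1) (((n:ℝ) + 1) / 2)
      (volume.real S) C := by
  obtain ⟨I⟩ := nonempty_isometry (n := n) (by omega)
  set e : Euc n := I (WithLp.toLp 2 (0, 1)) with he
  have he1 : ‖e‖ = 1 := by
    rw [he, I.norm_map, WithLp.prod_norm_eq_of_L2]; simp
  have hPP := hS.polarPair
  obtain ⟨r, hr, hball⟩ := hS.exists_ball
  have hV : 0 < volume.real S :=
    ENNReal.toReal_pos (((measure_closedBall_pos volume (0 : Euc n) hr).trans_le
      (measure_mono hball)).ne') hPP.compact_left.measure_lt_top.ne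
  have hω : 0 < volume.real (ball (0 : Euc (n - 1)) 1) :=
    ENNReal.toReal_pos (measure_ball_pos _ _ one_pos).ne' measure_ball_lt_top.ne
  refine ⟨_, div_pos (mul_pos (volume_paraHat_pos he1) (volume_paraCap_pos he1)) hV,
    capModel_of_osc (by omega) he1 hPP hV (fun p hp => ?_) fun p hp => ?_⟩
  · have hx := mem_frontier_of_contact hPP (y := p.1) (m := p.2) hp
    have h1 := (hC2 _ hx).1.inner_pos hr hball
    have h2 := hκ _ hx
    have h3 : 0 < cConst n S := by
      have : 0 < (volume S).toReal / (volume (ball (0 : Euc (n - 1)) 1)).toReal := div_pos hV hω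
      unfold cConst
      positivity
    unfold Gfun
    positivity
  · have hx := mem_frontier_of_contact hPP (y := p.1) (m := p.2) hp
    have h1 := (hC2 _ hx).1.inner_pos hr hball
    obtain ⟨J, J', hJ, hJ', hdet, hdet'⟩ :=
      exists_osc_of_curvature hn hPP hx (hC2 _ hx).1 (hC2 _ hx).2 (hκ _ hx) h1 I
    have h2 := hJ.uniq_right p.2 hp.2.1 hp.2.2
    rw [← h2] at hJ hJ'
    refine ⟨J, J', hJ, hJ', hdet', ?_⟩
    rw [he, volume_paraCap_one_one I]
    exact rpow_Gfun (by omega) hV hω (hκ _ hx) h1 (abs_nonneg _) hdet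

/-- Theorem 1.3 (main2, `C²₊` case): for a centrally symmetric convex body `S ⊂ ℝⁿ` of class
`C²₊`, `lim_{δ→0} (d_S(δ) − 1)/δ^{2/(n+1)} = G_max − G_min`. -/
theorem statement1 {n : ℕ} (hn : 2 ≤ n) (S : Set (Euc n))
    (u : Euc n → Euc n) (κ : Euc n → ℝ)
    (hS : IsSymConvexBody S) (hC2 : IsC2Body S u κ)
    (hκ : ∀ x ∈ frontier S, 0 < κ x) :
    Tendsto (fun δ : ℝ => (dualDist S δ - 1) / δ ^ ((2:ℝ)/(n+1))) (𝓝[>] 0)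
      (𝓝 (sSup (Gfun S u κ '' frontier S) - sInf (Gfun S u κ '' frontier S))) := by
  obtain ⟨C, hC, M⟩ := exists_capModel hn S u κ hS hC2 hκ
  have hPP := hS.polarPair
  obtain ⟨r, hr, hball⟩ := hS.exists_ball
  obtain ⟨r', hr', hball'⟩ := hPP.symm.exists_ball
  have hV : 0 < volume.real S :=
    ENNReal.toReal_pos (((measure_closedBall_pos volume (0 : Euc n) hr).trans_le
      (measure_mono hball)).ne') hPP.compact_left.measure_lt_top.ne
  have hT : 0 < volume.real (polarBody S) :=
    ENNReal.toReal_pos (((measure_closedBall_pos volume (0 : Euc n) hr').trans_le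
      (measure_mono hball')).ne') hPP.compact_right.measure_lt_top.ne
  have hΓ := isCompact_contact hPP
  have hΓne : (contact S (polarBody S)).Nonempty := by
    have : Nontrivial (Euc n) := by
      have : Nonempty (Fin n) := ⟨⟨0, by omega⟩⟩
      infer_instance
    obtain ⟨v, hv⟩ := exists_ne (0 : Euc n)
    obtain ⟨c, -, y, hy⟩ := hPP.exists_contact hv
    exact ⟨_, hy⟩
  obtain ⟨pm, hpm, hmin⟩ := hΓ.exists_isMinOn hΓne M.cont
  obtain ⟨pM, hpM, hmax⟩ := hΓ.exists_isMaxOn hΓne M.cont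
  have hcontact : ∀ x ∈ frontier S, ∃ m, (x, m) ∈ contact S (polarBody S) := fun x hx => by
    have h1 := (hC2 x hx).1.inner_pos hr hball
    refine ⟨⟪x, u x⟫⁻¹ • u x, hPP.compact_left.isClosed.frontier_subset hx, fun z hz => ?_, ?_⟩
    · rw [real_inner_smul_right, inv_mul_le_iff₀ h1, mul_one]
      exact (hC2 x hx).1.2 z hz
    · change ⟪⟪x, u x⟫⁻¹ • u x, x⟫ = 1
      rw [real_inner_smul_left, real_inner_comm x (u x), inv_mul_cancel₀ h1.ne']
  have hsup : sSup (Gfun S u κ '' frontier S) = Gfun S u κ pM.1 := by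
    refine IsGreatest.csSup_eq ⟨mem_image_of_mem _ (mem_frontier_of_contact hPP hpM), ?_⟩
    rintro _ ⟨x, hx, rfl⟩
    obtain ⟨m, hm⟩ := hcontact x hx
    exact hmax hm
  have hinf : sInf (Gfun S u κ '' frontier S) = Gfun S u κ pm.1 := by
    refine IsLeast.csInf_eq ⟨mem_image_of_mem _ (mem_frontier_of_contact hPP hpm), ?_⟩
    rintro _ ⟨x, hx, rfl⟩
    obtain ⟨m, hm⟩ := hcontact x hx
    exact hmin hm
  rw [hsup, hinf]
  have hn1 : (0:ℝ) < n + 1 := by positivity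
  have hN : (0:ℝ) < ((n:ℝ) + 1) / 2 := by positivity
  have hpow : Tendsto (fun δ : ℝ => δ ^ ((2:ℝ) / (n + 1))) (𝓝[>] 0) (𝓝 0) := by
    have h1 := (Real.continuousAt_rpow_const 0 ((2:ℝ) / (n + 1)) (Or.inr (by positivity))).tendsto
    rw [Real.zero_rpow (by positivity)] at h1
    exact h1.mono_left nhdsWithin_le_nhds
  rw [Metric.tendsto_nhds]
  intro ε hε
  obtain ⟨s₀, hs₀, h⟩ := M.abs_dualDist_sub_le (by omega) hN hV rfl hC hT hpm hpM
    (fun p hp => hmin hp) (fun p hp => hmax hp) (half_pos hε)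
  filter_upwards [hpow.eventually (gt_mem_nhds hs₀), self_mem_nhdsWithin] with δ h1 (h2 : 0 < δ)
  have h3 := h (δ ^ ((2:ℝ) / (n + 1))) (by positivity) h1
  rw [← Real.rpow_mul h2.le, show (2:ℝ) / (n + 1) * (((n:ℝ) + 1) / 2) = 1 by field_simp,
    Real.rpow_one] at h3
  rw [Real.dist_eq]
  exact h3.trans_lt (half_lt_self hε)
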